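/- arXiv:1007.0583 — 9 statements merged into one kernel-verified Lean document; each statement's English description precedes it below -/
import Mathlib

section
/- Let s ≥ 2 with prime decomposition s = p₁^{e₁}·…·p_d^{e_d}, and fix any i. The semigroup ⟨μ_{p_i}, σ⟩ ⊆ CAT(Λ_s^ℕ) generated by the multiplication transformation μ_{p_i} and the shift σ has the ID property if and only if s is not a power of a prime. -/
/-- The left shift on one-sided sequences over the alphabet `A`. -/
def shiftN (A : Type) : (ℕ → A) → (ℕ → A) := fun a k => a (k + 1)

/-- A cellular automaton transformation of the one-sided full shift over `A`:
a continuous map commuting with the left shift. -/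
def IsCAT (A : Type) [TopologicalSpace A] (τ : (ℕ → A) → (ℕ → A)) : Prop :=
  Continuous τ ∧ τ ∘ shiftN A = shiftN A ∘ τ

/-- Membership in the semigroup generated (under composition) by a set of transformations. -/
inductive InGen {Ω : Type} (S : Set (Ω → Ω)) : (Ω → Ω) → Prop
  | base {τ : Ω → Ω} : τ ∈ S → InGen S τ
  | comp {τ μ : Ω → Ω} : InGen S τ → InGen S μ → InGen S (τ ∘ μ)

/-- The semigroup generated (under composition) by a set of transformations. -/
def gen {Ω : Type} (S : Set (Ω → Ω)) : Set (Ω → Ω) := {τ | InGen S τ}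

/-- A family of transformations of a space `Ω` has the ID ("Infinite is Dense") property
if every closed invariant proper subset of `Ω` is finite. -/
def HasID {Ω : Type} [TopologicalSpace Ω] (S : Set (Ω → Ω)) : Prop :=
  ∀ A : Set Ω, IsClosed A → (∀ τ ∈ S, ∀ x ∈ A, τ x ∈ A) → A ≠ Set.univ → A.Finite

/-- The multiplication-by-`p` cellular automaton transformation on `Λ_s^ℕ`:
`μ_p(a)_k = (p·a_k + ⌊p·a_{k+1}/s⌋) mod s`. -/
def muP (s p : ℕ) : (ℕ → Fin s) → (ℕ → Fin s) := fun a k =>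
  if h : 0 < s then ⟨(p * (a k).val + p * (a (k + 1)).val / s) % s, Nat.mod_lt _ h⟩
  else a k

open Filter Topology

/-- Two integers `P, S ≥ 2` such that no positive power of `S` is a power of `P`. -/
def MulIndep (P S : ℕ) : Prop := 2 ≤ P ∧ 2 ≤ S ∧ ∀ m n : ℕ, P ^ m = S ^ n → n = 0

lemma MulIndep.pow_pow {P S : ℕ} (h : MulIndep P S) {u v : ℕ} (hu : 0 < u) (hv : 0 < v) :
    MulIndep (P ^ u) (S ^ v) := by
  refine ⟨h.1.trans (Nat.le_self_pow hu.ne' _), h.2.1.trans (Nat.le_self_pow hv.ne' _), ?_⟩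
  intro m n hmn
  rw [← pow_mul, ← pow_mul] at hmn
  have := h.2.2 _ _ hmn
  rcases mul_eq_zero.mp this with h0 | h0
  · omega
  · exact h0

lemma MulIndep.irrational_log_div_log {P S : ℕ} (h : MulIndep P S) :
    Irrational (Real.log P / Real.log S) := by
  obtain ⟨hP, hS, hI⟩ := h
  have hlP : 0 < Real.log P := Real.log_pos (by exact_mod_cast hP)
  have hlS : 0 < Real.log S := Real.log_pos (by exact_mod_cast hS)
  rintro ⟨q, hq⟩
  have hq0 : 0 < q := by
    have : (0 : ℝ) < q := by rw [hq]; positivity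
    exact_mod_cast this
  have hnum : ((q.num.toNat : ℕ) : ℝ) = (q.num : ℝ) := by
    exact_mod_cast Int.toNat_of_nonneg (Rat.num_pos.mpr hq0).le
  have hqd : (q : ℝ) = q.num.toNat / q.den := by rw [hnum, Rat.cast_def]
  have hden : (0 : ℝ) < q.den := by exact_mod_cast q.pos
  have hlog : Real.log ((P : ℝ) ^ q.den) = Real.log ((S : ℝ) ^ q.num.toNat) := by
    rw [Real.log_pow, Real.log_pow]
    rw [hqd] at hq
    field_simp at hq
    linarith
  have hpow : (P : ℝ) ^ q.den = (S : ℝ) ^ q.num.toNat :=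
    Real.log_injOn_pos (Set.mem_Ioi.mpr (by positivity)) (Set.mem_Ioi.mpr (by positivity)) hlog
  have := hI q.den q.num.toNat (by exact_mod_cast hpow)
  have := Rat.num_pos.mpr hq0
  omega

/-- Non-negative integer combinations of two positive reals with irrational ratio have gaps
tending to zero. -/
lemma exists_nat_combination_mem_Icc {α β : ℝ} (hα : 0 < α) (hβ : 0 < β)
    (hirr : Irrational (α / β)) {ε : ℝ} (hε : 0 < ε) :
    ∃ L₀ : ℝ, ∀ L ≥ L₀, ∃ m n : ℕ, m * α + n * β ∈ Set.Icc L (L + ε) := by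
  obtain ⟨δ, hδ, ⟨hδ0, hδε⟩⟩ :=
    (dense_addSubgroupClosure_pair_iff.mpr hirr).exists_mem_open isOpen_Ioo
      (Set.nonempty_Ioo.mpr hε)
  obtain ⟨m, n, hmn⟩ := AddSubgroup.mem_closure_pair.mp hδ
  have hm : (m : ℝ) = (m.toNat : ℝ) - ((-m).toNat : ℝ) := by
    exact_mod_cast (Int.toNat_sub_toNat_neg m).symm
  have hn : (n : ℝ) = (n.toNat : ℝ) - ((-n).toNat : ℝ) := by
    exact_mod_cast (Int.toNat_sub_toNat_neg n).symm
  rw [zsmul_eq_mul, zsmul_eq_mul, hm, hn] at hmn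
  set a := m.toNat
  set b := (-m).toNat
  set c := n.toNat
  set d := (-n).toNat
  set V : ℝ := (b + 1) * α + d * β with hV
  have hV0 : 0 < V := by positivity
  refine ⟨⌈V / δ⌉₊ * V, fun L hL => ?_⟩
  have hL0 : 0 ≤ L := le_trans (by positivity) hL
  set K := ⌊L / V⌋₊
  have hK1 : K * V ≤ L := (le_div_iff₀ hV0).mp (Nat.floor_le (by positivity))
  have hK2 : L < (K + 1) * V := (div_lt_iff₀ hV0).mp (Nat.lt_floor_add_one _)
  have hK3 : ⌈V / δ⌉₊ ≤ K := Nat.le_floor ((le_div_iff₀ hV0).mpr hL)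
  set j := ⌈(L - K * V) / δ⌉₊
  have hj1 : L - K * V ≤ j * δ := (div_le_iff₀ hδ0).mp (Nat.le_ceil _)
  have hj2 : (j : ℝ) * δ < L - K * V + δ := by
    have := Nat.ceil_lt_add_one (a := (L - K * V) / δ) (div_nonneg (by linarith) hδ0.le)
    calc (j : ℝ) * δ < ((L - K * V) / δ + 1) * δ := by gcongr
      _ = L - K * V + δ := by field_simp
  have hjK : j ≤ K := le_trans (Nat.ceil_mono (by gcongr; linarith)) hK3
  refine ⟨(K - j) * (b + 1) + j * (a + 1), (K - j) * d + j * c, ?_⟩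
  have key : (((K - j) * (b + 1) + j * (a + 1) : ℕ) : ℝ) * α
      + (((K - j) * d + j * c : ℕ) : ℝ) * β = K * V + j * δ := by
    push_cast [Nat.cast_sub hjK]
    rw [← hmn, hV]
    ring
  rw [key]
  constructor <;> linarith

lemma MulIndep.exists_pow_mul_pow_mem_Icc {P S : ℕ} (h : MulIndep P S) {ε : ℝ} (hε : 0 < ε) :
    ∃ R₀ > 0, ∀ R ≥ R₀, ∃ m n : ℕ, (P : ℝ) ^ m * (S : ℝ) ^ n ∈ Set.Icc R (R * (1 + ε)) := by
  have hP : (0 : ℝ) < P := by have := h.1; positivity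
  have hS : (0 : ℝ) < S := by have := h.2.1; positivity
  obtain ⟨L₀, hL₀⟩ := exists_nat_combination_mem_Icc
    (Real.log_pos (by exact_mod_cast h.1)) (Real.log_pos (by exact_mod_cast h.2.1))
    h.irrational_log_div_log (Real.log_pos (by linarith : 1 < 1 + ε))
  refine ⟨Real.exp L₀, Real.exp_pos _, fun R hR => ?_⟩
  have hR0 : 0 < R := (Real.exp_pos _).trans_le hR
  obtain ⟨m, n, h1, h2⟩ := hL₀ (Real.log R) ((Real.le_log_iff_exp_le hR0).mpr hR)
  refine ⟨m, n, ?_⟩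
  have hlog : Real.log ((P : ℝ) ^ m * (S : ℝ) ^ n) = m * Real.log P + n * Real.log S := by
    rw [Real.log_mul (by positivity) (by positivity), Real.log_pow, Real.log_pow]
  rw [← hlog] at h1 h2
  rw [← Real.log_mul (by positivity) (by positivity)] at h2
  exact ⟨(Real.log_le_log_iff hR0 (by positivity)).mp h1,
    (Real.log_le_log_iff (by positivity) (by positivity)).mp h2⟩

lemma UnitAddCircle.coe_eq_coe_iff {x y : ℝ} :
    (x : UnitAddCircle) = y ↔ ∃ n : ℤ, x = y + n := by
  rw [← sub_eq_zero, ← AddCircle.coe_sub, AddCircle.coe_eq_zero_iff]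
  constructor
  · rintro ⟨n, hn⟩
    exact ⟨n, by rw [zsmul_eq_mul, mul_one] at hn; linarith⟩
  · rintro ⟨n, hn⟩
    exact ⟨n, by rw [zsmul_eq_mul, mul_one]; linarith⟩

lemma UnitAddCircle.norm_coe_le_abs (x : ℝ) : ‖(x : UnitAddCircle)‖ ≤ |x| := by
  rw [UnitAddCircle.norm_eq]
  simpa using round_le x 0

lemma pow_nsmul_mem {G : Type*} [AddMonoid G] {Y : Set G} {P : ℕ}
    (hP : ∀ y ∈ Y, P • y ∈ Y) (m : ℕ) : ∀ y ∈ Y, P ^ m • y ∈ Y := by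
  induction m with
  | zero => simp
  | succ m ih =>
    intro y hy
    rw [pow_succ', mul_nsmul']
    exact hP _ (ih y hy)

/-- A closed subset of the circle invariant under two multiplicatively independent
multiplications and accumulating at `0` is the whole circle. -/
lemma MulIndep.eq_univ_of_accPt_zero {P S : ℕ} (h : MulIndep P S) {Y : Set UnitAddCircle}
    (hY : IsClosed Y) (hPY : ∀ y ∈ Y, P • y ∈ Y) (hSY : ∀ y ∈ Y, S • y ∈ Y)
    (h0 : AccPt 0 (𝓟 Y)) : Y = Set.univ := by
  refine Set.eq_univ_of_forall fun z => ?_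
  rw [← hY.closure_eq, Metric.mem_closure_iff]
  intro ε hε
  obtain ⟨R₀, hR₀, hR⟩ := h.exists_pow_mul_pow_mem_Icc (ε := ε / 3) (by positivity)
  obtain ⟨y, ⟨hyU, hyY⟩, hy0⟩ := accPt_iff_nhds.mp h0 (Metric.ball 0 R₀⁻¹)
    (Metric.ball_mem_nhds _ (by positivity))
  obtain ⟨x, hx, hxy⟩ : ∃ x : ℝ, |x| < R₀⁻¹ ∧ (x : UnitAddCircle) = y := by
    induction y using QuotientAddGroup.induction_on with
    | H x =>
    refine ⟨x - round x, ?_, ?_⟩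
    · rw [mem_ball_zero_iff] at hyU
      rw [← UnitAddCircle.norm_eq]
      exact hyU
    · exact UnitAddCircle.coe_eq_coe_iff.mpr ⟨-round x, by push_cast; ring⟩
  have hx0 : x ≠ 0 := by
    rintro rfl
    exact hy0 (by rw [← hxy]; rfl)
  obtain ⟨w, hwz, hw1, hw2, hwx⟩ : ∃ w : ℝ, (w : UnitAddCircle) = z ∧ 1 ≤ |w| ∧ |w| ≤ 2 ∧
      0 < w / x := by
    induction z using QuotientAddGroup.induction_on with
    | H z =>
    have hf0 := Int.floor_le z
    have hf1 := Int.lt_floor_add_one z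
    rcases lt_or_gt_of_ne hx0 with hneg | hpos
    · refine ⟨z - ⌊z⌋ - 2,
        UnitAddCircle.coe_eq_coe_iff.mpr ⟨-⌊z⌋ - 2, by push_cast; ring⟩, ?_, ?_, ?_⟩
      · rw [abs_of_neg (by linarith)]; linarith
      · rw [abs_of_neg (by linarith)]; linarith
      · exact div_pos_of_neg_of_neg (by linarith) hneg
    · refine ⟨z - ⌊z⌋ + 1,
        UnitAddCircle.coe_eq_coe_iff.mpr ⟨-⌊z⌋ + 1, by push_cast; ring⟩, ?_, ?_, ?_⟩
      · rw [abs_of_pos (by linarith)]; linarith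
      · rw [abs_of_pos (by linarith)]; linarith
      · exact div_pos (by linarith) hpos
  have hwx' : w / x = |w| / |x| := by rw [← abs_div, abs_of_pos hwx]
  have hR1 : R₀ ≤ w / x := by
    rw [hwx', le_div_iff₀ (abs_pos.mpr hx0)]
    have : R₀ * |x| < R₀ * R₀⁻¹ := by gcongr
    rw [mul_inv_cancel₀ hR₀.ne'] at this
    linarith
  obtain ⟨m, n, hmn1, hmn2⟩ := hR _ hR1
  refine ⟨P ^ m • S ^ n • y, pow_nsmul_mem hPY m _ (pow_nsmul_mem hSY n _ hyY), ?_⟩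
  set g : ℝ := (P : ℝ) ^ m * (S : ℝ) ^ n
  have hgy : P ^ m • S ^ n • y = ((g * x : ℝ) : UnitAddCircle) := by
    rw [← hxy, ← mul_nsmul', ← AddCircle.coe_nsmul, nsmul_eq_mul]
    push_cast
    rfl
  rw [hgy, ← hwz, dist_comm, dist_eq_norm, ← AddCircle.coe_sub]
  refine (UnitAddCircle.norm_coe_le_abs _).trans_lt ?_
  have hfac : g * x - w = (g - w / x) * x := by field_simp
  rw [hfac, abs_mul, abs_of_nonneg (by linarith)]
  calc (g - w / x) * |x| ≤ (|w| / |x| * (ε / 3)) * |x| := by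
        gcongr
        rw [← hwx']
        linarith
    _ = |w| * (ε / 3) := by
        have := abs_pos.mpr hx0
        field_simp
    _ ≤ 2 * (ε / 3) := by gcongr
    _ < ε := by linarith

lemma nsmul_pow_injective_of_torsion_free_orbit {G : Type*} [AddGroup G] {P : ℕ} (hP : 2 ≤ P)
    {x : G} (hx : ∀ k > 0, k • x ≠ 0) : Function.Injective fun i : ℕ => P ^ i • x := by
  intro i j hij
  by_contra hne
  wlog hlt : i < j generalizing i j
  · exact this hij.symm (Ne.symm hne) (by omega)
  have hpow : P ^ i < P ^ j := Nat.pow_lt_pow_right hP hlt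
  refine hx (P ^ j - P ^ i) (by omega) ?_
  have h1 : (P ^ j - P ^ i) • x + P ^ i • x = P ^ j • x := by
    rw [← add_nsmul, Nat.sub_add_cancel hpow.le]
  simp only at hij
  rw [← hij] at h1
  exact add_eq_right.mp h1

lemma MulIndep.exists_sub_eq {P S : ℕ} (h : MulIndep P S) {X : Set UnitAddCircle}
    (hX : IsClosed X) (hPX : ∀ x ∈ X, P • x ∈ X) (hSX : ∀ x ∈ X, S • x ∈ X)
    (hinf : X.Infinite) (z : UnitAddCircle) : ∃ a ∈ X, ∃ b ∈ X, a - b = z := by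
  obtain ⟨x, -, hx⟩ := hinf.exists_accPt_of_subset_isCompact isCompact_univ (Set.subset_univ _)
  have hxX : x ∈ X := (isClosed_iff_derivedSet_subset X).mp hX hx
  set Y : Set UnitAddCircle := (fun q : UnitAddCircle × UnitAddCircle => q.1 - q.2) '' (X ×ˢ X)
  have hYc : IsClosed Y :=
    ((hX.isCompact.prod hX.isCompact).image (by fun_prop)).isClosed
  have hinv : ∀ n : ℕ, (∀ x ∈ X, n • x ∈ X) → ∀ y ∈ Y, n • y ∈ Y := by
    rintro n hn _ ⟨⟨a, b⟩, ⟨ha, hb⟩, rfl⟩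
    exact ⟨(n • a, n • b), ⟨hn a ha, hn b hb⟩, (nsmul_sub a b n).symm⟩
  have hacc : AccPt 0 (𝓟 Y) := by
    rw [accPt_iff_nhds]
    intro U hU
    have hV : (fun y => y - x) ⁻¹' U ∈ 𝓝 x := by
      refine (continuous_id.sub continuous_const).continuousAt.preimage_mem_nhds ?_
      simpa using hU
    obtain ⟨y, ⟨hyU, hyX⟩, hyx⟩ := accPt_iff_nhds.mp hx _ hV
    exact ⟨y - x, ⟨hyU, ⟨(y, x), ⟨hyX, hxX⟩, rfl⟩⟩, sub_ne_zero.mpr hyx⟩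
  have hz : z ∈ Y := by
    rw [h.eq_univ_of_accPt_zero hYc (hinv P hPX) (hinv S hSX) hacc]
    trivial
  obtain ⟨⟨a, b⟩, ⟨ha, hb⟩, hab⟩ := hz
  exact ⟨a, ha, b, hb, hab⟩

lemma MulIndep.exists_add_nsmul_mem {P S : ℕ} (h : MulIndep P S) {X : Set UnitAddCircle}
    (hX : IsClosed X) (hne : X.Nonempty) (hPX : ∀ x ∈ X, P • x ∈ X) (hSX : ∀ x ∈ X, S • x ∈ X)
    (htf : ∀ x ∈ X, ∀ k > 0, k • x ≠ 0) {τ : UnitAddCircle} (hPτ : P • τ = τ) (hSτ : S • τ = τ)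
    (i : ℕ) : ∃ x ∈ X, ∀ j ≤ i, x + j • τ ∈ X := by
  suffices ∃ Z ⊆ X, IsClosed Z ∧ Z.Nonempty ∧ (∀ x ∈ Z, P • x ∈ Z) ∧ (∀ x ∈ Z, S • x ∈ Z) ∧
      ∀ x ∈ Z, ∀ j ≤ i, x + j • τ ∈ X by
    obtain ⟨Z, hZX, -, ⟨x, hx⟩, -, -, hj⟩ := this
    exact ⟨x, hZX hx, hj x hx⟩
  induction i with
  | zero => exact ⟨X, subset_rfl, hX, hne, hPX, hSX, by simp⟩
  | succ i ih =>
    obtain ⟨Z, hZX, hZc, ⟨x, hx⟩, hPZ, hSZ, hj⟩ := ih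
    have hinf : Z.Infinite :=
      Set.infinite_of_injective_forall_mem
        (nsmul_pow_injective_of_torsion_free_orbit h.1 (htf x (hZX hx)))
        fun i => pow_nsmul_mem hPZ i x hx
    obtain ⟨a, ha, b, hb, hab⟩ := h.exists_sub_eq hZc hPZ hSZ hinf τ
    refine ⟨Z ∩ (fun x => x + τ) ⁻¹' Z, fun x hx => hZX hx.1,
      hZc.inter (hZc.preimage (by fun_prop)), ⟨b, hb, ?_⟩, ?_, ?_, ?_⟩
    · simpa [← hab] using ha
    · rintro x ⟨hx, hxτ⟩
      refine ⟨hPZ x hx, ?_⟩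
      simpa [nsmul_add, hPτ] using hPZ _ hxτ
    · rintro x ⟨hx, hxτ⟩
      refine ⟨hSZ x hx, ?_⟩
      simpa [nsmul_add, hSτ] using hSZ _ hxτ
    · rintro x ⟨hx, hxτ⟩ j hji
      rcases j with _ | j
      · simpa using hZX hx
      · have := hj _ hxτ j (by omega)
        rwa [add_assoc, ← succ_nsmul'] at this

lemma nsmul_eq_self_of_modEq_one {G : Type*} [AddMonoid G] {t n : ℕ} {τ : G} (hτ : t • τ = 0)
    (hn : n ≡ 1 [MOD t]) : n • τ = τ := by
  rw [← Nat.mod_add_div n t, hn, add_nsmul, mul_nsmul, hτ, nsmul_zero, add_zero]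
  have h1 : (1 % t + t * (1 / t)) • τ = τ := by rw [Nat.mod_add_div, one_nsmul]
  rwa [add_nsmul, mul_nsmul, hτ, nsmul_zero, add_zero] at h1

/-- A nonempty closed subset of the circle invariant under two multiplicatively independent
multiplications contains a torsion point. -/
lemma MulIndep.exists_torsion_mem {P S : ℕ} (h : MulIndep P S) {X : Set UnitAddCircle}
    (hX : IsClosed X) (hne : X.Nonempty) (hPX : ∀ x ∈ X, P • x ∈ X) (hSX : ∀ x ∈ X, S • x ∈ X) :
    ∃ x ∈ X, ∃ k > 0, k • x = 0 := by
  by_contra! htf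
  suffices (0 : UnitAddCircle) ∈ X from htf 0 this 1 one_pos (by simp)
  rw [← hX.closure_eq, Metric.mem_closure_iff]
  intro ε hε
  obtain ⟨N, hN⟩ := exists_nat_gt (1 / ε)
  set t := P * S * N + 1 with ht
  have ht0 : (0 : ℝ) < t := by positivity
  have htε : 1 / (t : ℝ) < ε := by
    rw [div_lt_iff₀ ht0]
    rw [div_lt_iff₀ hε] at hN
    have hNt : (N : ℝ) ≤ t := by
      have := h.1
      have := h.2.1
      have : N ≤ P * S * N := Nat.le_mul_of_pos_left _ (by positivity)
      exact_mod_cast (by omega : N ≤ t)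
    nlinarith
  have hcop : ∀ a, a ∣ P * S * N → a.Coprime t := fun a ha =>
    Nat.Coprime.coprime_dvd_left ha (by simp [ht])
  have hu : 0 < t.totient := Nat.totient_pos.mpr (by omega)
  set τ : UnitAddCircle := ((1 / t : ℝ) : UnitAddCircle) with hτ
  have htτ : t • τ = 0 := by
    rw [hτ, ← AddCircle.coe_nsmul, nsmul_eq_mul, mul_one_div_cancel ht0.ne']
    exact AddCircle.coe_period 1
  obtain ⟨x, hx, hxj⟩ := (h.pow_pow hu hu).exists_add_nsmul_mem hX hne
    (pow_nsmul_mem hPX _) (pow_nsmul_mem hSX _) htf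
    (nsmul_eq_self_of_modEq_one htτ
      (Nat.ModEq.pow_totient (hcop P (by simp [mul_assoc]))))
    (nsmul_eq_self_of_modEq_one htτ
      (Nat.ModEq.pow_totient (hcop S (Dvd.intro_left (P * N) (by ring))))) t
  obtain ⟨y, hy0, hy1, rfl⟩ : ∃ y : ℝ, 0 ≤ y ∧ y < 1 ∧ ((-y : ℝ) : UnitAddCircle) = x := by
    induction x using QuotientAddGroup.induction_on with
    | H x =>
    refine ⟨Int.fract (-x), Int.fract_nonneg _, Int.fract_lt_one _, ?_⟩
    exact UnitAddCircle.coe_eq_coe_iff.mpr ⟨⌊-x⌋, by rw [← Int.self_sub_floor]; ring⟩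
  set j := ⌊y * t⌋₊
  have hj1 : (j : ℝ) ≤ y * t := Nat.floor_le (by positivity)
  have hj2 : y * t < j + 1 := Nat.lt_floor_add_one _
  have hjt : j ≤ t := Nat.floor_le_of_le (by nlinarith)
  refine ⟨_, hxj j hjt, ?_⟩
  rw [hτ, ← AddCircle.coe_nsmul, ← AddCircle.coe_add, dist_comm, dist_zero_right]
  refine (UnitAddCircle.norm_coe_le_abs _).trans_lt (lt_of_le_of_lt ?_ htε)
  rw [nsmul_eq_mul, abs_le]
  have e : (-y + j * (1 / t) : ℝ) = (j - y * t) / t := by field_simp; ring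
  rw [e, ← neg_div]
  constructor <;> gcongr <;> linarith

lemma exists_pow_nsmul_periodic {x : UnitAddCircle} {k : ℕ} (hk : 0 < k) (hx : k • x = 0)
    (P : ℕ) : ∃ i n : ℕ, 0 < n ∧ P ^ n • P ^ i • x = P ^ i • x := by
  have : ¬ Function.Injective fun i : ℕ => P ^ i • x := fun hinj =>
    Set.infinite_of_injective_forall_mem hinj (s := {u : UnitAddCircle | k • u = 0})
      (fun i => by
        change k • P ^ i • x = 0
        rw [nsmul_left_comm, hx, nsmul_zero]) (AddCircle.finite_torsion 1 hk)
  simp only [Function.Injective, not_forall] at this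
  obtain ⟨i, j, hij, hne⟩ := this
  wlog hlt : i < j generalizing i j
  · exact this j i hij.symm (Ne.symm hne) (by omega)
  refine ⟨i, j - i, by omega, ?_⟩
  rw [← mul_nsmul', ← pow_add, Nat.sub_add_cancel hlt.le]
  exact hij.symm

lemma nsmul_mem_derivedSet {X : Set UnitAddCircle} {P : ℕ} (hP : 0 < P)
    (hPX : ∀ x ∈ X, P • x ∈ X) : ∀ x ∈ derivedSet X, P • x ∈ derivedSet X := by
  intro x hx
  rw [mem_derivedSet, accPt_iff_nhds] at hx ⊢
  intro U hU
  set F : Set UnitAddCircle := {u | P • u = 0} \ {0}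
  have hF : IsClosed F := ((AddCircle.finite_torsion 1 hP).subset Set.sdiff_subset).isClosed
  have h1 : (fun y => P • y) ⁻¹' U ∈ 𝓝 x :=
    (continuous_nsmul P).continuousAt.preimage_mem_nhds hU
  have h2 : (fun y => y - x) ⁻¹' Fᶜ ∈ 𝓝 x :=
    (continuous_id.sub continuous_const).continuousAt.preimage_mem_nhds
      (hF.isOpen_compl.mem_nhds (by simp [F]))
  obtain ⟨y, ⟨⟨hyU, hyF⟩, hyX⟩, hyx⟩ := hx _ (inter_mem h1 h2)
  refine ⟨P • y, ⟨hyU, hPX y hyX⟩, fun heq => hyF ⟨?_, sub_ne_zero.mpr hyx⟩⟩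
  change P • (y - x) = 0
  rw [nsmul_sub, heq, sub_self]

/-- **Furstenberg's theorem**: an infinite closed subset of the circle invariant under two
multiplicatively independent multiplications is the whole circle. -/
theorem MulIndep.eq_univ_of_infinite {P S : ℕ} (h : MulIndep P S) {X : Set UnitAddCircle}
    (hX : IsClosed X) (hPX : ∀ x ∈ X, P • x ∈ X) (hSX : ∀ x ∈ X, S • x ∈ X)
    (hinf : X.Infinite) : X = Set.univ := by
  have hP0 : 0 < P := by have := h.1; omega
  have hS0 : 0 < S := by have := h.2.1; omega
  obtain ⟨a, -, ha⟩ := hinf.exists_accPt_of_subset_isCompact isCompact_univ (Set.subset_univ _)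
  have hPd := nsmul_mem_derivedSet hP0 hPX
  have hSd := nsmul_mem_derivedSet hS0 hSX
  obtain ⟨x, hx, k, hk, hkx⟩ := h.exists_torsion_mem (isClosed_derivedSet X) ⟨a, ha⟩ hPd hSd
  obtain ⟨i, u, hu, hiu⟩ := exists_pow_nsmul_periodic hk hkx P
  have hkx' : k • P ^ i • x = 0 := by rw [nsmul_left_comm, hkx, nsmul_zero]
  obtain ⟨j, v, hv, hjv⟩ := exists_pow_nsmul_periodic hk hkx' S
  set r := S ^ j • P ^ i • x with hr
  have hPr : P ^ u • r = r := by rw [hr, nsmul_left_comm, hiu]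
  have hrX : r ∈ derivedSet X := pow_nsmul_mem hSd j _ (pow_nsmul_mem hPd i _ hx)
  clear_value r
  have hinv : ∀ n : ℕ, n • r = r → (∀ x ∈ X, n • x ∈ X) →
      ∀ y ∈ (fun y => y + r) ⁻¹' X, n • y ∈ (fun y => y + r) ⁻¹' X := by
    intro n hn hnX y hy
    simpa [nsmul_add, hn] using hnX _ hy
  have hacc : AccPt 0 (𝓟 ((fun y => y + r) ⁻¹' X)) := by
    rw [accPt_iff_nhds]
    intro U hU
    have hV : (fun y => y - r) ⁻¹' U ∈ 𝓝 r := by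
      refine (continuous_id.sub continuous_const).continuousAt.preimage_mem_nhds ?_
      simpa using hU
    obtain ⟨y, ⟨hyU, hyX⟩, hyr⟩ := accPt_iff_nhds.mp hrX _ hV
    exact ⟨y - r, ⟨hyU, by simpa using hyX⟩, sub_ne_zero.mpr hyr⟩
  have huniv := (h.pow_pow hu hv).eq_univ_of_accPt_zero (hX.preimage (by fun_prop))
    (hinv _ hPr (pow_nsmul_mem hPX u)) (hinv _ hjv (pow_nsmul_mem hSX v)) hacc
  refine Set.eq_univ_of_forall fun z => ?_
  have : z - r ∈ (fun y => y + r) ⁻¹' X := huniv ▸ Set.mem_univ _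
  simpa using this

lemma ofDigits_shiftN {s : ℕ} (hs : 0 < s) (a : ℕ → Fin s) :
    s * Real.ofDigits a = (a 0 : ℕ) + Real.ofDigits (shiftN (Fin s) a) := by
  rw [Real.ofDigits_eq_sum_add_ofDigits a 1]
  have : (s : ℝ) ≠ 0 := by positivity
  simp only [Finset.sum_range_one, Real.ofDigitsTerm, zero_add, pow_one]
  field_simp
  rfl

lemma eq_zero_of_ofDigits_eq_zero {s : ℕ} (hs : 0 < s) (n : ℕ) :
    ∀ a : ℕ → Fin s, Real.ofDigits a = 0 → (a n : ℕ) = 0 := by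
  have step : ∀ a : ℕ → Fin s, Real.ofDigits a = 0 →
      (a 0 : ℕ) = 0 ∧ Real.ofDigits (shiftN (Fin s) a) = 0 := by
    intro a ha
    have h := ofDigits_shiftN hs a
    have h1 := Real.ofDigits_nonneg (shiftN (Fin s) a)
    have h2 : (0 : ℝ) ≤ (a 0 : ℕ) := by positivity
    rw [ha, mul_zero] at h
    exact ⟨by exact_mod_cast (by linarith : ((a 0 : ℕ) : ℝ) = 0), by linarith⟩
  induction n with
  | zero => exact fun a ha => (step a ha).1
  | succ n ih => exact fun a ha => ih _ (step a ha).2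

lemma add_one_eq_of_ofDigits_eq_one {s : ℕ} (hs : 0 < s) (n : ℕ) :
    ∀ a : ℕ → Fin s, Real.ofDigits a = 1 → (a n : ℕ) + 1 = s := by
  have step : ∀ a : ℕ → Fin s, Real.ofDigits a = 1 →
      (a 0 : ℕ) + 1 = s ∧ Real.ofDigits (shiftN (Fin s) a) = 1 := by
    intro a ha
    have h := ofDigits_shiftN hs a
    have h1 := Real.ofDigits_le_one (shiftN (Fin s) a)
    have h2 : ((a 0 : ℕ) : ℝ) + 1 ≤ s := by exact_mod_cast (a 0).isLt
    rw [ha, mul_one] at h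
    exact ⟨by exact_mod_cast (by linarith : ((a 0 : ℕ) : ℝ) + 1 = s), by linarith⟩
  induction n with
  | zero => exact fun a ha => (step a ha).1
  | succ n ih => exact fun a ha => ih _ (step a ha).2

/-- The sequence `a` is eventually equal to the least digit. -/
def EventuallyZero {s : ℕ} (a : ℕ → Fin s) : Prop := ∀ᶠ n in atTop, (a n : ℕ) = 0

/-- The sequence `a` is eventually equal to the greatest digit. -/
def EventuallyTop {s : ℕ} (a : ℕ → Fin s) : Prop := ∀ᶠ n in atTop, (a n : ℕ) + 1 = s

lemma EventuallyZero.not_eventuallyTop {s : ℕ} (hs : 2 ≤ s) {a : ℕ → Fin s}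
    (h : EventuallyZero a) : ¬ EventuallyTop a := fun h' => by
  obtain ⟨n, h0, h1⟩ := (h.and h').exists
  omega

lemma eventually_of_ofDigits_eq_of_lt {s : ℕ} (hs : 0 < s) (k : ℕ) :
    ∀ a b : ℕ → Fin s, (∀ i < k, a i = b i) → a k < b k → Real.ofDigits a = Real.ofDigits b →
      EventuallyTop a ∧ EventuallyZero b := by
  induction k with
  | zero =>
    intro a b _ hlt hab
    have ha := ofDigits_shiftN hs a
    have hb := ofDigits_shiftN hs b
    have ha1 := Real.ofDigits_le_one (shiftN (Fin s) a)
    have hb0 := Real.ofDigits_nonneg (shiftN (Fin s) b)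
    have hlt' : ((a 0 : ℕ) : ℝ) + 1 ≤ (b 0 : ℕ) := by exact_mod_cast hlt
    rw [hab] at ha
    constructor
    · refine (eventually_ge_atTop 1).mono fun n hn => ?_
      obtain ⟨m, rfl⟩ := Nat.exists_eq_add_of_le' hn
      exact add_one_eq_of_ofDigits_eq_one hs m (shiftN (Fin s) a) (by linarith)
    · refine (eventually_ge_atTop 1).mono fun n hn => ?_
      obtain ⟨m, rfl⟩ := Nat.exists_eq_add_of_le' hn
      exact eq_zero_of_ofDigits_eq_zero hs m (shiftN (Fin s) b) (by linarith)
  | succ k ih =>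
    intro a b heq hlt hab
    have ha := ofDigits_shiftN hs a
    have hb := ofDigits_shiftN hs b
    rw [hab, heq 0 (by omega)] at ha
    have := ih (shiftN (Fin s) a) (shiftN (Fin s) b) (fun i hi => heq (i + 1) (by omega)) hlt
      (by linarith)
    rw [EventuallyTop, EventuallyZero, ← map_add_atTop_eq_nat 1]
    exact this

/-- The point of the circle with a given expansion in base `s`. -/
noncomputable def circlePoint {s : ℕ} (a : ℕ → Fin s) : UnitAddCircle := Real.ofDigits a

lemma continuous_circlePoint {s : ℕ} : Continuous (circlePoint (s := s)) :=
  (AddCircle.continuous_mk' 1).comp Real.continuous_ofDigits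

lemma eq_or_eventually_of_circlePoint_eq {s : ℕ} (hs : 0 < s) {a b : ℕ → Fin s}
    (h : circlePoint a = circlePoint b) :
    a = b ∨ (EventuallyTop a ∧ EventuallyZero b) ∨ (EventuallyZero a ∧ EventuallyTop b) := by
  obtain ⟨n, hn⟩ := UnitAddCircle.coe_eq_coe_iff.mp h
  have ha0 := Real.ofDigits_nonneg a
  have ha1 := Real.ofDigits_le_one a
  have hb0 := Real.ofDigits_nonneg b
  have hb1 := Real.ofDigits_le_one b
  rcases lt_trichotomy n 0 with hneg | rfl | hpos
  · have hn' : (n : ℝ) ≤ -1 := by exact_mod_cast (by omega : n ≤ -1)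
    exact Or.inr (Or.inr
      ⟨.of_forall fun k => eq_zero_of_ofDigits_eq_zero hs k a (by linarith),
        .of_forall fun k => add_one_eq_of_ofDigits_eq_one hs k b (by linarith)⟩)
  · rw [Int.cast_zero, add_zero] at hn
    by_cases hab : a = b
    · exact Or.inl hab
    right
    have hex : ∃ k, a k ≠ b k := Function.ne_iff.mp hab
    classical
    have hmin : ∀ i < Nat.find hex, a i = b i := fun i hi => not_not.mp (Nat.find_min hex hi)
    rcases lt_or_gt_of_ne (Nat.find_spec hex) with hlt | hgt
    · exact Or.inl (eventually_of_ofDigits_eq_of_lt hs _ a b hmin hlt hn)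
    · exact Or.inr (eventually_of_ofDigits_eq_of_lt hs _ b a
        (fun i hi => (hmin i hi).symm) hgt hn.symm).symm
  · have hn' : (1 : ℝ) ≤ n := by exact_mod_cast (by omega : 1 ≤ n)
    exact Or.inr (Or.inl
      ⟨.of_forall fun k => add_one_eq_of_ofDigits_eq_one hs k a (by linarith),
        .of_forall fun k => eq_zero_of_ofDigits_eq_zero hs k b (by linarith)⟩)

lemma finite_circlePoint_fiber {s : ℕ} (hs : 2 ≤ s) (z : UnitAddCircle) :
    (circlePoint (s := s) ⁻¹' {z}).Finite := by
  have hsub : ∀ a ∈ circlePoint (s := s) ⁻¹' {z}, ∀ b ∈ circlePoint (s := s) ⁻¹' {z},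
      (EventuallyTop a ↔ EventuallyTop b) → a = b := by
    rintro a ha b hb hab
    rcases eq_or_eventually_of_circlePoint_eq (by omega) (ha.trans hb.symm) with
      h | ⟨h1, h2⟩ | ⟨h1, h2⟩
    · exact h
    · exact absurd (hab.mp h1) (h2.not_eventuallyTop hs)
    · exact absurd (hab.mpr h2) (h1.not_eventuallyTop hs)
  refine Set.Finite.of_finite_image (f := fun a => EventuallyTop a) (Set.toFinite _) ?_
  exact fun a ha b hb hab => hsub a ha b hb (Iff.of_eq hab)

lemma circlePoint_shiftN {s : ℕ} (hs : 0 < s) (a : ℕ → Fin s) :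
    circlePoint (shiftN (Fin s) a) = s • circlePoint a := by
  rw [circlePoint, circlePoint, ← AddCircle.coe_nsmul, nsmul_eq_mul, ofDigits_shiftN hs]
  exact UnitAddCircle.coe_eq_coe_iff.mpr ⟨-(a 0 : ℕ), by push_cast; ring⟩

lemma muP_apply_add {s p : ℕ} (hs : 0 < s) (hps : p ∣ s) (a : ℕ → Fin s) (k : ℕ) :
    (muP s p a k : ℕ) + p * (a k : ℕ) / s * s = p * (a k : ℕ) + p * (a (k + 1) : ℕ) / s := by
  have hp : 0 < p := Nat.pos_of_dvd_of_pos hps hs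
  have hdm := Nat.div_add_mod (p * (a k : ℕ)) s
  have hc : p * (a (k + 1) : ℕ) / s < p := by
    rw [Nat.div_lt_iff_lt_mul hs]
    exact Nat.mul_lt_mul_of_pos_left (a (k + 1)).isLt hp
  have hr : p * (a k : ℕ) % s + p ≤ s := by
    obtain ⟨m, rfl⟩ := hps
    have hm : 0 < m := Nat.pos_of_mul_pos_left hs
    rw [Nat.mul_mod_mul_left, ← Nat.mul_succ]
    exact Nat.mul_le_mul_left p (Nat.mod_lt _ hm)
  have hval : (muP s p a k : ℕ) = p * (a k : ℕ) % s + p * (a (k + 1) : ℕ) / s := by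
    simp only [muP, hs, dif_pos]
    rw [← Nat.mod_add_mod, Nat.mod_eq_of_lt (by omega)]
  rw [hval]
  nlinarith

lemma ofDigits_muP {s p : ℕ} (hs : 2 ≤ s) (hps : p ∣ s) (a : ℕ → Fin s) :
    p * Real.ofDigits a = Real.ofDigits (muP s p a) + (p * (a 0 : ℕ) / s : ℕ) := by
  have hs0 : (0 : ℝ) < s := by positivity
  set c : ℕ → ℝ := fun k => ((p * (a k : ℕ) / s : ℕ) : ℝ) * ((s : ℝ) ^ k)⁻¹ with hc
  have hsum : Summable c := by
    have hgeo : Summable fun k : ℕ => (p : ℝ) * ((s : ℝ)⁻¹) ^ k :=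
      (summable_geometric_of_lt_one (by positivity)
        (inv_lt_one_of_one_lt₀ (by exact_mod_cast hs))).mul_left _
    refine Summable.of_nonneg_of_le (fun k => by positivity) (fun k => ?_) hgeo
    simp only [hc, inv_pow]
    gcongr
    exact Nat.div_le_of_le_mul (by rw [mul_comm s]; exact Nat.mul_le_mul_left p (a k).isLt.le)
  have hterm : ∀ k, Real.ofDigitsTerm (muP s p a) k + c k
      = p * Real.ofDigitsTerm a k + c (k + 1) := by
    intro k
    have h := muP_apply_add (by omega : 0 < s) hps a k
    have h' : ((muP s p a k : ℕ) : ℝ) + ((p * (a k : ℕ) / s : ℕ) : ℝ) * s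
        = p * (a k : ℕ) + ((p * (a (k + 1) : ℕ) / s : ℕ) : ℝ) := by exact_mod_cast h
    simp only [Real.ofDigitsTerm, hc, pow_succ]
    field_simp
    linarith
  have h1 := tsum_congr (L := .unconditional ℕ) hterm
  rw [Real.summable_ofDigitsTerm.tsum_add hsum,
    (Real.summable_ofDigitsTerm.mul_left _).tsum_add ((summable_nat_add_iff 1).mpr hsum),
    tsum_mul_left, hsum.tsum_eq_zero_add] at h1
  have hc0 : c 0 = ((p * (a 0 : ℕ) / s : ℕ) : ℝ) := by simp [hc]
  rw [hc0] at h1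
  simp only [Real.ofDigits]
  linarith

lemma circlePoint_muP {s p : ℕ} (hs : 2 ≤ s) (hps : p ∣ s) (a : ℕ → Fin s) :
    circlePoint (muP s p a) = p • circlePoint a := by
  rw [circlePoint, circlePoint, ← AddCircle.coe_nsmul, nsmul_eq_mul, ofDigits_muP hs hps]
  exact UnitAddCircle.coe_eq_coe_iff.mpr ⟨-((p * (a 0 : ℕ) / s : ℕ) : ℤ), by
    rw [Int.cast_neg, Int.cast_natCast]; ring⟩

lemma mulIndep_of_not_isPrimePow {s p : ℕ} (hs : 2 ≤ s) (hp : p.Prime) (hps : p ∣ s)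
    (hpp : ¬ IsPrimePow s) : MulIndep p s := by
  refine ⟨hp.two_le, hs, fun m n hmn => ?_⟩
  by_contra hn
  refine hpp (isPrimePow_iff_unique_prime_dvd.mpr ⟨p, ⟨hp, hps⟩, fun q hq => ?_⟩)
  have : q ∣ p ^ m := hmn ▸ dvd_pow hq.2 hn
  exact (Nat.prime_dvd_prime_iff_eq hq.1 hp).mp (hq.1.dvd_of_dvd_pow this)

lemma eq_univ_of_circlePoint_image_eq_univ {s : ℕ} (hs : 2 ≤ s) {A : Set (ℕ → Fin s)}
    (hA : IsClosed A) (himg : circlePoint '' A = Set.univ) : A = Set.univ := by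
  refine Set.eq_univ_of_forall fun b => ?_
  set c : ℕ → ℕ → Fin s := fun n k => if k < n then b k else ⟨k % 2, by omega⟩ with hc
  have hcA : ∀ n, c n ∈ A := by
    intro n
    obtain ⟨a, haA, ha⟩ : circlePoint (c n) ∈ circlePoint '' A := himg ▸ Set.mem_univ _
    have hlarge : ∀ k ≥ n, (c n k : ℕ) = k % 2 := fun k hk => by
      simp [hc, Nat.not_lt.mpr hk]
    have h0 : ¬ EventuallyZero (c n) := fun h => by
      obtain ⟨N, hN⟩ := eventually_atTop.mp h
      have h1 := hN (2 * (N + n) + 1) (by omega)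
      rw [hlarge _ (by omega)] at h1
      omega
    have h1 : ¬ EventuallyTop (c n) := fun h => by
      obtain ⟨N, hN⟩ := eventually_atTop.mp h
      have h1 := hN (2 * (N + n)) (by omega)
      rw [hlarge _ (by omega)] at h1
      omega
    rcases eq_or_eventually_of_circlePoint_eq (by omega) ha with rfl | ⟨-, h⟩ | ⟨-, h⟩
    · exact haA
    · exact absurd h h0
    · exact absurd h h1
  refine hA.mem_of_tendsto (b := atTop) (f := c) (tendsto_pi_nhds.mpr fun k => ?_)
    (.of_forall hcA)
  refine tendsto_const_nhds.congr' ((eventually_gt_atTop k).mono fun n hn => ?_)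
  simp [hc, hn]

lemma hasID_of_not_isPrimePow {s p : ℕ} (hs : 2 ≤ s) (hp : p.Prime) (hps : p ∣ s)
    (hpp : ¬ IsPrimePow s) :
    HasID (gen ({muP s p, shiftN (Fin s)} : Set ((ℕ → Fin s) → (ℕ → Fin s)))) := by
  intro A hA hinv hne
  have hmu : ∀ a ∈ A, muP s p a ∈ A := hinv _ (.base (by simp))
  have hsh : ∀ a ∈ A, shiftN (Fin s) a ∈ A := hinv _ (.base (by simp))
  by_contra hinf
  refine hne (eq_univ_of_circlePoint_image_eq_univ hs hA ?_)
  refine (mulIndep_of_not_isPrimePow hs hp hps hpp).eq_univ_of_infinite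
    (hA.isCompact.image continuous_circlePoint).isClosed ?_ ?_ ?_
  · rintro _ ⟨a, ha, rfl⟩
    exact ⟨_, hmu a ha, circlePoint_muP hs hps a⟩
  · rintro _ ⟨a, ha, rfl⟩
    exact ⟨_, hsh a ha, circlePoint_shiftN (by omega) a⟩
  · intro hfin
    refine hinf ((hfin.preimage' fun z _ => finite_circlePoint_fiber hs z).subset ?_)
    exact Set.subset_preimage_image _ _

/-- The sequences with at most one nonzero entry, that entry being a power of `p`. -/
def singlePow (s p : ℕ) : Set (ℕ → Fin s) :=
  {a | (∀ k, (a k : ℕ) = 0 ∨ ∃ j, (a k : ℕ) = p ^ j) ∧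
    ∀ k l, k < l → (a k : ℕ) = 0 ∨ (a l : ℕ) = 0}

lemma isClosed_singlePow (s p : ℕ) : IsClosed (singlePow s p) := by
  have hev : ∀ k, Continuous fun a : ℕ → Fin s => a k := fun k => continuous_apply k
  have hcl : ∀ (k : ℕ) (q : Fin s → Prop), IsClosed {a : ℕ → Fin s | q (a k)} := fun k q =>
    (isClosed_discrete {x | q x}).preimage (hev k)
  simp only [singlePow, Set.ofPred_and, Set.ofPred_forall]
  refine (isClosed_iInter fun k => hcl k fun x => (x : ℕ) = 0 ∨ ∃ j, (x : ℕ) = p ^ j).inter ?_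
  refine isClosed_iInter fun k => isClosed_iInter fun l => isClosed_iInter fun _ => ?_
  exact (hcl k fun x => (x : ℕ) = 0).union (hcl l fun x => (x : ℕ) = 0)

lemma shiftN_mem_singlePow {s p : ℕ} {a : ℕ → Fin s} (ha : a ∈ singlePow s p) :
    shiftN (Fin s) a ∈ singlePow s p :=
  ⟨fun k => ha.1 (k + 1), fun k l hkl => ha.2 (k + 1) (l + 1) (by omega)⟩

lemma muP_mem_singlePow {p e : ℕ} (hp : p.Prime) (he : 0 < e) {a : ℕ → Fin (p ^ e)}
    (ha : a ∈ singlePow (p ^ e) p) : muP (p ^ e) p a ∈ singlePow (p ^ e) p := by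
  have hs : 0 < p ^ e := Nat.pow_pos hp.pos
  have h1s : 1 < p ^ e := Nat.one_lt_pow he.ne' hp.one_lt
  have hval : ∀ k, (muP (p ^ e) p a k : ℕ)
      = (p * (a k : ℕ) + p * (a (k + 1) : ℕ) / p ^ e) % p ^ e := fun k => by
    simp only [muP, hs, dif_pos]
  have hexp : ∀ {k j : ℕ}, (a k : ℕ) = p ^ j → j < e := fun {k j} hj =>
    (Nat.pow_lt_pow_iff_right hp.one_lt).mp (hj ▸ (a k).isLt)
  have hlast : ∀ {k j : ℕ}, (a k : ℕ) = p ^ j → j + 1 = e → p * (a k : ℕ) = p ^ e :=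
    fun {k j} hj hje => by rw [hj, ← pow_succ', hje]
  have hnotlast : ∀ {k j : ℕ}, (a k : ℕ) = p ^ j → j + 1 ≠ e →
      p * (a k : ℕ) = p ^ (j + 1) ∧ p * (a k : ℕ) < p ^ e := fun {k j} hj hje => by
    have := hexp hj
    rw [hj, ← pow_succ']
    exact ⟨rfl, Nat.pow_lt_pow_right hp.one_lt (by omega)⟩
  have hcases : ∀ k, (muP (p ^ e) p a k : ℕ) = 0 ∨
      (∃ j, (muP (p ^ e) p a k : ℕ) = p ^ j) ∧
        ((a k : ℕ) ≠ 0 ∧ p * (a k : ℕ) < p ^ e ∨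
          (a (k + 1) : ℕ) ≠ 0 ∧ p * (a (k + 1) : ℕ) = p ^ e) := by
    intro k
    rw [hval]
    rcases ha.2 k (k + 1) (by omega) with h0 | h0
    · rcases ha.1 (k + 1) with h | ⟨j, hj⟩
      · left; simp [h0, h]
      · by_cases hje : j + 1 = e
        · right
          have hl := hlast hj hje
          refine ⟨⟨0, ?_⟩, Or.inr ⟨by rw [hj]; exact (Nat.pow_pos hp.pos).ne', hl⟩⟩
          rw [h0, hl, Nat.div_self hs, mul_zero, zero_add, pow_zero, Nat.mod_eq_of_lt h1s]
        · left
          have hl := (hnotlast hj hje).2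
          rw [h0, Nat.div_eq_of_lt hl]
          simp
    · rcases ha.1 k with h | ⟨j, hj⟩
      · left; simp [h0, h]
      · by_cases hje : j + 1 = e
        · left
          rw [h0, hlast hj hje]
          simp
        · right
          obtain ⟨hl, hlt⟩ := hnotlast hj hje
          refine ⟨⟨j + 1, ?_⟩, Or.inl ⟨by rw [hj]; exact (Nat.pow_pos hp.pos).ne', hlt⟩⟩
          rw [h0, mul_zero, Nat.zero_div, add_zero, Nat.mod_eq_of_lt hlt, hl]
  refine ⟨fun k => (hcases k).imp_right And.left, fun k l hkl => ?_⟩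
  rcases hcases k with h | ⟨-, hk⟩
  · exact Or.inl h
  rcases hcases l with h | ⟨-, hl⟩
  · exact Or.inr h
  exfalso
  have huniq : ∀ {i j : ℕ}, (a i : ℕ) ≠ 0 → (a j : ℕ) ≠ 0 → i = j := fun {i j} hi hj => by
    rcases lt_trichotomy i j with h | h | h
    · exact ((ha.2 i j h).elim hi hj).elim
    · exact h
    · exact ((ha.2 j i h).elim hj hi).elim
  rcases hk with ⟨hk0, hk1⟩ | ⟨hk0, hk1⟩ <;> rcases hl with ⟨hl0, hl1⟩ | ⟨hl0, hl1⟩ <;>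
    have heq := huniq hk0 hl0
  · omega
  · omega
  · rw [heq] at hk1
    omega
  · omega

lemma infinite_singlePow {s : ℕ} (hs : 2 ≤ s) (p : ℕ) : (singlePow s p).Infinite := by
  set f : ℕ → ℕ → Fin s := fun n k => if k = n then ⟨1, by omega⟩ else ⟨0, by omega⟩ with hf
  refine Set.infinite_of_injective_forall_mem (f := f) ?_ ?_
  · intro m n hmn
    have := congrFun hmn m
    by_contra hne
    simp [hf, hne] at this
  · refine fun n => ⟨fun k => ?_, fun k l hkl => ?_⟩
    · by_cases hk : k = n
      · exact Or.inr ⟨0, by simp [hf, hk]⟩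
      · exact Or.inl (by simp [hf, hk])
    · by_cases hk : k = n
      · have hl : l ≠ n := by omega
        exact Or.inr (by simp [hf, hl])
      · exact Or.inl (by simp [hf, hk])

lemma singlePow_ne_univ {s : ℕ} (hs : 2 ≤ s) (p : ℕ) : singlePow s p ≠ Set.univ := by
  intro h
  have : (fun _ => ⟨1, by omega⟩ : ℕ → Fin s) ∈ singlePow s p := h ▸ Set.mem_univ _
  simpa using this.2 0 1 one_pos

lemma not_hasID_of_isPrimePow {s p : ℕ} (hs : 2 ≤ s) (hp : p.Prime) (hps : p ∣ s)
    (hpp : IsPrimePow s) :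
    ¬ HasID (gen ({muP s p, shiftN (Fin s)} : Set ((ℕ → Fin s) → (ℕ → Fin s)))) := by
  obtain ⟨q, e, hq, he, rfl⟩ := hpp
  obtain rfl : p = q := (Nat.prime_dvd_prime_iff_eq hp hq.nat_prime).mp (hp.dvd_of_dvd_pow hps)
  intro hID
  refine infinite_singlePow hs p (hID _ (isClosed_singlePow _ p) ?_ (singlePow_ne_univ hs p))
  intro τ hτ
  change InGen _ τ at hτ
  induction hτ with
  | base h =>
    rcases h with rfl | rfl
    · exact fun a ha => muP_mem_singlePow hp he ha
    · exact fun a ha => shiftN_mem_singlePow ha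
  | comp _ _ ih₁ ih₂ => exact fun a ha => ih₁ _ (ih₂ a ha)

/-- For `s ≥ 2` and a prime factor `p` of `s`, the semigroup
`⟨μ_p, σ⟩ ⊆ CAT(Λ_s^ℕ)` has the ID property iff `s` is not a power of a prime. -/
theorem mult_semigroup_ID_iff (s p : ℕ) (hs : 2 ≤ s) (hp : p.Prime) (hps : p ∣ s) :
    HasID (gen ({muP s p, shiftN (Fin s)} : Set ((ℕ → Fin s) → (ℕ → Fin s)))) ↔
      ¬ IsPrimePow s := by
  exact ⟨fun h hpp => not_hasID_of_isPrimePow hs hp hps hpp h,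
    hasID_of_not_isPrimePow hs hp hps⟩
end

section
/- Let s ≥ 2 with prime decomposition s = p₁^{e₁}·…·p_d^{e_d}. The semigroup ⟨μ_{p₁},…,μ_{p_d}, μ₀, μ₁⟩ ⊆ CAT(Λ_s^ℕ) is maximal commutative if and only if s is not a power of a prime. -/
/-- The semigroup `CAT(Λ^ℕ)` of all cellular automaton transformations. -/
def CATset (A : Type) [TopologicalSpace A] : Set ((ℕ → A) → (ℕ → A)) := {τ | IsCAT A τ}

/-- `S` is a maximal commutative subsemigroup of `CAT`: it consists of elements of `CAT`,
it is commutative, and every element of `CAT` commuting with all of `S` lies in `S`. -/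
def IsMC {Ω : Type} (CAT S : Set (Ω → Ω)) : Prop :=
  S ⊆ CAT ∧ (∀ τ ∈ S, ∀ μ ∈ S, τ ∘ μ = μ ∘ τ) ∧
    ∀ μ ∈ CAT, (∀ τ ∈ S, μ ∘ τ = τ ∘ μ) → μ ∈ S

/-- The zero map `μ₀(a)_k = 0`. -/
def muZero (s : ℕ) : (ℕ → Fin s) → (ℕ → Fin s) := fun a k =>
  if h : 0 < s then ⟨0, h⟩ else a k

namespace MultCA

open Filter Topology

section Expansions

variable {s : ℕ} [NeZero s]

/-- The base-`s` expansion of `j / m` modulo one that is obtained by rounding down. -/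
def fracDigits (s : ℕ) [NeZero s] (j m : ℕ) : ℕ → Fin s :=
  fun k => Fin.ofNat s (j * s ^ (k + 1) / m)

/-- The base-`s` expansion of `j / m` modulo one that approaches `j / m` from below:
it differs from `fracDigits s j m` only when `j / m` is an `s`-adic rational. -/
def fracDigitsBelow (s : ℕ) [NeZero s] (j m : ℕ) : ℕ → Fin s :=
  fun k => Fin.ofNat s ((j * s ^ (k + 1) - 1) / m)

/-- The point of the circle `ℝ / ℤ` with the given base-`s` digits. -/
noncomputable def circlePoint (a : ℕ → Fin s) : UnitAddCircle := (Real.ofDigits a : ℝ)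

theorem muP_val (p : ℕ) (a : ℕ → Fin s) (k : ℕ) :
    (muP s p a k).val = (p * (a k).val + p * (a (k + 1)).val / s) % s := by
  simp [muP, NeZero.pos s]

theorem muZero_apply (a : ℕ → Fin s) : muZero s a = 0 := by
  ext k
  simp [muZero, NeZero.pos s]

theorem muP_zero (p : ℕ) : muP s p 0 = 0 := by
  ext k
  simp [muP_val]

theorem muP_ofNat {p : ℕ} (hp : p ∣ s) (N : ℕ → ℕ) (hN : ∀ k, N (k + 1) / s = N k) :
    muP s p (fun k => Fin.ofNat s (N k)) = fun k => Fin.ofNat s (N (k + 1) / (s / p)) := by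
  obtain ⟨t, ht⟩ := hp
  have hs := NeZero.pos s
  have hp : 0 < p := Nat.pos_of_ne_zero (by rintro rfl; simp at ht; omega)
  have htp : 0 < t := Nat.pos_of_ne_zero (by rintro rfl; simp at ht; omega)
  ext k
  rw [muP_val]
  simp only [Fin.val_ofNat]
  have h1 : s / p = t := by rw [ht]; exact Nat.mul_div_cancel_left t hp
  have h2 : p * (N (k + 1) % s) / s = N (k + 1) / t % p := by
    conv_lhs => rw [ht]
    rw [Nat.mul_div_mul_left _ _ hp, mul_comm p t, Nat.mod_mul_right_div_self]
  have h3 : N k = N (k + 1) / t / p := by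
    rw [Nat.div_div_eq_div_mul, mul_comm t p, ← ht, hN]
  rw [h1, h2, Nat.add_mod, Nat.mul_mod_mod, ← Nat.add_mod, h3, Nat.div_add_mod]

theorem mul_sub_one_div_cancel {t y m : ℕ} (ht : 0 < t) (hy : 0 < y) :
    (t * y - 1) / (t * m) = (y - 1) / m := by
  rw [← Nat.div_div_eq_div_mul]
  congr 1
  obtain ⟨z, rfl⟩ : ∃ z, y = z + 1 := ⟨y - 1, by omega⟩
  have : t * (z + 1) - 1 = t * z + (t - 1) := by rw [mul_add]; omega
  rw [this, Nat.mul_add_div ht, Nat.div_eq_of_lt (by omega)]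
  simp

theorem muP_fracDigits {p : ℕ} (hp : p ∣ s) (j m : ℕ) :
    muP s p (fracDigits s j m) = fracDigits s (p * j) m := by
  have hs := NeZero.pos s
  unfold fracDigits
  rw [muP_ofNat hp (fun k => j * s ^ (k + 1) / m)]
  · funext k
    obtain ⟨t, ht⟩ := hp
    have hp : 0 < p := Nat.pos_of_ne_zero (by rintro rfl; simp at ht; omega)
    have htp : 0 < t := Nat.pos_of_ne_zero (by rintro rfl; simp at ht; omega)
    have h1 : s / p = t := by rw [ht]; exact Nat.mul_div_cancel_left t hp
    have h2 : j * s ^ (k + 1 + 1) = t * (p * j * s ^ (k + 1)) := by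
      rw [pow_succ s (k + 1)]
      nth_rewrite 2 [ht]
      ring
    rw [h1, Nat.div_div_eq_div_mul, mul_comm m t, h2,
      Nat.mul_div_mul_left _ _ htp]
  · intro k
    rw [Nat.div_div_eq_div_mul, mul_comm m s, pow_succ s (k + 1),
      show j * (s ^ (k + 1) * s) = s * (j * s ^ (k + 1)) by ring, Nat.mul_div_mul_left _ _ hs]

theorem muP_fracDigitsBelow {p : ℕ} (hp : p ∣ s) {j : ℕ} (hj : 0 < j) (m : ℕ) :
    muP s p (fracDigitsBelow s j m) = fracDigitsBelow s (p * j) m := by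
  have hs := NeZero.pos s
  unfold fracDigitsBelow
  rw [muP_ofNat hp (fun k => (j * s ^ (k + 1) - 1) / m)]
  · funext k
    obtain ⟨t, ht⟩ := hp
    have hp : 0 < p := Nat.pos_of_ne_zero (by rintro rfl; simp at ht; omega)
    have htp : 0 < t := Nat.pos_of_ne_zero (by rintro rfl; simp at ht; omega)
    have h1 : s / p = t := by rw [ht]; exact Nat.mul_div_cancel_left t hp
    have h2 : j * s ^ (k + 1 + 1) = t * (p * j * s ^ (k + 1)) := by
      rw [pow_succ s (k + 1)]
      nth_rewrite 2 [ht]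
      ring
    rw [h1, Nat.div_div_eq_div_mul, mul_comm m t, h2,
      mul_sub_one_div_cancel htp (by positivity)]
  · intro k
    rw [Nat.div_div_eq_div_mul, mul_comm m s, pow_succ s (k + 1),
      show j * (s ^ (k + 1) * s) = s * (j * s ^ (k + 1)) by ring,
      mul_sub_one_div_cancel hs (by positivity)]

theorem shiftN_fracDigits (j m : ℕ) :
    shiftN (Fin s) (fracDigits s j m) = fracDigits s (s * j) m := by
  funext k
  simp only [shiftN, fracDigits]
  congr 2
  ring

theorem shiftN_fracDigitsBelow (j m : ℕ) :
    shiftN (Fin s) (fracDigitsBelow s j m) = fracDigitsBelow s (s * j) m := by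
  funext k
  simp only [shiftN, fracDigitsBelow]
  congr 3
  ring

theorem fracDigits_mul_left {c : ℕ} (hc : 0 < c) (j m : ℕ) :
    fracDigits s (c * j) (c * m) = fracDigits s j m := by
  funext k
  simp only [fracDigits]
  rw [mul_assoc, Nat.mul_div_mul_left _ _ hc]

theorem fracDigitsBelow_mul_left {c j : ℕ} (hc : 0 < c) (hj : 0 < j) (m : ℕ) :
    fracDigitsBelow s (c * j) (c * m) = fracDigitsBelow s j m := by
  have hs := NeZero.pos s
  funext k
  simp only [fracDigitsBelow]
  rw [mul_assoc, mul_sub_one_div_cancel hc (by positivity)]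

theorem fracDigits_zero (m : ℕ) : fracDigits s 0 m = 0 := by
  ext k
  simp [fracDigits]

theorem fracDigits_add_self {m : ℕ} (hm : 0 < m) (j : ℕ) :
    fracDigits s (j + m) m = fracDigits s j m := by
  ext k
  simp only [fracDigits, Fin.val_ofNat]
  rw [add_mul, Nat.add_mul_div_left _ _ hm, pow_succ, Nat.add_mul_mod_self_right]

theorem fracDigits_one (n : ℕ) : fracDigits s n 1 = 0 := by
  induction n with
  | zero => exact fracDigits_zero 1
  | succ n ih => rw [fracDigits_add_self one_pos, ih]

theorem fracDigitsBelow_one {n : ℕ} (hn : 0 < n) :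
    fracDigitsBelow s n 1 = fracDigitsBelow s 1 1 := by
  have hs := NeZero.pos s
  obtain ⟨n, rfl⟩ : ∃ z, n = z + 1 := ⟨n - 1, by omega⟩
  ext k
  simp only [fracDigitsBelow, Fin.val_ofNat, Nat.div_one, one_mul]
  have : 0 < s ^ (k + 1) := by positivity
  rw [add_mul, one_mul, Nat.add_sub_assoc this, pow_succ, ← mul_assoc, Nat.mul_add_mod_self_right]

theorem fracDigits_eq_fracDigitsBelow {j m K : ℕ} (h : ¬ m ∣ j * s ^ K) :
    ∀ k < K, fracDigitsBelow s j m k = fracDigits s j m k := by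
  intro k hk
  have h' : ¬ m ∣ j * s ^ (k + 1) := fun hd =>
    h (hd.trans (mul_dvd_mul_left _ (pow_dvd_pow s hk)))
  simp only [fracDigitsBelow, fracDigits]
  congr 1
  obtain ⟨z, hz⟩ : ∃ z, j * s ^ (k + 1) = z + 1 := by
    refine ⟨j * s ^ (k + 1) - 1, ?_⟩
    have : j * s ^ (k + 1) ≠ 0 := fun h0 => h' (h0 ▸ dvd_zero m)
    omega
  rw [hz] at h' ⊢
  rw [Nat.succ_div_of_not_dvd h', Nat.add_sub_cancel]

theorem fracDigitsBelow_succ_eq {j K : ℕ} :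
    ∀ k < K, fracDigitsBelow s (j + 1) (s ^ K) k = fracDigits s j (s ^ K) k := by
  intro k hk
  have hs := NeZero.pos s
  simp only [fracDigitsBelow, fracDigits]
  congr 1
  obtain ⟨l, rfl⟩ := Nat.exists_eq_add_of_le (Nat.succ_le_of_lt hk)
  rw [Nat.succ_eq_add_one, pow_add s (k + 1) l, mul_comm (j + 1), mul_comm j,
    mul_sub_one_div_cancel (by positivity) (by positivity),
    Nat.mul_div_mul_left _ _ (by positivity), Nat.add_sub_cancel]

theorem fracDigits_eq_digits (j m : ℕ) : fracDigits s j m = Real.digits ((j : ℝ) / m) s := by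
  funext k
  simp only [fracDigits, Real.digits]
  congr 1
  rw [← Nat.floor_div_eq_div (K := ℝ)]
  congr 1
  push_cast
  ring

theorem ofDigits_fracDigits (hs : 2 ≤ s) {j m : ℕ} (hj : j < m) :
    Real.ofDigits (fracDigits s j m) = (j : ℝ) / m := by
  rw [fracDigits_eq_digits, Real.ofDigits_digits (by omega)]
  refine ⟨by positivity, ?_⟩
  rw [div_lt_one (by exact_mod_cast (by omega : 0 < m))]
  exact_mod_cast hj

theorem exists_eq_fracDigits (K : ℕ) (a : ℕ → Fin s) (ha : ∀ k, K ≤ k → a k = 0) :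
    ∃ j < s ^ K, a = fracDigits s j (s ^ K) := by
  have hs := NeZero.pos s
  induction K generalizing a with
  | zero =>
    refine ⟨0, by simp, ?_⟩
    rw [fracDigits_zero]
    exact funext fun k => ha k (Nat.zero_le k)
  | succ K ih =>
    obtain ⟨j, hj, h⟩ := ih (shiftN (Fin s) a) fun k hk => ha (k + 1) (by omega)
    refine ⟨(a 0).val * s ^ K + j, ?_, ?_⟩
    · have := (a 0).isLt
      calc (a 0).val * s ^ K + j < (a 0).val * s ^ K + s ^ K := by omega
        _ = ((a 0).val + 1) * s ^ K := by ring
        _ ≤ s * s ^ K := Nat.mul_le_mul_right _ this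
        _ = s ^ (K + 1) := by ring
    · have hK : 0 < s ^ K := by positivity
      ext k
      cases k with
      | zero =>
        simp only [fracDigits, Fin.val_ofNat]
        rw [zero_add, pow_one, pow_succ, Nat.mul_div_mul_right _ _ hs, mul_comm,
          Nat.mul_add_div hK, Nat.div_eq_of_lt hj, add_zero, Nat.mod_eq_of_lt (a 0).isLt]
      | succ k =>
        have h1 : a (k + 1) = fracDigits s j (s ^ K) k := congrFun h k
        rw [h1]
        simp only [fracDigits, Fin.val_ofNat]
        rw [pow_succ s (k + 1), pow_succ s K, ← mul_assoc, Nat.mul_div_mul_right _ _ hs, add_mul,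
          show (a 0).val * s ^ K * s ^ (k + 1) = s ^ K * ((a 0).val * s ^ k * s) by ring,
          Nat.mul_add_div hK, Nat.mul_add_mod_self_right]

/-- The sequence `a` with all digits from position `K` on replaced by zero. -/
def truncate (K : ℕ) (a : ℕ → Fin s) : ℕ → Fin s := fun k => if k < K then a k else 0

theorem truncate_eq_zero {K k : ℕ} (a : ℕ → Fin s) (hk : K ≤ k) : truncate K a k = 0 := by
  simp [truncate, hk]

theorem tendsto_truncate (a : ℕ → Fin s) :
    Tendsto (fun K => truncate K a) atTop (𝓝 a) := by
  rw [tendsto_pi_nhds]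
  intro k
  refine tendsto_const_nhds.congr' ?_
  filter_upwards [eventually_gt_atTop k] with K hK
  simp [truncate, hK]

theorem ofDigits_zero : Real.ofDigits (0 : ℕ → Fin s) = 0 := by
  simp [Real.ofDigits, Real.ofDigitsTerm]

theorem circlePoint_zero : circlePoint (0 : ℕ → Fin s) = 0 := by
  simp [circlePoint, ofDigits_zero]

theorem continuous_circlePoint {b : ℕ} : Continuous (circlePoint (s := b)) :=
  (AddCircle.continuous_mk' 1).comp Real.continuous_ofDigits

theorem norm_circlePoint_sub_le {d : ℕ} {a b : ℕ → Fin d} {K : ℕ} (h : ∀ k < K, a k = b k) :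
    ‖circlePoint a - circlePoint b‖ ≤ ((d : ℝ) ^ K)⁻¹ := by
  rw [circlePoint, circlePoint, ← AddCircle.coe_sub]
  exact (QuotientAddGroup.norm_mk_le_norm).trans (Real.abs_ofDigits_sub_ofDigits_le h)

theorem coe_unitAddCircle_eq_iff {x y : ℝ} :
    (x : UnitAddCircle) = y ↔ ∃ n : ℤ, x - y = n := by
  rw [← sub_eq_zero, ← AddCircle.coe_sub, AddCircle.coe_eq_zero_iff]
  simp [eq_comm]

theorem eq_of_coe_unitAddCircle_eq {x y : ℝ} (h : (x : UnitAddCircle) = y) (hxy : |x - y| < 1) :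
    x = y := by
  obtain ⟨n, hn⟩ := coe_unitAddCircle_eq_iff.1 h
  rw [hn] at hxy
  have : n = 0 := Int.abs_lt_one_iff.1 (by exact_mod_cast hxy)
  rw [this] at hn
  simpa [sub_eq_zero] using hn

theorem eq_of_circlePoint_eq (hs : 2 ≤ s) {K : ℕ} {a b : ℕ → Fin s} (ha : ∀ k, K ≤ k → a k = 0)
    (hb : ∀ k, K ≤ k → b k = 0) (h : circlePoint a = circlePoint b) : a = b := by
  obtain ⟨i, hi, rfl⟩ := exists_eq_fracDigits K a ha
  obtain ⟨j, hj, rfl⟩ := exists_eq_fracDigits K b hb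
  have hK : (0 : ℝ) < (s ^ K : ℕ) := by exact_mod_cast (by omega : 0 < s ^ K)
  have hi' : (i : ℝ) / (s ^ K : ℕ) < 1 := (div_lt_one hK).2 (by exact_mod_cast hi)
  have hj' : (j : ℝ) / (s ^ K : ℕ) < 1 := (div_lt_one hK).2 (by exact_mod_cast hj)
  have hi0 : 0 ≤ (i : ℝ) / (s ^ K : ℕ) := by positivity
  have hj0 : 0 ≤ (j : ℝ) / (s ^ K : ℕ) := by positivity
  rw [circlePoint, circlePoint, ofDigits_fracDigits hs hi, ofDigits_fracDigits hs hj] at h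
  have := eq_of_coe_unitAddCircle_eq h (by rw [abs_lt]; constructor <;> linarith)
  rw [div_left_inj' hK.ne'] at this
  rw [Nat.cast_injective this]

theorem ofDigits_shiftN (a : ℕ → Fin s) :
    Real.ofDigits (shiftN (Fin s) a) = s * Real.ofDigits a - (a 0).val := by
  have hs : (s : ℝ) ≠ 0 := by exact_mod_cast NeZero.ne s
  rw [Real.ofDigits_eq_sum_add_ofDigits a 1]
  simp only [Finset.range_one, Finset.sum_singleton, Real.ofDigitsTerm, zero_add, pow_one]
  field_simp
  change _ = _ + Real.ofDigits (shiftN (Fin s) a) - _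
  ring

theorem circlePoint_shiftN (a : ℕ → Fin s) :
    circlePoint (shiftN (Fin s) a) = s • circlePoint a := by
  rw [circlePoint, circlePoint, ← AddCircle.coe_nsmul, coe_unitAddCircle_eq_iff]
  refine ⟨-((a 0).val : ℤ), ?_⟩
  rw [ofDigits_shiftN]
  simp

theorem circlePoint_muP {p : ℕ} (hp : p ∣ s) (a : ℕ → Fin s) :
    circlePoint (muP s p a) = p • circlePoint a := by
  have hs := NeZero.pos s
  have hs' : (s : ℝ) ≠ 0 := by exact_mod_cast NeZero.ne s
  obtain ⟨t, ht⟩ := hp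
  have hp : 0 < p := Nat.pos_of_ne_zero (by rintro rfl; simp at ht; omega)
  have htp : 0 < t := Nat.pos_of_ne_zero (by rintro rfl; simp at ht; omega)
  have hdiv : ∀ x, p * x / s = x / t := fun x => by
    rw [ht, Nat.mul_div_mul_left _ _ hp]
  let c : ℕ → Fin s := fun k =>
    ⟨(a k).val / t, (Nat.div_le_self _ _).trans_lt (a k).isLt⟩
  have hc : ∀ k, ((muP s p a k).val : ℝ) = p * (a k).val + (c (k + 1)).val - s * (c k).val := by
    intro k
    have h1 : (a (k + 1)).val / t < p := by
      rw [Nat.div_lt_iff_lt_mul htp, ← ht]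
      exact (a (k + 1)).isLt
    have h2 : (p * (a k).val + (a (k + 1)).val / t) / s = (a k).val / t := by
      rw [show ∀ n : ℕ, n / s = n / p / t from fun n => by rw [Nat.div_div_eq_div_mul, ← ht],
        Nat.mul_add_div hp, Nat.div_eq_of_lt h1, add_zero]
    have h3 := Nat.mod_add_div (p * (a k).val + (a (k + 1)).val / t) s
    rw [h2] at h3
    rw [muP_val, hdiv]
    simp only [c]
    rw [eq_sub_iff_add_eq]
    exact_mod_cast h3
  have hsum : Real.ofDigits (muP s p a) =
      p * Real.ofDigits a + Real.ofDigits (shiftN (Fin s) c) - s * Real.ofDigits c := by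
    refine HasSum.tsum_eq ?_
    have h := ((Real.summable_ofDigitsTerm (digits := a)).hasSum.mul_left (p : ℝ)).add
      (Real.summable_ofDigitsTerm (digits := shiftN (Fin s) c)).hasSum |>.sub
      ((Real.summable_ofDigitsTerm (digits := c)).hasSum.mul_left (s : ℝ))
    refine h.congr_fun ?_
    intro k
    simp only [Real.ofDigitsTerm, hc, shiftN]
    ring
  rw [circlePoint, circlePoint, ← AddCircle.coe_nsmul, coe_unitAddCircle_eq_iff]
  refine ⟨-((c 0).val : ℤ), ?_⟩
  rw [hsum, ofDigits_shiftN]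
  simp only [nsmul_eq_mul, Int.cast_neg, Int.cast_natCast]
  ring

end Expansions

section Automata

variable {s : ℕ} [NeZero s]

theorem isCAT_comp {A : Type} [TopologicalSpace A] {τ μ : (ℕ → A) → (ℕ → A)}
    (hτ : IsCAT A τ) (hμ : IsCAT A μ) : IsCAT A (τ ∘ μ) := by
  refine ⟨hτ.1.comp hμ.1, ?_⟩
  rw [Function.comp_assoc, hμ.2, ← Function.comp_assoc, hτ.2, Function.comp_assoc]

/-- A transformation given by a local rule of width two is a cellular automaton. -/
theorem isCAT_of_local_rule {A : Type} [TopologicalSpace A] [DiscreteTopology A]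
    (f : A → A → A) : IsCAT A (fun a k => f (a k) (a (k + 1))) := by
  refine ⟨continuous_pi fun k => ?_, rfl⟩
  exact Continuous.comp (X := ℕ → A)
    (continuous_of_discreteTopology (f := fun x : A × A => f x.1 x.2))
    ((continuous_apply k).prodMk (continuous_apply (k + 1)))

theorem isCAT_muP (s p : ℕ) : IsCAT (Fin s) (muP s p) :=
  isCAT_of_local_rule (A := Fin s) fun x y =>
    if h : 0 < s then ⟨(p * x.val + p * y.val / s) % s, Nat.mod_lt _ h⟩ else x

theorem isCAT_muZero (s : ℕ) : IsCAT (Fin s) (muZero s) :=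
  isCAT_of_local_rule (A := Fin s) fun x _ => if h : 0 < s then ⟨0, h⟩ else x

theorem _root_.IsCAT.apply_shiftN {A : Type} [TopologicalSpace A] {τ : (ℕ → A) → (ℕ → A)}
    (hτ : IsCAT A τ) (a : ℕ → A) : τ (shiftN A a) = shiftN A (τ a) :=
  congrFun hτ.2 a

theorem shiftN_iterate_apply {A : Type} (a : ℕ → A) (n k : ℕ) :
    (shiftN A)^[n] a k = a (k + n) := by
  induction n generalizing k with
  | zero => rfl
  | succ n ih =>
    rw [Function.iterate_succ_apply', shiftN, ih]
    congr 1
    ring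

theorem _root_.IsCAT.apply_shiftN_iterate {A : Type} [TopologicalSpace A] {τ : (ℕ → A) → (ℕ → A)}
    (hτ : IsCAT A τ) (a : ℕ → A) (n : ℕ) : τ ((shiftN A)^[n] a) = (shiftN A)^[n] (τ a) :=
  (Function.Semiconj.iterate_right (f := τ) (fun x => hτ.apply_shiftN x) n) a

/-- A cellular automaton over a finite alphabet has a finite memory `w`. -/
theorem _root_.IsCAT.exists_memory {A : Type} [TopologicalSpace A] [DiscreteTopology A] [Finite A]
    {τ : (ℕ → A) → (ℕ → A)} (hτ : IsCAT A τ) :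
    ∃ w : ℕ, ∀ (K : ℕ) (a b : ℕ → A), (∀ k < K + w, a k = b k) → ∀ k < K, τ a k = τ b k := by
  have key : ∃ w : ℕ, ∀ a ∈ (Set.univ : Set (ℕ → A)), ∀ b : ℕ → A, (∀ k < w, a k = b k) →
      τ a 0 = τ b 0 := by
    refine isCompact_univ.induction_on
      (p := fun S => ∃ w : ℕ, ∀ a ∈ S, ∀ b : ℕ → A, (∀ k < w, a k = b k) → τ a 0 = τ b 0)
      ⟨0, by simp⟩ ?_ ?_ ?_
    · rintro S T hST ⟨w, hw⟩
      exact ⟨w, fun a ha => hw a (hST ha)⟩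
    · rintro S T ⟨w, hw⟩ ⟨v, hv⟩
      refine ⟨max w v, ?_⟩
      rintro a (ha | ha) b hab
      · exact hw a ha b fun k hk => hab k (lt_max_of_lt_left hk)
      · exact hv a ha b fun k hk => hab k (lt_max_of_lt_right hk)
    · intro a _
      have hopen : IsOpen {b : ℕ → A | τ b 0 = τ a 0} :=
        (isOpen_discrete {τ a 0}).preimage ((continuous_apply 0).comp hτ.1)
      obtain ⟨I, u, hu, hsub⟩ := isOpen_pi_iff.1 hopen a rfl
      refine ⟨(I : Set ℕ).pi u, mem_nhdsWithin_of_mem_nhds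
        (set_pi_mem_nhds I.finite_toSet fun i hi => (hu i hi).1.mem_nhds (hu i hi).2),
        I.sup id + 1, ?_⟩
      intro b hb c hbc
      have hc : c ∈ (I : Set ℕ).pi u := fun i hi => by
        rw [← hbc i (Nat.lt_succ_of_le (Finset.le_sup (f := id) hi))]
        exact hb i hi
      exact (hsub hb : τ b 0 = τ a 0).trans (hsub hc : τ c 0 = τ a 0).symm
  obtain ⟨w, hw⟩ := key
  refine ⟨w, fun K a b hab k hk => ?_⟩
  have h := hw ((shiftN A)^[k] a) trivial ((shiftN A)^[k] b) fun i hi => by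
    rw [shiftN_iterate_apply, shiftN_iterate_apply]
    exact hab _ (by omega)
  rw [hτ.apply_shiftN_iterate, hτ.apply_shiftN_iterate, shiftN_iterate_apply,
    shiftN_iterate_apply] at h
  simpa using h

theorem _root_.IsCAT.apply_eq_zero {τ : (ℕ → Fin s) → (ℕ → Fin s)} (hτ : IsCAT (Fin s) τ)
    (h0 : τ 0 = 0) {K : ℕ} {a : ℕ → Fin s} (ha : ∀ k, K ≤ k → a k = 0) {k : ℕ} (hk : K ≤ k) :
    τ a k = 0 := by
  have h1 : (shiftN (Fin s))^[k] a = 0 := by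
    funext i
    rw [shiftN_iterate_apply]
    exact ha _ (by omega)
  have h2 := hτ.apply_shiftN_iterate a k
  rw [h1, h0] at h2
  have h3 := congrFun h2 0
  rw [shiftN_iterate_apply] at h3
  simpa using h3.symm

/-- Cellular automata fixing the zero sequence are determined by their action on the circle. -/
theorem _root_.IsCAT.eq_of_circlePoint_eq (hs : 2 ≤ s) {τ μ : (ℕ → Fin s) → (ℕ → Fin s)}
    (hτ : IsCAT (Fin s) τ) (hμ : IsCAT (Fin s) μ) (hτ0 : τ 0 = 0) (hμ0 : μ 0 = 0)
    (h : ∀ a, circlePoint (τ a) = circlePoint (μ a)) : τ = μ := by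
  funext a
  have h1 := (hτ.1.tendsto a).comp (tendsto_truncate a)
  have h2 := (hμ.1.tendsto a).comp (tendsto_truncate a)
  refine tendsto_nhds_unique h1 (h2.congr fun K => ?_)
  have ha : ∀ k, K ≤ k → truncate K a k = 0 := fun k => truncate_eq_zero a
  exact (MultCA.eq_of_circlePoint_eq hs (fun k => hτ.apply_eq_zero hτ0 ha)
    (fun k => hμ.apply_eq_zero hμ0 ha) (h _)).symm

/-- The generators of the multiplication semigroup. -/
def multGenerators (s : ℕ) : Set ((ℕ → Fin s) → (ℕ → Fin s)) :=
  {τ | ∃ p : ℕ, p.Prime ∧ p ∣ s ∧ τ = muP s p} ∪ {muZero s, id}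

theorem muP_mem_gen {s p : ℕ} (hp : p.Prime) (hps : p ∣ s) : muP s p ∈ gen (multGenerators s) :=
  InGen.base (Or.inl ⟨p, hp, hps, rfl⟩)

theorem muZero_mem_gen (s : ℕ) : muZero s ∈ gen (multGenerators s) :=
  InGen.base (Or.inr (Or.inl rfl))

theorem id_mem_gen (s : ℕ) : id ∈ gen (multGenerators s) :=
  InGen.base (Or.inr (Or.inr rfl))

theorem isCAT_of_mem_gen {s : ℕ} {μ : (ℕ → Fin s) → (ℕ → Fin s)}
    (hμ : μ ∈ gen (multGenerators s)) : IsCAT (Fin s) μ := by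
  induction (hμ : InGen _ μ) with
  | base h =>
    obtain ⟨p, -, -, rfl⟩ | rfl | rfl := h
    · exact isCAT_muP s p
    · exact isCAT_muZero s
    · exact ⟨continuous_id, rfl⟩
  | comp _ _ ih₁ ih₂ => exact isCAT_comp ih₁ ih₂

theorem apply_zero_of_mem_gen {μ : (ℕ → Fin s) → (ℕ → Fin s)}
    (hμ : μ ∈ gen (multGenerators s)) : μ 0 = 0 := by
  induction (hμ : InGen _ μ) with
  | base h =>
    obtain ⟨p, -, -, rfl⟩ | rfl | rfl := h
    · exact muP_zero p
    · exact muZero_apply 0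
    · rfl
  | comp _ _ ih₁ ih₂ => rw [Function.comp_apply, ih₂, ih₁]

/-- Every element of the multiplication semigroup acts on the circle as multiplication by a
natural number. -/
theorem exists_nsmul_of_mem_gen {μ : (ℕ → Fin s) → (ℕ → Fin s)}
    (hμ : μ ∈ gen (multGenerators s)) :
    ∃ n : ℕ, ∀ a, circlePoint (μ a) = n • circlePoint a := by
  induction (hμ : InGen _ μ) with
  | base h =>
    obtain ⟨p, -, hps, rfl⟩ | rfl | rfl := h
    · exact ⟨p, circlePoint_muP hps⟩
    · exact ⟨0, fun a => by rw [muZero_apply, circlePoint_zero, zero_smul]⟩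
    · exact ⟨1, fun a => by rw [one_smul, id]⟩
  | comp _ _ ih₁ ih₂ =>
    obtain ⟨m, hm⟩ := ih₁
    obtain ⟨n, hn⟩ := ih₂
    exact ⟨m * n, fun a => by rw [Function.comp_apply, hm, hn, mul_smul]⟩

theorem comp_comm_of_mem_gen (hs : 2 ≤ s) {τ μ : (ℕ → Fin s) → (ℕ → Fin s)}
    (hτ : τ ∈ gen (multGenerators s)) (hμ : μ ∈ gen (multGenerators s)) : τ ∘ μ = μ ∘ τ := by
  refine IsCAT.eq_of_circlePoint_eq hs (isCAT_of_mem_gen (InGen.comp hτ hμ))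
    (isCAT_of_mem_gen (InGen.comp hμ hτ)) (apply_zero_of_mem_gen (InGen.comp hτ hμ))
    (apply_zero_of_mem_gen (InGen.comp hμ hτ)) fun a => ?_
  obtain ⟨m, hm⟩ := exists_nsmul_of_mem_gen hτ
  obtain ⟨n, hn⟩ := exists_nsmul_of_mem_gen hμ
  rw [Function.comp_apply, Function.comp_apply, hm, hn, hn, hm, smul_comm]

/-- Multiplication by a divisor of a power of `s` belongs to the multiplication semigroup. -/
theorem exists_mem_gen_of_dvd_pow {n k : ℕ} (hn : n ∣ s ^ k) :
    ∃ μ ∈ gen (multGenerators s), ∀ a, circlePoint (μ a) = n • circlePoint a := by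
  induction n using Nat.recOnMul with
  | zero =>
    exact ⟨muZero s, muZero_mem_gen s,
      fun a => by rw [muZero_apply, circlePoint_zero, zero_smul]⟩
  | one => exact ⟨id, id_mem_gen s, fun a => by rw [one_smul, id]⟩
  | prime p hp =>
    have hps := hp.dvd_of_dvd_pow hn
    exact ⟨muP s p, muP_mem_gen hp hps, circlePoint_muP hps⟩
  | mul m n ihm ihn =>
    obtain ⟨τ, hτ, hτ'⟩ := ihm ((Nat.dvd_mul_right m n).trans hn)
    obtain ⟨μ, hμ, hμ'⟩ := ihn ((Nat.dvd_mul_left n m).trans hn)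
    exact ⟨τ ∘ μ, InGen.comp hτ hμ,
      fun a => by rw [Function.comp_apply, hτ', hμ', mul_smul]⟩

end Automata

section Rigidity

variable {s : ℕ} [NeZero s]

/-- A nonzero point of the circle killed by `n` has norm at least `1 / n`. -/
theorem one_le_mul_norm_of_nsmul_eq_zero {u : UnitAddCircle} {n : ℕ} (hn : 0 < n)
    (h : n • u = 0) (hu : u ≠ 0) : 1 ≤ n * ‖u‖ := by
  have : Fact ((0 : ℝ) < 1) := ⟨one_pos⟩
  have hfin : IsOfFinAddOrder u := isOfFinAddOrder_iff_nsmul_eq_zero.2 ⟨n, hn, h⟩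
  have h1 := AddCircle.le_add_order_smul_norm_of_isOfFinAddOrder hfin hu
  rw [nsmul_eq_mul] at h1
  refine h1.trans (mul_le_mul_of_nonneg_right ?_ (norm_nonneg u))
  exact_mod_cast addOrderOf_le_of_nsmul_eq_zero hn h

theorem exists_coe_eq_abs_eq_norm (u : UnitAddCircle) :
    ∃ r : ℝ, (r : UnitAddCircle) = u ∧ |r| = ‖u‖ := by
  obtain ⟨x, rfl⟩ := QuotientAddGroup.mk_surjective u
  refine ⟨x - round x, ?_, ?_⟩
  · exact coe_unitAddCircle_eq_iff.2 ⟨-round x, by push_cast; ring⟩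
  · exact (UnitAddCircle.norm_eq (x := x)).symm

theorem norm_circlePoint_apply_sub_le {τ : (ℕ → Fin s) → (ℕ → Fin s)} {w : ℕ}
    (hw : ∀ (K : ℕ) (a b : ℕ → Fin s), (∀ k < K + w, a k = b k) → ∀ k < K, τ a k = τ b k)
    {K : ℕ} {a b : ℕ → Fin s} (h : ∀ k < K, a k = b k) :
    ‖circlePoint (τ a) - circlePoint (τ b)‖ ≤ (s : ℝ) ^ w / (s : ℝ) ^ K := by
  have hs : (1 : ℝ) ≤ s := by exact_mod_cast NeZero.pos s
  refine (norm_circlePoint_sub_le (K := K - w) fun k hk =>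
    hw (K - w) a b (fun i hi => h i (by omega)) k hk).trans ?_
  rw [inv_eq_one_div, div_le_div_iff₀ (by positivity) (by positivity), one_mul, ← pow_add]
  exact pow_le_pow_right₀ hs (by omega)

/-- The difference of the values of `τ` at the two expansions of `j / m`. -/
noncomputable def jump (τ : (ℕ → Fin s) → (ℕ → Fin s)) (j m : ℕ) : UnitAddCircle :=
  circlePoint (τ (fracDigitsBelow s j m)) - circlePoint (τ (fracDigits s j m))

theorem jump_mul_left (τ : (ℕ → Fin s) → (ℕ → Fin s)) {c j : ℕ} (hc : 0 < c) (hj : 0 < j)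
    (m : ℕ) : jump τ (c * j) (c * m) = jump τ j m := by
  rw [jump, fracDigits_mul_left hc, fracDigitsBelow_mul_left hc hj, jump]

theorem jump_mul_self (τ : (ℕ → Fin s) → (ℕ → Fin s)) {j m : ℕ} (hj : 0 < j) (hm : 0 < m) :
    jump τ (m * j) m = jump τ 1 1 := by
  have h := jump_mul_left τ hm hj 1
  rw [mul_one] at h
  rw [h, jump, jump, fracDigits_one, fracDigits_one, fracDigitsBelow_one hj]

theorem shift_nsmul_jump {τ : (ℕ → Fin s) → (ℕ → Fin s)} (hτ : IsCAT (Fin s) τ) (j m : ℕ) :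
    s • jump τ j m = jump τ (s * j) m := by
  rw [jump, jump, smul_sub, ← circlePoint_shiftN, ← circlePoint_shiftN, ← hτ.apply_shiftN,
    ← hτ.apply_shiftN, shiftN_fracDigits, shiftN_fracDigitsBelow]

theorem prime_nsmul_jump {τ : (ℕ → Fin s) → (ℕ → Fin s)} {p : ℕ} (hps : p ∣ s)
    (hp : ∀ a, τ (muP s p a) = muP s p (τ a)) {j : ℕ} (hj : 0 < j) (m : ℕ) :
    p • jump τ j m = jump τ (p * j) m := by
  rw [jump, jump, smul_sub, ← circlePoint_muP hps, ← circlePoint_muP hps, ← hp, ← hp,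
    muP_fracDigits hps, muP_fracDigitsBelow hps hj]

theorem pow_nsmul_jump {τ : (ℕ → Fin s) → (ℕ → Fin s)} {c : ℕ} (hc : 0 < c)
    (h : ∀ j m, 0 < j → c • jump τ j m = jump τ (c * j) m) {j : ℕ} (hj : 0 < j) (m n : ℕ) :
    c ^ n • jump τ j m = jump τ (c ^ n * j) m := by
  induction n with
  | zero => simp
  | succ n ih => rw [pow_succ', mul_smul, ih, h _ _ (by positivity), mul_assoc]

/-- A cellular automaton commuting with multiplication by a prime factor `p` of `s` respects the
identification of the two expansions of an `s`-adic rational, unless `s` is a power of `p`. -/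
theorem jump_eq_zero {τ : (ℕ → Fin s) → (ℕ → Fin s)} (hτ : IsCAT (Fin s) τ) {p e t : ℕ}
    (hp : p.Prime) (hps : p ∣ s) (hst : s = p ^ e * t) (ht : 2 ≤ t) (hpt : ¬ p ∣ t)
    (hcomm : ∀ a, τ (muP s p a) = muP s p (τ a)) {j : ℕ} (hj : 0 < j) (L : ℕ) :
    jump τ j (s ^ L) = 0 := by
  have hs := NeZero.pos s
  have hs' : (0 : ℝ) < s := by exact_mod_cast hs
  have hpp := hp.pos
  have hp1 : 0 < p - 1 := Nat.sub_pos_of_lt hp.one_lt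
  obtain ⟨w, hw⟩ := hτ.exists_memory
  obtain ⟨v, i, hpi, hji⟩ := Nat.exists_eq_pow_mul_and_not_dvd hj.ne' p hp.ne_one
  obtain ⟨K, hK⟩ := pow_unbounded_of_one_lt (s ^ L * p ^ (v + 1) * (p - 1) * s ^ w)
    (by omega : 1 < t)
  set m := v + e * K + 1 with hm
  have hmul : ∀ j m, 0 < j → p • jump τ j m = jump τ (p * j) m :=
    fun j m hj => prime_nsmul_jump hps hcomm hj m
  have hndvd : ¬ s ^ L * p ^ m ∣ j * s ^ K := by
    intro hd
    have h1 : p ^ m ∣ j * s ^ K := (Nat.dvd_mul_left _ _).trans hd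
    rw [hji, hst, mul_pow, ← pow_mul,
      show p ^ v * i * (p ^ (e * K) * t ^ K) = p ^ (v + e * K) * (i * t ^ K) by ring, hm,
      pow_succ] at h1
    have h2 := Nat.dvd_of_mul_dvd_mul_left (by positivity) h1
    rcases hp.dvd_mul.1 h2 with h3 | h3
    · exact hpi h3
    · exact hpt (hp.dvd_of_dvd_pow h3)
  have hnorm : ‖jump τ j (s ^ L * p ^ m)‖ ≤ (s : ℝ) ^ w / (s : ℝ) ^ K :=
    norm_circlePoint_apply_sub_le hw (fracDigits_eq_fracDigitsBelow hndvd)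
  have hγ : (p - 1) • jump τ 1 1 = 0 := by
    have h1 := hmul 1 1 one_pos
    have h2 := jump_mul_self τ hpp one_pos
    rw [mul_one] at h1
    rw [one_mul] at h2
    rw [h2] at h1
    have h3 : (p - 1 + 1) • jump τ 1 1 = jump τ 1 1 := by
      rwa [Nat.sub_add_cancel hpp]
    rwa [add_smul, one_smul, add_eq_right] at h3
  have htors : (s ^ L * p ^ m * (p - 1)) • jump τ j (s ^ L * p ^ m) = 0 := by
    rw [mul_comm _ (p - 1), mul_smul, mul_smul, pow_nsmul_jump hpp hmul hj,
      pow_nsmul_jump hs (fun j m _ => shift_nsmul_jump hτ j m) (by positivity), ← mul_assoc,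
      jump_mul_self τ hj (by positivity), hγ]
  have hzero : jump τ j (s ^ L * p ^ m) = 0 := by
    by_contra hne
    have h1 := one_le_mul_norm_of_nsmul_eq_zero (by positivity) htors hne
    have h2 := h1.trans (mul_le_mul_of_nonneg_left hnorm (Nat.cast_nonneg _))
    rw [mul_div_assoc', le_div_iff₀ (by positivity), one_mul] at h2
    have h3 : s ^ K ≤ s ^ L * p ^ m * (p - 1) * s ^ w := by exact_mod_cast h2
    have h4 : s ^ K = p ^ (e * K) * t ^ K := by rw [hst, mul_pow, ← pow_mul]
    have h5 : s ^ L * p ^ m * (p - 1) * s ^ w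
        = p ^ (e * K) * (s ^ L * p ^ (v + 1) * (p - 1) * s ^ w) := by rw [hm]; ring
    rw [h4, h5] at h3
    exact absurd (Nat.le_of_mul_le_mul_left h3 (by positivity)) (by omega)
  have h1 := pow_nsmul_jump hpp hmul hj (s ^ L * p ^ m) m
  rw [hzero, smul_zero, mul_comm (s ^ L), jump_mul_left τ (by positivity) hj] at h1
  exact h1.symm

/-- A family of circle points which behaves like the values at `j / s ^ K` of a Lipschitz circle
map commuting with multiplication by `s` comes from multiplication by an integer. -/
theorem exists_int_of_lipschitz_family {s w : ℕ} (hs : 2 ≤ s) (A : ℕ → ℕ → UnitAddCircle)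
    (hscale : ∀ j K, A (s * j) (K + 1) = A j K) (hmul : ∀ j K, s • A j (K + 1) = A j K)
    (hper : ∀ j K, A (j + s ^ K) K = A j K) (hzero : ∀ K, A 0 K = 0)
    (hlip : ∀ j K, ‖A (j + 1) K - A j K‖ ≤ (s : ℝ) ^ w / (s : ℝ) ^ K) :
    ∃ c : ℤ, ∀ᶠ K in atTop, ∀ j, A j K = ((c * j / (s : ℝ) ^ K : ℝ) : UnitAddCircle) := by
  have hs0 : (0 : ℝ) < s := by exact_mod_cast (by omega : 0 < s)
  choose r hr hrn using fun j K => exists_coe_eq_abs_eq_norm (A (j + 1) K - A j K)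
  have hbound : ∀ j K, |r j K| ≤ (s : ℝ) ^ w / (s : ℝ) ^ K := fun j K =>
    (hrn j K).trans_le (hlip j K)
  have hbound' : ∀ j K, s * |r j (K + 1)| ≤ (s : ℝ) ^ w / (s : ℝ) ^ K := fun j K => by
    refine (mul_le_mul_of_nonneg_left (hbound j (K + 1)) hs0.le).trans_eq ?_
    field_simp
    ring
  have hsmall : ∀ K, w + 2 ≤ K → (s : ℝ) ^ w / (s : ℝ) ^ K ≤ 1 / 4 := by
    intro K hK
    have h2 : (2 : ℝ) ≤ s := by exact_mod_cast hs
    rw [div_le_div_iff₀ (by positivity) (by positivity), one_mul]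
    calc (s : ℝ) ^ w * 4 ≤ s ^ w * (s * s) := by gcongr; nlinarith
      _ = s ^ (w + 2) := by ring
      _ ≤ s ^ K := pow_le_pow_right₀ (by linarith) hK
  have hrper : ∀ j K, w + 2 ≤ K → r (j + s ^ K) K = r j K := by
    intro j K hK
    refine eq_of_coe_unitAddCircle_eq ?_ ?_
    · rw [hr, hr, add_right_comm, hper, hper]
    · have := hsmall K hK
      refine (abs_sub _ _).trans_lt ?_
      linarith [hbound (j + s ^ K) K, hbound j K]
  have hrmul : ∀ j K, w + 2 ≤ K → s * r j (K + 1) = r j K := by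
    intro j K hK
    refine eq_of_coe_unitAddCircle_eq ?_ ?_
    · rw [← nsmul_eq_mul, AddCircle.coe_nsmul, hr, hr, smul_sub, hmul, hmul]
    · have := hsmall K hK
      refine (abs_sub _ _).trans_lt ?_
      rw [abs_mul, abs_of_pos hs0]
      linarith [hbound' j K, hbound j K]
  have hcoe : ∀ K i n, ((∑ k ∈ Finset.range n, r (i + k) K : ℝ) : UnitAddCircle)
      = A (i + n) K - A i K := by
    intro K i n
    induction n with
    | zero => simp
    | succ n ih =>
      rw [Finset.sum_range_succ, AddCircle.coe_add, ih, hr, add_assoc]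
      abel
  have hrsum : ∀ j K, w + 2 ≤ K → ∑ i ∈ Finset.range s, r (s * j + i) K = s * r j K := by
    intro j K hK
    have h1 : ∑ i ∈ Finset.range s, r (s * j + i) (K + 1) = r j K := by
      refine eq_of_coe_unitAddCircle_eq ?_ ?_
      · rw [hcoe, hr, hscale, ← mul_add_one, hscale]
      · have := hsmall K hK
        refine (abs_sub _ _).trans_lt ?_
        have h2 : |∑ i ∈ Finset.range s, r (s * j + i) (K + 1)| ≤ (s : ℝ) ^ w / (s : ℝ) ^ K := by
          refine (Finset.abs_sum_le_sum_abs _ _).trans ?_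
          refine (Finset.sum_le_card_nsmul _ _ _ fun i _ => hbound (s * j + i) (K + 1)).trans_eq ?_
          rw [Finset.card_range, nsmul_eq_mul]
          field_simp
          ring
        linarith [hbound j K]
    rw [← h1, Finset.mul_sum]
    exact Finset.sum_congr rfl fun i _ => (hrmul _ K hK).symm
  -- the partial sums of `r · K` are additive along multiples of the period
  have hlin : ∀ K, w + 2 ≤ K → ∀ j, ∑ i ∈ Finset.range j, r i K = j * r 0 K := by
    intro K hK
    set S : ℕ → ℝ := fun j => ∑ i ∈ Finset.range j, r i K with hS
    have hSs : ∀ j, S (s * j) = s * S j := by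
      intro j
      induction j with
      | zero => simp [hS]
      | succ j ih =>
        have h1 : S (j + 1) = S j + r j K := Finset.sum_range_succ _ _
        have h2 : S (s * (j + 1)) = S (s * j) + ∑ i ∈ Finset.range s, r (s * j + i) K := by
          rw [mul_add_one]; exact Finset.sum_range_add _ _ _
        rw [h2, hrsum j K hK, ih, h1]
        ring
    have hSpow : ∀ n j, S (s ^ n * j) = s ^ n * S j := by
      intro n j
      induction n with
      | zero => simp
      | succ n ih => rw [pow_succ', mul_assoc, hSs, ih]; ring
    have hSper : ∀ j, S (s ^ K * j) = j * S (s ^ K) := by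
      have hr' : ∀ n i, r (s ^ K * n + i) K = r i K := by
        intro n i
        induction n with
        | zero => simp
        | succ n ih => rw [mul_add_one, add_right_comm, hrper _ K hK, ih]
      intro j
      induction j with
      | zero => simp [hS]
      | succ j ih =>
        have h1 : S (s ^ K * j + s ^ K)
            = S (s ^ K * j) + ∑ i ∈ Finset.range (s ^ K), r (s ^ K * j + i) K :=
          Finset.sum_range_add _ _ _
        simp only [hr'] at h1
        rw [mul_add_one, h1, ih]
        push_cast
        ring
    have h1 : S 1 = r 0 K := by simp [hS]
    have h2 := hSpow K 1
    rw [mul_one, h1] at h2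
    intro j
    have h3 := (hSpow K j).symm.trans (hSper j)
    rw [h2] at h3
    have hsK : (s : ℝ) ^ K ≠ 0 := by positivity
    apply mul_left_cancel₀ hsK
    rw [h3]
    ring
  have hconst : ∀ n, (s : ℝ) ^ (w + 2 + n) * r 0 (w + 2 + n) = s ^ (w + 2) * r 0 (w + 2) := by
    intro n
    induction n with
    | zero => simp
    | succ n ih =>
      rw [← ih, ← hrmul 0 (w + 2 + n) (by omega), ← add_assoc, pow_succ]
      ring
  have hA : ∀ K, w + 2 ≤ K → ∀ j : ℕ, A j K
      = ((s ^ (w + 2) * r 0 (w + 2) * j / (s : ℝ) ^ K : ℝ) : UnitAddCircle) := by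
    intro K hK j
    have h1 := hcoe K 0 j
    simp only [zero_add, hzero, sub_zero] at h1
    obtain ⟨n, rfl⟩ := Nat.exists_eq_add_of_le hK
    rw [← h1, hlin _ hK, ← hconst n]
    congr 1
    field_simp
  obtain ⟨c, hc⟩ : ∃ c : ℤ, s ^ (w + 2) * r 0 (w + 2) = (c : ℝ) := by
    have h1 := hA (w + 2) le_rfl (s ^ (w + 2))
    have h2 := hper 0 (w + 2)
    rw [zero_add, hzero] at h2
    rw [h2, eq_comm, ← QuotientAddGroup.mk_zero, coe_unitAddCircle_eq_iff] at h1
    obtain ⟨c, hc⟩ := h1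
    refine ⟨c, ?_⟩
    rw [← hc]
    push_cast
    field_simp
    simp
  refine ⟨c, ?_⟩
  filter_upwards [eventually_ge_atTop (w + 2)] with K hK j
  rw [hA K hK, hc]

end Rigidity

section Classification

variable {s : ℕ} [NeZero s]

theorem exists_zsmul_of_commute (hs : 2 ≤ s) {τ : (ℕ → Fin s) → (ℕ → Fin s)}
    (hτ : IsCAT (Fin s) τ) (h0 : τ 0 = 0) {p e t : ℕ} (hp : p.Prime) (hps : p ∣ s)
    (hst : s = p ^ e * t) (ht : 2 ≤ t) (hpt : ¬ p ∣ t)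
    (hcomm : ∀ a, τ (muP s p a) = muP s p (τ a)) :
    ∃ c : ℤ, ∀ a, circlePoint (τ a) = c • circlePoint a := by
  obtain ⟨w, hw⟩ := hτ.exists_memory
  have hs0 := NeZero.pos s
  obtain ⟨c, hc⟩ := exists_int_of_lipschitz_family (w := w) hs
    (fun j K => circlePoint (τ (fracDigits s j (s ^ K))))
    (fun j K => by rw [pow_succ', fracDigits_mul_left hs0])
    (fun j K => by
      rw [← circlePoint_shiftN, ← hτ.apply_shiftN, shiftN_fracDigits, pow_succ',
        fracDigits_mul_left hs0])
    (fun j K => by rw [fracDigits_add_self (by positivity)])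
    (fun K => by rw [fracDigits_zero, h0, circlePoint_zero])
    (fun j K => by
      have h1 := jump_eq_zero hτ hp hps hst ht hpt hcomm j.succ_pos K
      rw [jump, sub_eq_zero] at h1
      rw [← h1]
      exact norm_circlePoint_apply_sub_le hw fracDigitsBelow_succ_eq)
  refine ⟨c, fun a => ?_⟩
  have h1 := ((continuous_circlePoint.comp hτ.1).tendsto a).comp (tendsto_truncate a)
  have h2 := ((continuous_circlePoint.const_smul c).tendsto a).comp (tendsto_truncate a)
  refine tendsto_nhds_unique h1 (h2.congr' ?_)
  filter_upwards [hc] with K hK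
  obtain ⟨j, hj, hja⟩ := exists_eq_fracDigits K (truncate K a) fun k => truncate_eq_zero a
  have hpoint : circlePoint (fracDigits s j (s ^ K)) = ((j / (s ^ K : ℕ) : ℝ) : UnitAddCircle) := by
    rw [circlePoint, ofDigits_fracDigits hs hj]
  have hKj := hK j
  simp only [Function.comp_apply]
  rw [hja, hKj, Pi.smul_apply, hpoint, ← AddCircle.coe_zsmul, zsmul_eq_mul]
  congr 1
  push_cast
  ring

/-- The multiplier of a cellular automaton fixing the zero sequence is zero or a divisor of a power
of `s`. -/
theorem multiplier_eq_zero_or_dvd_pow (hs : 2 ≤ s) {τ : (ℕ → Fin s) → (ℕ → Fin s)}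
    (hτ : IsCAT (Fin s) τ) (h0 : τ 0 = 0) {c : ℤ}
    (hc : ∀ a, circlePoint (τ a) = c • circlePoint a) :
    c = 0 ∨ ∃ n k : ℕ, c = n ∧ n ∣ s ^ k := by
  obtain ⟨w, hw⟩ := hτ.exists_memory
  have hs2 : (2 : ℝ) ≤ s := by exact_mod_cast hs
  have hfirst : ∀ a b : ℕ → Fin s, (∀ k < 1 + w, a k = b k) →
      |Real.ofDigits (τ a) - Real.ofDigits (τ b)| ≤ 1 / 2 := by
    intro a b hab
    refine (Real.abs_ofDigits_sub_ofDigits_le (n := 1) (hw 1 a b hab)).trans ?_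
    rw [pow_one, inv_eq_one_div]
    exact one_div_le_one_div_of_le two_pos hs2
  have hfrac : ∀ j m : ℕ, j < m →
      ∃ n : ℤ, Real.ofDigits (τ (fracDigits s j m)) - c * ((j : ℝ) / m) = n := by
    intro j m hjm
    have h1 := hc (fracDigits s j m)
    rwa [circlePoint, circlePoint, ofDigits_fracDigits hs hjm, ← AddCircle.coe_zsmul,
      zsmul_eq_mul, coe_unitAddCircle_eq_iff] at h1
  have hpos : ∀ k < 1 + w, s ^ (k + 1) ≤ s ^ (1 + w) := fun k hk =>
    Nat.pow_le_pow_right (by omega) hk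
  rcases lt_trichotomy c 0 with hneg | rfl | hcpos
  · exfalso
    set M : ℕ := s ^ (1 + w) + 2 * c.natAbs + 1 with hM
    have hagree : ∀ k < 1 + w,
        fracDigits s 1 M k = (0 : ℕ → Fin s) k := by
      intro k hk
      have h1 := hpos k hk
      rw [fracDigits, one_mul, Nat.div_eq_of_lt (by omega)]
      simp
    have h1 := hfirst _ _ hagree
    rw [h0, ofDigits_zero, sub_zero] at h1
    have h2 := Real.ofDigits_nonneg (τ (fracDigits s 1 M))
    obtain ⟨n, hn⟩ := hfrac 1 M (by omega)
    have hMpos : (0 : ℝ) < M := by exact_mod_cast (by omega : 0 < M)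
    have hcR : (c : ℝ) < 0 := by exact_mod_cast hneg
    have hcM : -(c : ℝ) * 2 < M := by
      have : -c * 2 < (M : ℤ) := by omega
      exact_mod_cast this
    have h3 : 0 < -(c : ℝ) * (1 / M) := by
      have : 0 < -(c : ℝ) := by linarith
      positivity
    have h4 : -(c : ℝ) * (1 / M) < 1 / 2 := by
      rw [mul_one_div, div_lt_div_iff₀ hMpos two_pos]
      linarith
    rw [abs_of_nonneg h2] at h1
    push_cast at hn
    have h5 : (0 : ℝ) < n := by linarith
    have h6 : (n : ℝ) < 1 := by linarith
    have h7 : 0 < n := by exact_mod_cast h5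
    have h8 : n < 1 := by exact_mod_cast h6
    omega
  · exact Or.inl rfl
  · right
    obtain ⟨n, rfl⟩ := Int.eq_ofNat_of_zero_le hcpos.le
    have hn0 : 0 < n := by exact_mod_cast hcpos
    refine ⟨n, 1 + w, rfl, ?_⟩
    by_contra hnd
    have hn1 : n ≠ 1 := by
      rintro rfl
      exact hnd (one_dvd _)
    have hn2 : 2 ≤ n := by omega
    set M : ℕ := s ^ (1 + w) + 5 with hM
    have hMR : (5 : ℝ) < M := by
      have : 0 < s ^ (1 + w) := by positivity
      exact_mod_cast (by omega : 5 < M)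
    have hagree : ∀ k < 1 + w,
        fracDigits s (M - 1) (n * M) k = fracDigits s (M + 1) (n * M) k := by
      intro k hk
      simp only [fracDigits]
      congr 1
      set y := s ^ (k + 1) with hy
      have hyM : y < M := by have := hpos k hk; omega
      have hny : ¬ n ∣ y := fun h => hnd (h.trans (pow_dvd_pow s hk))
      have hr0 : 1 ≤ y % n := Nat.pos_of_ne_zero fun h => hny (Nat.dvd_of_mod_eq_zero h)
      have hrn : y % n < n := Nat.mod_lt _ hn0
      have hdm := Nat.div_add_mod y n
      have hMy : M * y = y / n * (n * M) + y % n * M := by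
        conv_lhs => rw [← hdm]
        ring
      have hlow : M ≤ y % n * M := Nat.le_mul_of_pos_left M hr0
      have hup : y % n * M + M ≤ n * M := by
        rw [← Nat.succ_mul]
        exact Nat.mul_le_mul_right M hrn
      have e1 : (M - 1) * y / (n * M) = y / n := by
        apply Nat.div_eq_of_lt_le
        · rw [Nat.sub_one_mul]
          omega
        · rw [Nat.sub_one_mul, Nat.add_one_mul (y / n)]
          omega
      have e2 : (M + 1) * y / (n * M) = y / n := by
        apply Nat.div_eq_of_lt_le
        · rw [Nat.add_one_mul]
          omega
        · rw [Nat.add_one_mul, Nat.add_one_mul (y / n)]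
          omega
      rw [e1, e2]
    have h1 := hfirst _ _ hagree
    have hnM : 2 * M ≤ n * M := Nat.mul_le_mul_right M hn2
    obtain ⟨i, hi⟩ := hfrac (M - 1) (n * M) (by omega)
    obtain ⟨j, hj⟩ := hfrac (M + 1) (n * M) (by omega)
    have hnR : (n : ℝ) ≠ 0 := by positivity
    have hM1 : 1 ≤ M := by omega
    have f1 : ((n : ℤ) : ℝ) * (((M - 1 : ℕ) : ℝ) / ((n * M : ℕ) : ℝ)) = 1 - 1 / M := by
      push_cast [Nat.cast_sub hM1]
      field_simp
    have f2 : ((n : ℤ) : ℝ) * (((M + 1 : ℕ) : ℝ) / ((n * M : ℕ) : ℝ)) = 1 + 1 / M := by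
      push_cast
      field_simp
    rw [f1] at hi
    rw [f2] at hj
    have hε : 0 < 1 / (M : ℝ) := by positivity
    have hε' : 1 / (M : ℝ) < 1 / 5 := one_div_lt_one_div_of_lt (by norm_num) hMR
    have a1 := Real.ofDigits_nonneg (τ (fracDigits s (M - 1) (n * M)))
    have a2 := Real.ofDigits_le_one (τ (fracDigits s (M - 1) (n * M)))
    have b1 := Real.ofDigits_nonneg (τ (fracDigits s (M + 1) (n * M)))
    have b2 := Real.ofDigits_le_one (τ (fracDigits s (M + 1) (n * M)))
    have i0 : i = 0 := by
      have h2 : (-1 : ℝ) < i := by linarith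
      have h3 : (i : ℝ) < 1 := by linarith
      have h4 : -1 < i := by exact_mod_cast h2
      have h5 : i < 1 := by exact_mod_cast h3
      omega
    have j0 : j = -1 := by
      have h2 : (-2 : ℝ) < j := by linarith
      have h3 : (j : ℝ) < 0 := by linarith
      have h4 : -2 < j := by exact_mod_cast h2
      have h5 : j < 0 := by exact_mod_cast h3
      omega
    rw [i0] at hi
    rw [j0] at hj
    push_cast at hi hj
    rw [abs_le] at h1
    linarith

theorem isMC_of_not_isPrimePow (hs : 2 ≤ s) (hpp : ¬ IsPrimePow s) :
    IsMC (CATset (Fin s)) (gen (multGenerators s)) := by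
  refine ⟨fun μ hμ => isCAT_of_mem_gen hμ, fun τ hτ μ hμ => comp_comm_of_mem_gen hs hτ hμ, ?_⟩
  intro τ hτ hcomm
  have h0 : τ 0 = 0 := by
    have h := congrFun (hcomm _ (muZero_mem_gen s)) 0
    simpa only [Function.comp_apply, muZero_apply] using h
  obtain ⟨p, hp, hps⟩ := Nat.exists_prime_and_dvd (by omega : s ≠ 1)
  obtain ⟨e, t, hpt, hst⟩ := Nat.exists_eq_pow_mul_and_not_dvd (by omega : s ≠ 0) p hp.ne_one
  have he : 0 < e := Nat.pos_of_ne_zero fun he => hpt (by rwa [hst, he, pow_zero, one_mul] at hps)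
  have ht : 2 ≤ t := by
    by_contra hlt
    interval_cases t
    · simp at hpt
    · exact hpp ((isPrimePow_nat_iff s).2 ⟨p, e, hp, he, by rw [hst, mul_one]⟩)
  obtain ⟨c, hc⟩ := exists_zsmul_of_commute hs hτ h0 hp hps hst ht hpt
    fun a => congrFun (hcomm _ (muP_mem_gen hp hps)) a
  have hmem : ∃ μ ∈ gen (multGenerators s), ∀ a, circlePoint (μ a) = c • circlePoint a := by
    rcases multiplier_eq_zero_or_dvd_pow hs hτ h0 hc with rfl | ⟨n, k, rfl, hn⟩
    · exact ⟨muZero s, muZero_mem_gen s,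
        fun a => by rw [muZero_apply, circlePoint_zero, zero_smul]⟩
    · simpa only [natCast_zsmul] using exists_mem_gen_of_dvd_pow hn
  obtain ⟨μ, hμ, hμc⟩ := hmem
  have : τ = μ := hτ.eq_of_circlePoint_eq hs (isCAT_of_mem_gen hμ) h0 (apply_zero_of_mem_gen hμ)
    fun a => (hc a).trans (hμc a).symm
  rwa [this]

end Classification

section PrimePower

variable {p f : ℕ}

/-- The `i`-th digit in base `p`. -/
def digit (x : Fin (p ^ (f + 1))) : Fin (f + 1) → Fin p := finFunctionFinEquiv.symm x

theorem digit_val (x : Fin (p ^ (f + 1))) (i : Fin (f + 1)) :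
    (digit x i : ℕ) = x / p ^ (i : ℕ) % p := rfl

theorem digit_injective : Function.Injective (digit (p := p) (f := f)) :=
  finFunctionFinEquiv.symm.injective

variable [NeZero p]

/-- Keep the base-`p` digits of `x` at the places where `y` has a nonzero digit. -/
def mask (x y : Fin (p ^ (f + 1))) : Fin (p ^ (f + 1)) :=
  finFunctionFinEquiv fun i => if digit y i = 0 then 0 else digit x i

theorem digit_mask (x y : Fin (p ^ (f + 1))) (i : Fin (f + 1)) :
    digit (mask x y) i = if digit y i = 0 then 0 else digit x i := by
  rw [mask, digit, Equiv.symm_apply_apply]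

theorem mul_add_div_pow_mod {p : ℕ} (hp : 0 < p) (x y f : ℕ) :
    (p * x + p * y / p ^ (f + 1)) % p ^ (f + 1) % p = y / p ^ f % p := by
  rw [pow_succ', Nat.mul_div_mul_left _ _ hp, Nat.mod_mul_right_mod, Nat.mul_add_mod]

theorem mul_add_div_pow_div {p : ℕ} (hp : 0 < p) (x : ℕ) {y f i : ℕ} (hy : y < p ^ (f + 1))
    (hi : i < f) :
    (p * x + p * y / p ^ (f + 1)) % p ^ (f + 1) / p ^ (i + 1) % p = x / p ^ i % p := by
  have hsplit : p ^ (f + 1) = p ^ (i + 1) * p ^ (f - i) := by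
    rw [← pow_add]
    congr 1
    omega
  have hlt : y / p ^ f < p := Nat.div_lt_of_lt_mul (by rwa [← pow_succ])
  have hdiv : p * y / p ^ (f + 1) = y / p ^ f := by
    rw [pow_succ', Nat.mul_div_mul_left _ _ hp]
  rw [hdiv, hsplit, Nat.mod_mul_right_div_self, Nat.mod_mod_of_dvd _ (dvd_pow_self p (by omega)),
    pow_succ', ← Nat.div_div_eq_div_mul, Nat.mul_add_div hp, Nat.div_eq_of_lt hlt, add_zero]

theorem digit_muP_zero (a : ℕ → Fin (p ^ (f + 1))) (k : ℕ) :
    digit (muP (p ^ (f + 1)) p a k) 0 = digit (a (k + 1)) (Fin.last f) := by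
  ext
  rw [digit_val, digit_val, muP_val, Fin.val_zero, pow_zero, Nat.div_one,
    mul_add_div_pow_mod (NeZero.pos p), Fin.val_last]

theorem digit_muP_succ (a : ℕ → Fin (p ^ (f + 1))) (k : ℕ) (i : Fin f) :
    digit (muP (p ^ (f + 1)) p a k) i.succ = digit (a k) i.castSucc := by
  ext
  rw [digit_val, digit_val, muP_val, Fin.val_succ,
    mul_add_div_pow_div (NeZero.pos p) _ (a (k + 1)).isLt i.isLt, Fin.val_castSucc]

theorem muP_mask (a b : ℕ → Fin (p ^ (f + 1))) :
    muP (p ^ (f + 1)) p (fun k => mask (a k) (b k)) =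
      fun k => mask (muP (p ^ (f + 1)) p a k) (muP (p ^ (f + 1)) p b k) := by
  funext k
  refine digit_injective (funext fun i => ?_)
  refine Fin.cases ?_ (fun j => ?_) i
  · simp only [digit_mask, digit_muP_zero]
  · simp only [digit_mask, digit_muP_succ]

/-- The automaton which masks a sequence by its image under multiplication by `p`. -/
def maskAutomaton (p f : ℕ) [NeZero p] : (ℕ → Fin (p ^ (f + 1))) → (ℕ → Fin (p ^ (f + 1))) :=
  fun a k => mask (a k) (muP (p ^ (f + 1)) p a k)

theorem isCAT_maskAutomaton : IsCAT (Fin (p ^ (f + 1))) (maskAutomaton p f) :=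
  isCAT_of_local_rule (A := Fin (p ^ (f + 1))) fun x y => mask x
    (if h : 0 < p ^ (f + 1) then
      ⟨(p * x.val + p * y.val / p ^ (f + 1)) % p ^ (f + 1), Nat.mod_lt _ h⟩ else x)

theorem maskAutomaton_muP (a : ℕ → Fin (p ^ (f + 1))) :
    maskAutomaton p f (muP (p ^ (f + 1)) p a) = muP (p ^ (f + 1)) p (maskAutomaton p f a) :=
  (muP_mask a (muP (p ^ (f + 1)) p a)).symm

theorem digit_zero (i : Fin (f + 1)) : digit (0 : Fin (p ^ (f + 1))) i = 0 := by
  ext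
  simp [digit_val]

theorem mask_zero_left (y : Fin (p ^ (f + 1))) : mask 0 y = 0 := by
  refine digit_injective (funext fun i => ?_)
  rw [digit_mask, digit_zero, ite_self]

theorem mask_self (x : Fin (p ^ (f + 1))) : mask x x = x := by
  refine digit_injective (funext fun i => ?_)
  rw [digit_mask]
  split_ifs with h
  · exact h.symm
  · rfl

theorem maskAutomaton_zero : maskAutomaton p f 0 = 0 := by
  funext k
  exact mask_zero_left _

theorem maskAutomaton_comm_of_mem_gen (hp : p.Prime) {μ : (ℕ → Fin (p ^ (f + 1))) → _}
    (hμ : μ ∈ gen (multGenerators (p ^ (f + 1)))) :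
    maskAutomaton p f ∘ μ = μ ∘ maskAutomaton p f := by
  induction hμ with
  | base h =>
    rcases h with ⟨q, hq, hqs, rfl⟩ | rfl | rfl
    · obtain rfl := (Nat.prime_dvd_prime_iff_eq hq hp).1 (hq.dvd_of_dvd_pow hqs)
      exact funext maskAutomaton_muP
    · funext a
      simp only [Function.comp_apply, muZero_apply, maskAutomaton_zero]
    · rfl
  | comp _ _ ih₁ ih₂ =>
    rw [← Function.comp_assoc, ih₁, Function.comp_assoc, ih₂, Function.comp_assoc]

theorem mask_one_eq_zero (hp : p.Prime) {y : Fin (p ^ (f + 1))} (hy : p ∣ y) :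
    mask 1 y = 0 := by
  refine digit_injective (funext fun i => ?_)
  have h1 : 1 < p ^ (f + 1) := Nat.one_lt_pow (by omega) hp.one_lt
  rw [digit_mask, digit_zero]
  refine ite_eq_left_iff.2 fun hi => ?_
  refine Fin.cases (fun hi => ?_) (fun j hi => ?_) i hi
  · refine absurd (Fin.ext ?_) hi
    rw [digit_val, Fin.val_zero, pow_zero, Nat.div_one, Nat.mod_eq_zero_of_dvd hy, Fin.val_zero]
  · ext
    rw [digit_val, Fin.val_one', Nat.mod_eq_of_lt h1, Fin.val_succ,
      Nat.div_eq_of_lt (Nat.one_lt_pow (by omega) hp.one_lt), Nat.zero_mod, Fin.val_zero]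

theorem maskAutomaton_single (hp : p.Prime) (K : ℕ) :
    maskAutomaton p f (Pi.single K 1) = 0 := by
  funext k
  rw [maskAutomaton]
  rcases eq_or_ne k K with rfl | hk
  · rw [Pi.single_eq_same]
    refine mask_one_eq_zero hp ?_
    rw [muP_val, Pi.single_eq_same, Pi.single_eq_of_ne (by omega), Fin.val_zero, mul_zero,
      Nat.zero_div, add_zero]
    exact (Nat.dvd_mod_iff (dvd_pow_self p (by omega))).2 (dvd_mul_right _ _)
  · rw [Pi.single_eq_of_ne hk, mask_zero_left]
    rfl

theorem exists_maskAutomaton_ne_zero (hp : p.Prime) : ∃ a, maskAutomaton p f a ≠ 0 := by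
  have : Fact (1 < p) := ⟨hp.one_lt⟩
  set x : Fin (p ^ (f + 1)) := finFunctionFinEquiv fun _ => 1 with hx
  have hdigit : ∀ i, digit x i = 1 := fun i => by rw [hx, digit, Equiv.symm_apply_apply]
  have hfix : muP (p ^ (f + 1)) p (fun _ => x) = fun _ => x := by
    funext k
    refine digit_injective (funext fun i => ?_)
    refine Fin.cases ?_ (fun j => ?_) i
    · rw [digit_muP_zero, hdigit, hdigit]
    · rw [digit_muP_succ, hdigit, hdigit]
  refine ⟨fun _ => x, fun h => ?_⟩
  have h2 := congrFun h 0
  rw [maskAutomaton, hfix, mask_self, Pi.zero_apply] at h2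
  have h3 := hdigit 0
  rw [h2, digit_zero, Fin.ext_iff, Fin.val_zero, Fin.val_one', Nat.mod_eq_of_lt hp.one_lt] at h3
  exact zero_ne_one h3

theorem fracDigits_one_pow {s : ℕ} [NeZero s] (hs : 2 ≤ s) (K : ℕ) :
    fracDigits s 1 (s ^ (K + 1)) = Pi.single K 1 := by
  funext k
  have hs0 : 0 < s := by omega
  rw [fracDigits, one_mul]
  rcases lt_trichotomy k K with h | rfl | h
  · rw [Pi.single_eq_of_ne h.ne, Nat.div_eq_of_lt (Nat.pow_lt_pow_right hs (by omega))]
    simp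
  · rw [Pi.single_eq_same, Nat.div_self (by positivity)]
    rfl
  · rw [Pi.single_eq_of_ne h.ne', Nat.pow_div (by omega) hs0]
    ext
    rw [Fin.val_ofNat, Fin.val_zero]
    exact Nat.mod_eq_zero_of_dvd (dvd_pow_self s (by omega))

theorem maskAutomaton_notMem_gen (hp : p.Prime) :
    maskAutomaton p f ∉ gen (multGenerators (p ^ (f + 1))) := by
  intro hmem
  have h1 : 1 < p ^ (f + 1) := Nat.one_lt_pow (by omega) hp.one_lt
  obtain ⟨n, hn⟩ := exists_nsmul_of_mem_gen hmem
  have hn0 : n = 0 := by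
    have h2 := hn (fracDigits (p ^ (f + 1)) 1 ((p ^ (f + 1)) ^ (n + 1)))
    rw [fracDigits_one_pow h1, maskAutomaton_single hp, circlePoint_zero, ← fracDigits_one_pow h1,
      circlePoint, ofDigits_fracDigits h1 (Nat.one_lt_pow n.succ_ne_zero h1), ← AddCircle.coe_nsmul,
      nsmul_eq_mul, eq_comm, ← AddCircle.coe_zero, coe_unitAddCircle_eq_iff] at h2
    obtain ⟨m, hm⟩ := h2
    have hlt : n < (p ^ (f + 1)) ^ (n + 1) := n.lt_succ_self.trans (Nat.lt_pow_self h1)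
    generalize (p ^ (f + 1)) ^ (n + 1) = M at hm hlt
    have hM : (0 : ℝ) < M := by exact_mod_cast (by omega : 0 < M)
    rw [sub_zero, Nat.cast_one, mul_one_div, div_eq_iff hM.ne'] at hm
    have hm' : (n : ℤ) = m * M := by exact_mod_cast hm
    exact Nat.eq_zero_of_dvd_of_lt (Int.natCast_dvd_natCast.1 ⟨m, by rw [hm', mul_comm]⟩) hlt
  obtain ⟨a, ha⟩ := exists_maskAutomaton_ne_zero (p := p) (f := f) hp
  refine ha ?_
  have h2 : maskAutomaton p f = muZero (p ^ (f + 1)) :=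
    isCAT_maskAutomaton.eq_of_circlePoint_eq h1 (isCAT_muZero _) maskAutomaton_zero
      (muZero_apply _) fun a => by rw [hn, hn0, zero_smul, muZero_apply, circlePoint_zero]
  rw [h2, muZero_apply]

end PrimePower

theorem not_isMC_of_isPrimePow {s : ℕ} (hpp : IsPrimePow s) :
    ¬ IsMC (CATset (Fin s)) (gen (multGenerators s)) := by
  obtain ⟨p, e, hp, he, rfl⟩ := (isPrimePow_nat_iff s).1 hpp
  obtain ⟨f, rfl⟩ := Nat.exists_eq_add_of_le' he
  have : NeZero p := ⟨hp.ne_zero⟩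
  exact fun h => maskAutomaton_notMem_gen hp <| h.2.2 _ isCAT_maskAutomaton
    fun μ hμ => maskAutomaton_comm_of_mem_gen hp hμ

end MultCA

/-- For `s ≥ 2` with prime factors `p₁, …, p_d`, the semigroup
`⟨μ_{p₁}, …, μ_{p_d}, μ₀, μ₁⟩ ⊆ CAT(Λ_s^ℕ)` is maximal commutative iff `s` is not
a power of a prime. (Here `μ₁ = id`.) -/
theorem mult_semigroup_MC_iff (s : ℕ) (hs : 2 ≤ s) :
    IsMC (CATset (Fin s))
        (gen ({τ | ∃ p : ℕ, p.Prime ∧ p ∣ s ∧ τ = muP s p} ∪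
          {muZero s, id} : Set ((ℕ → Fin s) → (ℕ → Fin s)))) ↔
      ¬ IsPrimePow s := by
  have : NeZero s := ⟨by omega⟩
  exact ⟨fun h hpp => MultCA.not_isMC_of_isPrimePow hpp h, MultCA.isMC_of_not_isPrimePow hs⟩
end

section
/- Let p be a prime dividing s with s not a power of p. If τ ∈ CAT(Λ_s^ℕ) commutes with μ_p, then τ descends through the evaluation map to a well-defined continuous torus function: there exists a continuous map τ̃ : 𝕋 → 𝕋 such that τ̃ ∘ V = V ∘ τ. -/
/-- The evaluation map `V : Λ_s^ℕ → 𝕋 = ℝ/ℤ`, `V(a) = Σ_{n=0}^∞ a_n / s^{n+1}`. -/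
noncomputable def Veval (s : ℕ) (a : ℕ → Fin s) : AddCircle (1 : ℝ) :=
  ((∑' n : ℕ, ((a n : ℕ) : ℝ) / (s : ℝ) ^ (n + 1) : ℝ) : AddCircle (1 : ℝ))

open Filter Topology

/-- A rounding function to the integers that commutes with integer translations and is compatible
with division by positive integers. The two relevant ones are `⌊y⌋` and `⌈y⌉ - 1`. -/
structure IsRounding (ρ : ℝ → ℤ) : Prop where
  div_natCast : ∀ (y : ℝ) (q : ℕ), 0 < q → ρ (y / q) = ρ y / q
  add_intCast : ∀ (y : ℝ) (n : ℤ), ρ (y + n) = ρ y + n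

theorem isRounding_floor : IsRounding (fun y => ⌊y⌋) where
  div_natCast y q _ := Int.floor_div_natCast y q
  add_intCast y n := Int.floor_add_intCast y n

theorem isRounding_ceil_sub_one : IsRounding (fun y => ⌈y⌉ - 1) where
  div_natCast y q hq := by
    have hq' : (0 : ℝ) < q := by exact_mod_cast hq
    have hqz : (0 : ℤ) < q := by exact_mod_cast hq
    have h1 : ((⌈y⌉ - 1 : ℤ) : ℝ) < y := by
      have := Int.ceil_lt_add_one y
      push_cast
      linarith
    have h2 : y ≤ ⌈y⌉ := Int.le_ceil y
    have h3 := Int.mul_ediv_add_emod (⌈y⌉ - 1) q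
    have h4 := Int.emod_nonneg (⌈y⌉ - 1) hqz.ne'
    have h5 := Int.emod_lt_of_pos (⌈y⌉ - 1) hqz
    set m := (⌈y⌉ - 1) / (q : ℤ)
    have h6 : ((q * m : ℤ) : ℝ) ≤ ((⌈y⌉ - 1 : ℤ) : ℝ) := by exact_mod_cast (by linarith)
    have h7 : (⌈y⌉ : ℝ) ≤ ((q * m + q : ℤ) : ℝ) := by exact_mod_cast (by linarith)
    have h8 : ⌈y / q⌉ = m + 1 := by
      rw [Int.ceil_eq_iff, lt_div_iff₀ hq', div_le_iff₀ hq']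
      push_cast at h6 h7 h1 ⊢
      constructor <;> linarith
    simp only [h8, add_sub_cancel_right]
  add_intCast y n := by
    simp only [Int.ceil_add_intCast]
    ring

/-- The base-`s` digit sequence of the fractional part of `x`, computed with the rounding
function `ρ`. -/
noncomputable def expansion (s : ℕ) [NeZero s] (ρ : ℝ → ℤ) (x : ℝ) : ℕ → Fin s := fun i =>
  ⟨(ρ (x * s ^ (i + 1)) % s).toNat, by
    have hs : (0 : ℤ) < s := by exact_mod_cast NeZero.pos s
    have := Int.emod_lt_of_pos (ρ (x * s ^ (i + 1))) hs
    have := Int.emod_nonneg (ρ (x * s ^ (i + 1))) hs.ne'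
    omega⟩

section expansion

variable {s : ℕ} [NeZero s] {ρ : ℝ → ℤ}

theorem intCast_expansion (x : ℝ) (i : ℕ) :
    ((expansion s ρ x i : ℕ) : ℤ) = ρ (x * s ^ (i + 1)) % s :=
  Int.toNat_of_nonneg (Int.emod_nonneg _ (by exact_mod_cast NeZero.ne s))

theorem expansion_add_intCast (hρ : IsRounding ρ) (x : ℝ) (n : ℤ) :
    expansion s ρ (x + n) = expansion s ρ x := by
  ext i
  zify
  rw [intCast_expansion, intCast_expansion]
  have : (x + n) * (s : ℝ) ^ (i + 1) = x * s ^ (i + 1) + ((n * s ^ i * s : ℤ) : ℝ) := by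
    push_cast
    ring
  rw [this, hρ.add_intCast, Int.add_mul_emod_self_right]

theorem muP_expansion (hρ : IsRounding ρ) {p : ℕ} (hp : 0 < p) (hps : p ∣ s) (x : ℝ) :
    muP s p (expansion s ρ x) = expansion s ρ (p * x) := by
  obtain ⟨q, hq⟩ := hps
  have hs : 0 < s := NeZero.pos s
  have hq0 : 0 < q := Nat.pos_of_ne_zero (by rintro rfl; omega)
  have hsR : (s : ℝ) = p * q := by exact_mod_cast hq
  have hsZ : (s : ℤ) = p * q := by exact_mod_cast hq
  have hpR : (p : ℝ) ≠ 0 := by exact_mod_cast hp.ne'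
  have hqR : (q : ℝ) ≠ 0 := by exact_mod_cast hq0.ne'
  have hpZ : (0 : ℤ) < p := by exact_mod_cast hp
  have hqZ : (0 : ℤ) < q := by exact_mod_cast hq0
  ext i
  simp only [muP, hs, dif_pos]
  zify
  rw [intCast_expansion, intCast_expansion, intCast_expansion]
  have h1 : x * (s : ℝ) ^ (i + 1) = x * s ^ (i + 1 + 1) / s := by
    rw [pow_succ _ (i + 1), hsR]
    field_simp
  have h2 : p * x * (s : ℝ) ^ (i + 1) = x * s ^ (i + 1 + 1) / q := by
    rw [pow_succ _ (i + 1), hsR]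
    field_simp
  rw [h2, h1, hρ.div_natCast _ _ hs, hρ.div_natCast _ _ hq0]
  generalize ρ (x * (s : ℝ) ^ (i + 1 + 1)) = A
  have h3 : p * (A % s) / s = A % s / q := by
    nth_rewrite 2 [hsZ]
    exact Int.mul_ediv_mul_of_pos _ _ hpZ
  have h4 : A / q = p * (A / s) + A % s / q := by
    have : A = A % s + (p * (A / s)) * q := by
      have := Int.emod_add_mul_ediv A s
      nth_rewrite 2 [hsZ] at this
      linarith
    nth_rewrite 1 [this]
    rw [Int.add_mul_ediv_right _ _ hqZ.ne', add_comm]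
  rw [h3, h4]
  exact Int.ModEq.add_right _ ((Int.mod_modEq _ _).mul_left _)

theorem iterate_muP_expansion (hρ : IsRounding ρ) {p : ℕ} (hp : 0 < p) (hps : p ∣ s) (x : ℝ)
    (N : ℕ) : (muP s p)^[N] (expansion s ρ (x / p ^ N)) = expansion s ρ x := by
  have hpR : (p : ℝ) ≠ 0 := by exact_mod_cast hp.ne'
  induction N with
  | zero => simp
  | succ N ih =>
    rw [Function.iterate_succ_apply, muP_expansion hρ hp hps, ← ih]
    congr 2
    rw [pow_succ]
    field_simp

/-- The two expansions of `x` have the same digit at every place where the scaled number is not an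
integer. -/
theorem expansion_floor_eq_expansion_ceil {x : ℝ} {i : ℕ}
    (h : ¬ ∃ z : ℤ, x * s ^ (i + 1) = z) :
    expansion s (fun y => ⌊y⌋) x i = expansion s (fun y => ⌈y⌉ - 1) x i := by
  ext
  zify
  rw [intCast_expansion, intCast_expansion]
  congr 1
  have h1 : ⌈x * (s : ℝ) ^ (i + 1)⌉ ≤ ⌊x * (s : ℝ) ^ (i + 1)⌋ + 1 := Int.ceil_le_floor_add_one _
  have h2 : ⌊x * (s : ℝ) ^ (i + 1)⌋ < ⌈x * (s : ℝ) ^ (i + 1)⌉ := by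
    by_contra! h3
    refine h ⟨⌊x * (s : ℝ) ^ (i + 1)⌋, le_antisymm ?_ (Int.floor_le _)⟩
    exact (Int.le_ceil _).trans (by exact_mod_cast h3)
  omega

end expansion

theorem Veval_eq_ofDigits {s : ℕ} (a : ℕ → Fin s) :
    Veval s a = ((Real.ofDigits a : ℝ) : AddCircle (1 : ℝ)) := by
  simp only [Veval, Real.ofDigits, Real.ofDigitsTerm, div_eq_mul_inv]

theorem ofDigits_tail {s : ℕ} (a : ℕ → Fin s) (i : ℕ) :
    Real.ofDigits (fun n => a (n + i)) * s = a i + Real.ofDigits (fun n => a (n + (i + 1))) := by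
  have hs : (s : ℝ) ≠ 0 := by exact_mod_cast (Fin.pos (a 0)).ne'
  rw [Real.ofDigits_eq_sum_add_ofDigits _ 1]
  simp only [Finset.sum_range_one, Real.ofDigitsTerm, zero_add, pow_one, add_mul, add_assoc,
    add_comm 1 i]
  field_simp

/-- Every digit sequence is one of the two expansions of the number it evaluates to. -/
theorem eq_expansion_ofDigits {s : ℕ} [NeZero s] (hs : 2 ≤ s) (a : ℕ → Fin s) :
    a = expansion s (fun y => ⌊y⌋) (Real.ofDigits a) ∨
      a = expansion s (fun y => ⌈y⌉ - 1) (Real.ofDigits a) := by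
  have hsR : (2 : ℝ) ≤ s := by exact_mod_cast hs
  set T : ℕ → ℝ := fun i => Real.ofDigits (fun n => a (n + i)) with hT
  have hT0 (i) : 0 ≤ T i := Real.ofDigits_nonneg _
  have hT1 (i) : T i ≤ 1 := Real.ofDigits_le_one _
  have hstep (i) : T i * s = a i + T (i + 1) := ofDigits_tail a i
  have hdigit (i) : ((a i : ℕ) : ℝ) + 1 ≤ s := by exact_mod_cast (a i).isLt
  have hdigit0 (i) : (0 : ℝ) ≤ (a i : ℕ) := Nat.cast_nonneg _
  have hB (i : ℕ) : ∃ B : ℤ, Real.ofDigits a * s ^ i = B + T i := by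
    induction i with
    | zero => exact ⟨0, by simp [hT]⟩
    | succ i ih =>
      obtain ⟨B, hB⟩ := ih
      refine ⟨B * s + (a i : ℕ), ?_⟩
      rw [pow_succ, ← mul_assoc, hB, add_mul, hstep]
      push_cast
      ring
  have hA (i : ℕ) : ∃ B : ℤ, Real.ofDigits a * s ^ (i + 1) =
      ((B * s + (a i : ℕ) : ℤ) : ℝ) + T (i + 1) := by
    obtain ⟨B, hB⟩ := hB i
    refine ⟨B, ?_⟩
    rw [pow_succ, ← mul_assoc, hB, add_mul, hstep]
    push_cast
    ring
  have hmod (B : ℤ) (i : ℕ) : (B * s + (a i : ℕ)) % (s : ℤ) = (a i : ℕ) := by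
    rw [add_comm, Int.add_mul_emod_self_right]
    exact Int.emod_eq_of_lt (by positivity) (by exact_mod_cast (a i).isLt)
  by_cases h : ∃ i, T i = 1
  · right
    obtain ⟨i, hi⟩ := h
    have hone (k : ℕ) : T (i + k) = 1 := by
      induction k with
      | zero => exact hi
      | succ k ih =>
        have := hstep (i + k)
        rw [ih] at this
        have := hdigit (i + k)
        exact le_antisymm (hT1 _) (by rw [← add_assoc]; linarith)
    have hpos (j : ℕ) : 0 < T j := by
      refine (hT0 j).lt_of_ne' fun hj => ?_
      have hzero (k : ℕ) : T (j + k) = 0 := by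
        induction k with
        | zero => exact hj
        | succ k ih =>
          have := hstep (j + k)
          rw [ih] at this
          have := hdigit0 (j + k)
          exact le_antisymm (by rw [← add_assoc]; linarith) (hT0 _)
      have h1 := hone j
      have h2 := hzero i
      rw [add_comm] at h2
      linarith
    ext k
    zify
    rw [intCast_expansion]
    obtain ⟨B, hB⟩ := hA k
    have : ⌈Real.ofDigits a * s ^ (k + 1)⌉ = B * s + (a k : ℕ) + 1 := by
      rw [hB, Int.ceil_intCast_add, show ⌈T (k + 1)⌉ = 1 from Int.ceil_eq_iff.2 ?_]
      have := hpos (k + 1)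
      have := hT1 (k + 1)
      constructor <;> norm_num <;> linarith
    rw [this, add_sub_cancel_right, hmod]
  · left
    push Not at h
    ext k
    zify
    rw [intCast_expansion]
    obtain ⟨B, hB⟩ := hA k
    have : ⌊Real.ofDigits a * s ^ (k + 1)⌋ = B * s + (a k : ℕ) := by
      rw [hB, Int.floor_intCast_add, Int.floor_eq_zero_iff.2, add_zero]
      exact ⟨hT0 _, (hT1 _).lt_of_ne (h _)⟩
    rw [this, hmod]

theorem Veval_muP {s p : ℕ} (hp : 0 < p) (hps : p ∣ s) (a : ℕ → Fin s) :
    Veval s (muP s p a) = p • Veval s a := by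
  have hs : 0 < s := Fin.pos (a 0)
  have hsR : (s : ℝ) ≠ 0 := by exact_mod_cast hs.ne'
  obtain ⟨q, hq⟩ := hps
  have hq0 : 0 < q := Nat.pos_of_ne_zero (by rintro rfl; omega)
  set w : ℕ → ℝ := fun k => ((p * (a k).val / s : ℕ) : ℝ) / s ^ k
  have hterm (k : ℕ) : Real.ofDigitsTerm (muP s p a) k + w k =
      p * Real.ofDigitsTerm a k + w (k + 1) := by
    have hdiv (c : ℕ) : p * c / s = c / q := by rw [hq, Nat.mul_div_mul_left _ _ hp]
    have hlt (c : ℕ) (hc : c < s) : c / q < p := by rwa [Nat.div_lt_iff_lt_mul hq0, ← hq]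
    have hnat : (p * (a k).val + p * (a (k + 1)).val / s) % s + s * (p * (a k).val / s) =
        p * (a k).val + p * (a (k + 1)).val / s := by
      have h1 := hlt _ (a (k + 1)).isLt
      have h2 : (p * (a k).val + p * (a (k + 1)).val / s) / s = p * (a k).val / s := by
        rw [hdiv, hdiv]
        generalize (a k).val = c, (a (k + 1)).val / q = d at h1
        rw [hq, ← Nat.div_div_eq_div_mul, Nat.mul_add_div hp, Nat.div_eq_of_lt h1, add_zero]
      rw [← h2, Nat.mod_add_div]
    have hreal := congrArg (Nat.cast : ℕ → ℝ) hnat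
    simp only [Real.ofDigitsTerm, muP, hs, dif_pos, w]
    push_cast at hreal ⊢
    generalize ((p * (a (k + 1)).val / s : ℕ) : ℝ) = c at *
    generalize ((p * (a k).val / s : ℕ) : ℝ) = d at *
    field_simp
    linear_combination (s : ℝ) ^ k * hreal
  have hsum1 := Real.summable_ofDigitsTerm (digits := muP s p a)
  have hsum2 := (Real.summable_ofDigitsTerm (digits := a)).mul_left (p : ℝ)
  have hsumw : Summable w := by
    refine hsum2.of_nonneg_of_le (fun k => by positivity) fun k => ?_
    have h : ((p * (a k).val / s : ℕ) : ℝ) ≤ ((p * (a k).val : ℕ) : ℝ) / s := Nat.cast_div_le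
    calc w k ≤ ((p * (a k).val : ℕ) : ℝ) / s / s ^ k := by
          simp only [w]
          gcongr
      _ = p * Real.ofDigitsTerm a k := by
          simp only [Real.ofDigitsTerm]
          push_cast
          field_simp
          ring
  have hsumw' : Summable fun k => w (k + 1) := (summable_nat_add_iff 1).2 hsumw
  have htot := tsum_congr (L := .unconditional ℕ) hterm
  rw [hsum1.tsum_add hsumw, hsum2.tsum_add hsumw', hsumw.tsum_eq_zero_add, tsum_mul_left] at htot
  have hval : Real.ofDigits (muP s p a) =
      p * Real.ofDigits a - ((p * (a 0).val / s : ℕ) : ℤ) * (1 : ℝ) := by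
    have hw0 : w 0 = ((p * (a 0).val / s : ℕ) : ℝ) := by simp [w]
    rw [hw0] at htot
    simp only [Real.ofDigits, Int.cast_natCast]
    linarith
  rw [Veval_eq_ofDigits, Veval_eq_ofDigits, hval, AddCircle.coe_sub, ← nsmul_eq_mul,
    AddCircle.coe_nsmul, ← zsmul_eq_mul, AddCircle.coe_zsmul, AddCircle.coe_period, smul_zero,
    sub_zero]

theorem Veval_iterate_muP {s p : ℕ} (hp : 0 < p) (hps : p ∣ s) (N : ℕ) (a : ℕ → Fin s) :
    Veval s ((muP s p)^[N] a) = p ^ N • Veval s a := by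
  induction N with
  | zero => simp
  | succ N ih =>
    rw [Function.iterate_succ_apply', Veval_muP hp hps, ih, ← mul_smul, pow_succ']

/-- Sequences agreeing on their first `n` terms have close evaluations. -/
theorem norm_Veval_sub_le {s n : ℕ} {a b : ℕ → Fin s} (h : ∀ i < n, a i = b i) :
    ‖Veval s a - Veval s b‖ ≤ ((s : ℝ) ^ n)⁻¹ := by
  rw [Veval_eq_ofDigits, Veval_eq_ofDigits, ← AddCircle.coe_sub]
  exact (QuotientAddGroup.norm_mk_le_norm).trans (Real.abs_ofDigits_sub_ofDigits_le h)

theorem continuous_Veval (s : ℕ) : Continuous (Veval s) := by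
  rw [show Veval s = fun a => ((Real.ofDigits a : ℝ) : AddCircle (1 : ℝ)) from
    funext Veval_eq_ofDigits]
  exact (AddCircle.continuous_mk' 1).comp Real.continuous_ofDigits

theorem surjective_Veval {s : ℕ} (hs : 2 ≤ s) : Function.Surjective (Veval s) := by
  intro t
  obtain ⟨x, rfl⟩ := QuotientAddGroup.mk_surjective t
  have hx : Int.fract x ∈ Set.Icc (0 : ℝ) 1 := ⟨Int.fract_nonneg x, (Int.fract_lt_one x).le⟩
  obtain ⟨a, -, ha⟩ := Real.ofDigits_SurjOn (b := s) hs hx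
  refine ⟨a, ?_⟩
  rw [Veval_eq_ofDigits, ha]
  exact AddCircle.coe_fract x

/-- A cellular automaton transformation is given by a local rule of some finite window size. -/
theorem IsCAT.exists_window {A : Type} [TopologicalSpace A] [DiscreteTopology A] [CompactSpace A]
    {τ : (ℕ → A) → (ℕ → A)} (hτ : IsCAT A τ) :
    ∃ r : ℕ, ∀ (a b : ℕ → A) (n : ℕ), (∀ i < n + r, a i = b i) → ∀ i < n + 1, τ a i = τ b i := by
  have hcont : Continuous fun a => τ a 0 := (continuous_apply 0).comp hτ.1
  have hloc (a : ℕ → A) : ∃ n, PiNat.cylinder a n ⊆ {b | τ b 0 = τ a 0} := by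
    have hopen : IsOpen {b | τ b 0 = τ a 0} := (isOpen_discrete {τ a 0}).preimage hcont
    obtain ⟨_, ⟨c, n, rfl⟩, hac, hsub⟩ :=
      (PiNat.isTopologicalBasis_cylinders (fun _ => A)).exists_subset_of_mem_open
        (show a ∈ {b | τ b 0 = τ a 0} from rfl) hopen
    refine ⟨n, ?_⟩
    rwa [PiNat.mem_cylinder_iff_eq.1 hac]
  choose n hn using hloc
  obtain ⟨F, hF⟩ := isCompact_univ.elim_finite_subcover (fun a => PiNat.cylinder a (n a))
    (fun a => PiNat.isOpen_cylinder _ a (n a))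
    (fun a _ => Set.mem_iUnion.2 ⟨a, PiNat.self_mem_cylinder a (n a)⟩)
  have hzero (a b : ℕ → A) (h : ∀ i < F.sup n, a i = b i) : τ a 0 = τ b 0 := by
    obtain ⟨c, hcF, hc⟩ := Set.mem_iUnion₂.1 (hF (Set.mem_univ a))
    have hb : b ∈ PiNat.cylinder c (n c) := fun i hi =>
      (h i (hi.trans_le (Finset.le_sup hcF))).symm.trans (hc i hi)
    exact (hn c hc).trans (hn c hb).symm
  have hshift (a : ℕ → A) (i : ℕ) : τ a i = τ (fun k => a (k + i)) 0 := by
    induction i generalizing a with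
    | zero => rfl
    | succ i ih =>
      have := congrFun (congrFun hτ.2 a) i
      simp only [Function.comp_apply, shiftN] at this
      rw [← this, ih]
      rfl
  refine ⟨F.sup n, fun a b m h i hi => ?_⟩
  rw [hshift a, hshift b]
  exact hzero _ _ fun k hk => h _ (by omega)

/-- If `x / p ^ (v * M)`, with `v` the exponent of `p` in `s`, becomes an integer after
multiplication by `s ^ (i + 1)`, then `i` is at least `M` up to a constant. -/
theorem exists_le_of_div_mul_pow_eq_intCast {s p : ℕ} (hs : s ≠ 0) (hp : p.Prime) (hps : p ∣ s)
    {x : ℝ} (hx : x ≠ 0) :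
    ∃ e : ℕ, ∀ M i : ℕ, (∃ z : ℤ, x / p ^ (s.factorization p * M) * s ^ (i + 1) = z) →
      M ≤ i + 1 + e := by
  have hpR : (p : ℝ) ≠ 0 := by exact_mod_cast hp.ne_zero
  have hsR : (s : ℝ) ≠ 0 := by exact_mod_cast hs
  have hv : 0 < s.factorization p := hp.factorization_pos_of_dvd hs hps
  set v := s.factorization p
  by_cases hk : ∃ (n : ℕ) (k : ℤ), x * s ^ n = k
  · obtain ⟨n, k, hk⟩ := hk
    have hk0 : k.natAbs ≠ 0 := by
      rw [Int.natAbs_ne_zero]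
      rintro rfl
      simp [hx, hsR] at hk
    refine ⟨k.natAbs.factorization p, fun M i ⟨z, hz⟩ => ?_⟩
    have heq : k * (s : ℤ) ^ (i + 1) = p ^ (v * M) * (z * s ^ n) := by
      have : (k : ℝ) * s ^ (i + 1) = p ^ (v * M) * (z * s ^ n) := by
        rw [← hk, ← hz]
        field_simp
      exact_mod_cast this
    have hdvd : p ^ (v * M) ∣ k.natAbs * s ^ (i + 1) := by
      have := Int.natAbs_dvd_natAbs.2 (Dvd.intro _ heq.symm)
      simpa [Int.natAbs_mul, Int.natAbs_pow] using this
    rw [hp.pow_dvd_iff_le_factorization (by positivity),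
      Nat.factorization_mul hk0 (by positivity), Nat.factorization_pow] at hdvd
    simp only [Finsupp.add_apply, Finsupp.smul_apply, smul_eq_mul] at hdvd
    change v * M ≤ _ + (i + 1) * v at hdvd
    nlinarith
  · refine ⟨0, fun M i ⟨z, hz⟩ => absurd ⟨i + 1, p ^ (v * M) * z, ?_⟩ hk⟩
    push_cast
    rw [← hz]
    field_simp

theorem one_lt_ordCompl {s p : ℕ} (hs : s ≠ 0) (hpow : ¬ ∃ m : ℕ, s = p ^ m) :
    1 < s / p ^ s.factorization p := by
  have h1 := Nat.ordCompl_pos p hs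
  refine lt_of_le_of_ne h1 fun h => hpow ⟨s.factorization p, ?_⟩
  have := Nat.ordProj_mul_ordCompl_eq_self s p
  rw [← h, mul_one] at this
  exact this.symm

/-- A cellular automaton transformation commuting with multiplication by `p` does not separate the
two expansions of a nonzero real number. -/
theorem Veval_map_expansion_floor_eq_ceil {s p : ℕ} [NeZero s] (hp : p.Prime) (hps : p ∣ s)
    (hpow : ¬ ∃ m : ℕ, s = p ^ m) {τ : (ℕ → Fin s) → (ℕ → Fin s)} (hτ : IsCAT (Fin s) τ)
    (hcomm : τ ∘ muP s p = muP s p ∘ τ) {x : ℝ} (hx : x ≠ 0) :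
    Veval s (τ (expansion s (fun y => ⌊y⌋) x)) =
      Veval s (τ (expansion s (fun y => ⌈y⌉ - 1) x)) := by
  have hs : s ≠ 0 := NeZero.ne s
  have hs1 : (1 : ℝ) ≤ s := by exact_mod_cast NeZero.one_le
  obtain ⟨r, hr⟩ := hτ.exists_window
  obtain ⟨e, he⟩ := exists_le_of_div_mul_pow_eq_intCast hs hp hps hx
  have hm := one_lt_ordCompl hs hpow
  have hsm := Nat.ordProj_mul_ordCompl_eq_self s p
  set v := s.factorization p
  set m := s / p ^ v
  have hmR : (1 : ℝ) < m := by exact_mod_cast hm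
  have hsmR : (s : ℝ) = p ^ v * m := by exact_mod_cast hsm.symm
  have hpR : (0 : ℝ) < p := by exact_mod_cast hp.pos
  have hlift {ρ : ℝ → ℤ} (hρ : IsRounding ρ) (N : ℕ) :
      Veval s (τ (expansion s ρ x)) = p ^ N • Veval s (τ (expansion s ρ (x / p ^ N))) := by
    rw [← Veval_iterate_muP hp.pos hps, ← iterate_muP_expansion hρ hp.pos hps x N]
    congr 1
    exact (Function.Semiconj.iterate_right (f := τ) (congrFun hcomm) N) _
  have hbound (M : ℕ) : ‖Veval s (τ (expansion s (fun y => ⌊y⌋) x)) -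
      Veval s (τ (expansion s (fun y => ⌈y⌉ - 1) x))‖ ≤ (s : ℝ) ^ (e + r + 1) * (m : ℝ)⁻¹ ^ M := by
    rw [hlift isRounding_floor (v * M), hlift isRounding_ceil_sub_one (v * M), ← nsmul_sub]
    set y := x / (p : ℝ) ^ (v * M)
    have hagree (i : ℕ) (hi : i < M - (e + r + 1)) :
        τ (expansion s (fun y => ⌊y⌋) y) i = τ (expansion s (fun y => ⌈y⌉ - 1) y) i := by
      refine hr _ _ i (fun j hj => expansion_floor_eq_expansion_ceil fun hz => ?_) i (by omega)
      have := he M j hz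
      omega
    have hdiff := norm_Veval_sub_le hagree
    have hpowle : ((s : ℝ) ^ (M - (e + r + 1)))⁻¹ ≤ s ^ (e + r + 1) * ((s : ℝ) ^ M)⁻¹ := by
      rw [← div_eq_mul_inv, le_div_iff₀ (by positivity), inv_mul_le_iff₀ (by positivity),
        ← pow_add]
      exact pow_le_pow_right₀ hs1 (by omega)
    calc _ ≤ (p ^ (v * M) : ℕ) * ‖Veval s (τ (expansion s (fun y => ⌊y⌋) y)) -
          Veval s (τ (expansion s (fun y => ⌈y⌉ - 1) y))‖ := norm_nsmul_le
      _ ≤ (p ^ (v * M) : ℕ) * (s ^ (e + r + 1) * ((s : ℝ) ^ M)⁻¹) := by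
          gcongr
          exact hdiff.trans hpowle
      _ = (s : ℝ) ^ (e + r + 1) * (m : ℝ)⁻¹ ^ M := by
          have h : ((s : ℝ) ^ M)⁻¹ = ((p : ℝ) ^ (v * M))⁻¹ * (m : ℝ)⁻¹ ^ M := by
            rw [hsmR, mul_pow, ← pow_mul, mul_inv, inv_pow]
          rw [h]
          push_cast
          field_simp
  have hlim : Tendsto (fun M : ℕ => (s : ℝ) ^ (e + r + 1) * (m : ℝ)⁻¹ ^ M) atTop (𝓝 0) := by
    simpa using (tendsto_pow_atTop_nhds_zero_of_lt_one (by positivity)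
      (inv_lt_one_of_one_lt₀ hmR)).const_mul ((s : ℝ) ^ (e + r + 1))
  exact sub_eq_zero.1 (norm_le_zero_iff.1 (ge_of_tendsto' hlim hbound))

/-- Let `p` be a prime dividing `s` with `s` not a power of `p`.
If `τ ∈ CAT(Λ_s^ℕ)` commutes with `μ_p`, then `τ` descends through the evaluation map
to a well-defined continuous torus function `τ̃` with `τ̃ ∘ V = V ∘ τ`. -/
theorem commuting_with_muP_descends_to_torus (s p : ℕ) (hs : 2 ≤ s) (hp : p.Prime)
    (hps : p ∣ s) (hpow : ¬ ∃ m : ℕ, s = p ^ m)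
    (τ : (ℕ → Fin s) → (ℕ → Fin s)) (hτ : IsCAT (Fin s) τ)
    (hcomm : τ ∘ muP s p = muP s p ∘ τ) :
    ∃ g : AddCircle (1 : ℝ) → AddCircle (1 : ℝ),
      Continuous g ∧ g ∘ Veval s = Veval s ∘ τ := by
  have : NeZero s := ⟨by omega⟩
  have hfloor (a : ℕ → Fin s) (n : ℤ) (h : Real.ofDigits a + n ≠ 0) :
      Veval s (τ a) = Veval s (τ (expansion s (fun y => ⌊y⌋) (Real.ofDigits a + n))) := by
    rcases eq_expansion_ofDigits hs a with ha | ha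
    · rw [expansion_add_intCast isRounding_floor, ← ha]
    · rw [Veval_map_expansion_floor_eq_ceil hp hps hpow hτ hcomm h,
        expansion_add_intCast isRounding_ceil_sub_one, ← ha]
  have hfactor (a b : ℕ → Fin s) (hab : Veval s a = Veval s b) :
      Veval s (τ a) = Veval s (τ b) := by
    rw [Veval_eq_ofDigits, Veval_eq_ofDigits, ← sub_eq_zero, ← AddCircle.coe_sub,
      AddCircle.coe_eq_zero_iff] at hab
    obtain ⟨n, hn⟩ := hab
    have ha : Real.ofDigits a + (1 : ℤ) = Real.ofDigits b + (n + 1 : ℤ) := by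
      simp only [zsmul_eq_mul, mul_one] at hn
      push_cast
      linarith
    have hpos : Real.ofDigits a + (1 : ℤ) ≠ 0 := by
      have := Real.ofDigits_nonneg a
      push_cast
      positivity
    rw [hfloor a 1 hpos, hfloor b (n + 1) (ha ▸ hpos), ha]
  have hsurj := surjective_Veval hs
  have hlift : (fun t => Veval s (τ (Function.surjInv hsurj t))) ∘ Veval s = Veval s ∘ τ :=
    funext fun a => hfactor _ _ (Function.surjInv_eq hsurj _)
  refine ⟨_, ?_, hlift⟩
  rw [(Topology.IsQuotientMap.of_surjective_continuous hsurj (continuous_Veval s)).continuous_iff,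
    hlift]
  exact (continuous_Veval s).comp hτ.1
end

section
/- For any prime power p^m, the semigroup LCAT(𝔽_{p^m}^ℕ) of all linear cellular automaton transformations over the finite field 𝔽_{p^m} has the ID property: every closed LCAT(𝔽_{p^m}^ℕ)-invariant proper subset of 𝔽_{p^m}^ℕ is finite. -/
/-- The linear recurrence `∑ i, c i * a (i + k) = 0` for all `k`. -/
def SatisfiesRecurrence {F : Type} [Field F] {n : ℕ} (c : Fin n → F) (a : ℕ → F) : Prop :=
  ∀ k : ℕ, ∑ i : Fin n, c i * a (i + k) = 0

/-- A solution of a nontrivial linear recurrence whose initial segment vanishes is zero. -/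
theorem SatisfiesRecurrence.eq_zero {F : Type} [Field F] {n : ℕ} {c : Fin n → F} (hc : c ≠ 0)
    {d : ℕ → F} (hd : SatisfiesRecurrence c d) (h0 : ∀ i < n, d i = 0) : d = 0 := by
  classical
  obtain ⟨i₀, hi₀⟩ := Function.ne_iff.mp hc
  obtain ⟨j, hj, hmax⟩ := (Finset.univ.filter (fun i => c i ≠ 0)).exists_max_image id
    ⟨i₀, by simpa using hi₀⟩
  have hj : c j ≠ 0 := by simpa using hj
  funext m
  induction m using Nat.strong_induction_on with
  | _ m ih =>
    by_cases hm : m < n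
    · exact h0 m hm
    have hjn := j.2
    have key := hd (m - j)
    rw [Finset.sum_eq_single j] at key
    · rw [show (j : ℕ) + (m - j) = m by omega] at key
      exact (mul_eq_zero.mp key).resolve_left hj
    · intro i _ hij
      by_cases hci : c i = 0
      · rw [hci, zero_mul]
      · have hle : i ≤ j := hmax i (by simpa using hci)
        have hlt : (i : ℕ) < j := lt_of_le_of_ne hle (Fin.val_ne_of_ne hij)
        rw [ih (i + (m - j)) (by omega), Pi.zero_apply, mul_zero]
    · simp

/-- A nontrivial linear recurrence over a finite field has finitely many solutions. -/
theorem finite_setOf_satisfiesRecurrence {F : Type} [Field F] [Finite F] {n : ℕ} {c : Fin n → F}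
    (hc : c ≠ 0) : {a : ℕ → F | SatisfiesRecurrence c a}.Finite := by
  refine Set.Finite.of_finite_image (f := fun a (i : Fin n) => a i) (Set.toFinite _) ?_
  intro a ha b hb hab
  refine sub_eq_zero.mp (SatisfiesRecurrence.eq_zero hc (d := a - b) (fun k => ?_) fun i hi => ?_)
  · simp only [Pi.sub_apply, mul_sub, Finset.sum_sub_distrib]
    rw [ha k, hb k, sub_zero]
  · exact sub_eq_zero.mpr (congrFun hab ⟨i, hi⟩)

/-- The polynomial `∑ k, l k * σ ^ k` in the shift is a linear cellular automaton
transformation. -/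
theorem isCAT_and_isLinearMap_shiftPolynomial {F : Type} [Field F] [TopologicalSpace F]
    [DiscreteTopology F] (l : ℕ →₀ F) :
    IsCAT F (fun y j => l.sum fun k r => r * y (j + k)) ∧
      IsLinearMap F (fun (y : ℕ → F) j => l.sum fun k r => r * y (j + k)) := by
  refine ⟨⟨?_, ?_⟩, ⟨?_, ?_⟩⟩
  · refine continuous_pi fun j => continuous_finsetSum _ fun k _ => ?_
    exact continuous_of_discreteTopology.comp (continuous_apply (j + k))
  · funext y j
    simp only [Function.comp_apply, shiftN, Nat.add_right_comm]
  · intro x y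
    funext j
    simp [mul_add, Finsupp.sum, Finset.sum_add_distrib]
  · intro r y
    funext j
    simp [Finsupp.sum, Finset.mul_sum, mul_left_comm]

/-- Either every word of length `n` starts the image of `a` under some linear cellular automaton
transformation, or `a` satisfies a nontrivial linear recurrence with `n` terms. -/
theorem exists_LCAT_prefix_or_satisfiesRecurrence {F : Type} [Field F] [TopologicalSpace F]
    [DiscreteTopology F] {n : ℕ} (w : Fin n → F) (a : ℕ → F) :
    (∃ τ : (ℕ → F) → (ℕ → F), (IsCAT F τ ∧ IsLinearMap F τ) ∧ ∀ i : Fin n, τ a i = w i) ∨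
      ∃ c : Fin n → F, c ≠ 0 ∧ SatisfiesRecurrence c a := by
  let W := Submodule.span F (Set.range fun (k : ℕ) (i : Fin n) => a (i + k))
  by_cases hW : W = ⊤
  · left
    have hw : w ∈ W := hW ▸ Submodule.mem_top
    obtain ⟨l, hl⟩ := Finsupp.mem_span_range_iff_exists_finsupp.mp hw
    refine ⟨_, isCAT_and_isLinearMap_shiftPolynomial l, fun i => ?_⟩
    simp [← hl, Finsupp.sum]
  · right
    obtain ⟨f, hf, hWf⟩ := Submodule.exists_le_ker_of_lt_top W (lt_top_iff_ne_top.mpr hW)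
    refine ⟨fun i => f (Pi.single i 1), fun h => hf ?_, fun k => ?_⟩
    · ext i
      simpa using congrFun h i
    · have hk : f (fun i : Fin n => a (i + k)) = 0 :=
        hWf (Submodule.subset_span (Set.mem_range_self k))
      classical
      rw [LinearMap.pi_apply_eq_sum_univ] at hk
      rw [← hk]
      refine Finset.sum_congr rfl fun i _ => ?_
      rw [smul_eq_mul, mul_comm]
      congr 1
      refine congrArg f (funext fun j => ?_)
      simp [Pi.single_apply, eq_comm]

/-- A point outside a closed set of sequences is separated from it by a finite prefix. -/
theorem exists_prefix_separating {F : Type} [TopologicalSpace F] {A : Set (ℕ → F)}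
    (hA : IsClosed A) {x : ℕ → F} (hx : x ∉ A) :
    ∃ n : ℕ, ∀ y : ℕ → F, (∀ i : Fin n, y i = x i) → y ∉ A := by
  obtain ⟨I, u, hu, hsub⟩ := isOpen_pi_iff.mp hA.isOpen_compl x hx
  refine ⟨I.sup id + 1, fun y hy => hsub fun i hi => ?_⟩
  rw [hy ⟨i, Nat.lt_succ_of_le (Finset.le_sup (f := id) hi)⟩]
  exact (hu i hi).2

/-- For any finite field `F` (with the discrete topology), the semigroup
`LCAT(F^ℕ)` of all `F`-linear cellular automaton transformations has the ID property. -/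
theorem LCAT_finite_field_ID (F : Type) [Field F] [Fintype F]
    [TopologicalSpace F] [DiscreteTopology F] :
    HasID {τ : (ℕ → F) → (ℕ → F) | IsCAT F τ ∧ IsLinearMap F τ} := by
  intro A hA hinv hne
  obtain ⟨x, hx⟩ := (Set.ne_univ_iff_exists_notMem A).mp hne
  obtain ⟨n, hn⟩ := exists_prefix_separating hA hx
  refine ((Set.toFinite {c : Fin n → F | c ≠ 0}).biUnion
    fun c hc => finite_setOf_satisfiesRecurrence hc).subset fun a ha => ?_
  obtain ⟨τ, hτ, hτa⟩ | ⟨c, hc, hca⟩ :=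
    exists_LCAT_prefix_or_satisfiesRecurrence (fun i : Fin n => x i) a
  · exact absurd (hinv τ hτ a ha) (hn _ hτa)
  · exact Set.mem_biUnion (show c ∈ {c : Fin n → F | c ≠ 0} from hc) hca
end

section
/- For s ≥ 2, identify Λ_s with the ring ℤ/sℤ. The semigroup LCAT(Λ_s^ℕ) of all linear cellular automaton transformations has the ID property if and only if s is prime. -/
/-- A finitely supported family of coefficients `c` defines the linear cellular automaton
transformation `∑ k, c k • σ ^ k`. -/
theorem isCAT_and_isLinearMap_finsupp_sum {R : Type} [CommRing R] [TopologicalSpace R]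
    [IsTopologicalRing R] (c : ℕ →₀ R) :
    IsCAT R (fun x j => c.sum fun k a => a * x (j + k)) ∧
      IsLinearMap R (fun (x : ℕ → R) j => c.sum fun k a => a * x (j + k)) := by
  refine ⟨⟨?_, ?_⟩, ?_, ?_⟩
  · unfold Finsupp.sum
    fun_prop
  · funext x j
    simp [shiftN, Finsupp.sum, add_right_comm]
  · intro x y
    funext j
    simp [Finsupp.sum, mul_add, Finset.sum_add_distrib]
  · intro r x
    funext j
    simp [Finsupp.sum, Finset.mul_sum, mul_left_comm]

/-- A linear endomorphism preserves the elements annihilated by a scalar. -/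
theorem IsLinearMap.smul_apply_eq_zero {R M : Type*} [CommRing R] [AddCommGroup M] [Module R M]
    {τ : M → M} (h : IsLinearMap R τ) {a : R} {x : M} (hx : a • x = 0) : a • τ x = 0 := by
  rw [← h.map_smul, hx, h.map_zero]

/-- A point outside a closed set of sequences is separated from it by
one of its prefixes. -/
theorem IsClosed.exists_prefix_disjoint {A : Type} [TopologicalSpace A]
    {C : Set (ℕ → A)} (hC : IsClosed C) {w : ℕ → A} (hw : w ∉ C) :
    ∃ n, ∀ x ∈ C, ∃ i < n, x i ≠ w i := by
  obtain ⟨I, u, hu, hsub⟩ := isOpen_pi_iff.1 hC.isOpen_compl w hw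
  refine ⟨I.sup id + 1, fun x hx => ?_⟩
  by_contra! h
  refine hsub (fun i hi => ?_) hx
  rw [h i (Nat.lt_succ_of_le (Finset.le_sup (f := id) hi))]
  exact (hu i hi).2

/-- Over a finite field, a nonzero linear recurrence has only finitely many solutions. -/
theorem finite_setOf_linear_recurrence {F : Type} [Field F] [Finite F] {n : ℕ}
    {f : Module.Dual F (Fin n → F)} (hf : f ≠ 0) :
    {x : ℕ → F | ∀ k, f (fun i => x (i + k)) = 0}.Finite := by
  classical
  let e : Fin n → F := fun i => f fun j => if i = j then 1 else 0
  have hsum : ∀ v, f v = ∑ i, v i * e i := f.pi_apply_eq_sum_univ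
  have he : (Finset.univ.filter fun i => e i ≠ 0).Nonempty := by
    by_contra h
    rw [Finset.not_nonempty_iff_eq_empty, Finset.filter_eq_empty_iff] at h
    refine hf (LinearMap.ext fun v => ?_)
    rw [hsum]
    exact Finset.sum_eq_zero fun i hi => by rw [not_not.1 (h hi), mul_zero]
  obtain ⟨d, hd, hmax⟩ := Finset.exists_max_image _ id he
  replace hd : e d ≠ 0 := (Finset.mem_filter.1 hd).2
  have hgt : ∀ i, d < i → e i = 0 := fun i hi => by
    by_contra hne
    exact absurd (hmax i (by simp [hne])) (not_le.2 hi)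
  refine Set.Finite.of_injOn (f := fun x (i : Fin n) => x i) (t := Set.univ)
    (fun _ _ => Set.mem_univ _) ?_ Set.finite_univ
  intro x hx y hy hxy
  funext m
  induction m using Nat.strong_induction_on with
  | _ m ih =>
    rcases lt_or_ge m n with hm | hm
    · exact congrFun hxy ⟨m, hm⟩
    have hdm : (d : ℕ) + (m - d) = m := by omega
    have h : ∑ i : Fin n, (x (i + (m - d)) - y (i + (m - d))) * e i = 0 := by
      simp_rw [sub_mul, Finset.sum_sub_distrib]
      rw [← hsum fun i => x (i + (m - d)), ← hsum fun i => y (i + (m - d)), hx, hy, sub_zero]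
    rw [Finset.sum_eq_single d, hdm] at h
    · exact sub_eq_zero.1 ((mul_eq_zero.1 h).resolve_right hd)
    · intro i _ hid
      rcases lt_or_gt_of_ne hid with hlt | hlt
      · rw [ih _ (by omega), sub_self, zero_mul]
      · rw [hgt i hlt, mul_zero]
    · simp

/-- For `s ≥ 2`, identifying `Λ_s` with the ring `ℤ/sℤ`, the semigroup
`LCAT(Λ_s^ℕ)` of all `ℤ/sℤ`-linear cellular automaton transformations has the ID property
iff `s` is prime. -/
theorem LCAT_ZMod_ID_iff (s : ℕ) (hs : 2 ≤ s) :
    HasID {τ : (ℕ → ZMod s) → (ℕ → ZMod s) | IsCAT (ZMod s) τ ∧ IsLinearMap (ZMod s) τ} ↔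
      s.Prime := by
  constructor
  · intro h
    by_contra hp
    obtain ⟨a, ⟨b, rfl⟩, ha, hab⟩ := (Nat.not_prime_iff_exists_dvd_lt hs).1 hp
    have hane : (a : ZMod (a * b)) ≠ 0 := fun h0 =>
      absurd (Nat.le_of_dvd (by omega) ((ZMod.natCast_eq_zero_iff _ _).1 h0)) (by omega)
    have hbne : (b : ZMod (a * b)) ≠ 0 := fun h0 => by
      have hb : 0 < b := by rcases b.eq_zero_or_pos with rfl | hb <;> omega
      have := Nat.le_of_dvd hb ((ZMod.natCast_eq_zero_iff _ _).1 h0)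
      nlinarith
    have hfin := h {x | (a : ZMod (a * b)) • x = 0}
      (isClosed_eq (by fun_prop) continuous_const)
      (fun τ hτ x hx => hτ.2.smul_apply_eq_zero hx)
      (fun hu => hane (by
        simpa using congrFun ((Set.eq_univ_iff_forall.1 hu) (fun _ => 1)) 0))
    refine Set.infinite_of_injective_forall_mem
      (f := fun n : ℕ => Pi.single n (b : ZMod (a * b))) ?_ ?_ hfin
    · intro m n hmn
      by_contra hne
      have := congrFun hmn m
      simp [hne, hbne] at this
    · intro n
      simp only [Set.mem_ofPred_eq, ← Pi.single_smul, smul_eq_mul, ← Nat.cast_mul,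
        ZMod.natCast_self, Pi.single_zero]
  · intro hp C hC hinv hne
    have : Fact s.Prime := ⟨hp⟩
    obtain ⟨w, hw⟩ := (Set.ne_univ_iff_exists_notMem C).1 hne
    obtain ⟨n, hn⟩ := hC.exists_prefix_disjoint hw
    have : Finite (Module.Dual (ZMod s) (Fin n → ZMod s)) :=
      Module.finite_of_finite (ZMod s)
    refine (Set.finite_iUnion fun f : {f : Module.Dual (ZMod s) (Fin n → ZMod s) // f ≠ 0} =>
      finite_setOf_linear_recurrence f.2).subset fun x hx => ?_
    have hlt : Submodule.span (ZMod s)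
        (Set.range fun (k : ℕ) (i : Fin n) => x (i + k)) < ⊤ := by
      refine lt_top_iff_ne_top.2 fun htop => ?_
      obtain ⟨c, hc⟩ := Finsupp.mem_span_range_iff_exists_finsupp.1
        (htop ▸ Submodule.mem_top : (fun i : Fin n => w i) ∈ _)
      obtain ⟨i, hi, hne⟩ := hn _ (hinv _ (isCAT_and_isLinearMap_finsupp_sum c) x hx)
      refine hne ?_
      simpa [Finsupp.sum] using congrFun hc ⟨i, hi⟩
    obtain ⟨f, hf, hle⟩ := Submodule.exists_le_ker_of_lt_top _ hlt
    exact Set.mem_iUnion.2 ⟨⟨f, hf⟩, fun k => hle (Submodule.subset_span ⟨k, rfl⟩)⟩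
end

section
/- For any prime power p^m, the semigroup LCAT(𝔽_{p^m}^ℕ) of all linear cellular automaton transformations over the finite field 𝔽_{p^m} is maximal commutative in CAT(𝔽_{p^m}^ℕ). -/
/-- A continuous map from sequences over a discrete alphabet to a discrete space depends, near
a given sequence, only on finitely many initial coordinates. -/
theorem exists_forall_eq_of_forall_lt {A B : Type*} [TopologicalSpace A] [DiscreteTopology A]
    [TopologicalSpace B] [DiscreteTopology B] {f : (ℕ → A) → B} (hf : Continuous f) (x : ℕ → A) :
    ∃ n, ∀ m, n ≤ m → ∀ y : ℕ → A, (∀ i < m, y i = x i) → f y = f x := by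
  obtain ⟨s, u, hu, hs⟩ :=
    isOpen_pi_iff.mp ((isOpen_discrete {f x}).preimage hf) x rfl
  refine ⟨s.sup id + 1, fun m hm y hy => hs fun i hi => ?_⟩
  have hi' : i ≤ s.sup id := Finset.le_sup (f := id) hi
  rw [hy i (by omega)]
  exact (hu i hi).2

theorem shiftN_iterate_apply (A : Type) (n : ℕ) (a : ℕ → A) (k : ℕ) :
    (shiftN A)^[n] a k = a (k + n) := by
  induction n generalizing k with
  | zero => rfl
  | succ n ih =>
    rw [Function.iterate_succ_apply']
    exact (ih (k + 1)).trans (congrArg a (by omega))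

theorem continuous_shiftN_iterate {A : Type} [TopologicalSpace A] (n : ℕ) :
    Continuous (shiftN A)^[n] :=
  Continuous.iterate (continuous_pi fun k => continuous_apply (k + 1)) n

theorem isLinearMap_add_shiftN_iterate {F : Type} [Field F] (n : ℕ) :
    IsLinearMap F (fun a : ℕ → F => a + (shiftN F)^[n] a) := by
  constructor
  · intro a b
    funext k
    simp only [Pi.add_apply, shiftN_iterate_apply]
    ring
  · intro c a
    funext k
    simp only [Pi.add_apply, Pi.smul_apply, smul_eq_mul, shiftN_iterate_apply]
    ring

theorem map_shiftN_iterate {A : Type} {τ : (ℕ → A) → (ℕ → A)}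
    (hτ : τ ∘ shiftN A = shiftN A ∘ τ) (n : ℕ) (a : ℕ → A) :
    τ ((shiftN A)^[n] a) = (shiftN A)^[n] (τ a) :=
  (Function.Commute.iterate_right (f := τ) (g := shiftN A) (congrFun hτ) n) a

theorem apply_eq_apply_shiftN_iterate_zero {A : Type} {τ : (ℕ → A) → (ℕ → A)}
    (hτ : τ ∘ shiftN A = shiftN A ∘ τ) (a : ℕ → A) (k : ℕ) :
    τ a k = τ ((shiftN A)^[k] a) 0 := by
  rw [map_shiftN_iterate hτ, shiftN_iterate_apply, zero_add]

section Linear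

variable {F : Type} [Field F] [TopologicalSpace F] [DiscreteTopology F]

/-- A linear cellular automaton transformation is a polynomial in the shift. -/
theorem exists_eq_sum_shiftN_iterate {τ : (ℕ → F) → (ℕ → F)} (hτ : IsCAT F τ)
    (hlin : IsLinearMap F τ) :
    ∃ (n : ℕ) (c : ℕ → F), ∀ a, τ a = ∑ i ∈ Finset.range n, c i • (shiftN F)^[i] a := by
  obtain ⟨n, hn⟩ := exists_forall_eq_of_forall_lt ((continuous_apply 0).comp hτ.1) 0
  have hzero : ∀ a, τ a 0 = ∑ i ∈ Finset.range n, τ (Pi.single i 1) 0 * a i := by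
    intro a
    have h := hn n le_rfl (a - ∑ i ∈ Finset.range n, a i • Pi.single i (1 : F)) (by
      intro j hj
      simp [Finset.sum_apply, Pi.single_apply, hj])
    have hsum : τ (∑ i ∈ Finset.range n, a i • Pi.single i (1 : F)) =
        ∑ i ∈ Finset.range n, a i • τ (Pi.single i 1) := by
      have h := map_sum (hlin.mk' τ) (fun i => a i • Pi.single i (1 : F)) (Finset.range n)
      simpa only [IsLinearMap.mk'_apply, hlin.map_smul] using h
    simp only [Function.comp_apply, hlin.map_sub, hlin.map_zero, hsum, Pi.sub_apply,
      Pi.zero_apply, sub_eq_zero, Finset.sum_apply, Pi.smul_apply, smul_eq_mul] at h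
    rw [h]
    exact Finset.sum_congr rfl fun i _ => mul_comm _ _
  refine ⟨n, fun i => τ (Pi.single i 1) 0, fun a => funext fun k => ?_⟩
  rw [apply_eq_apply_shiftN_iterate_zero hτ.2, hzero]
  simp [shiftN_iterate_apply, add_comm k]

theorem linear_comp_comm {τ μ : (ℕ → F) → (ℕ → F)} (hτ : IsCAT F τ) (hτlin : IsLinearMap F τ)
    (hμ : IsCAT F μ) (hμlin : IsLinearMap F μ) : τ ∘ μ = μ ∘ τ := by
  obtain ⟨n, c, hc⟩ := exists_eq_sum_shiftN_iterate hτ hτlin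
  funext a
  have hsum := map_sum (hμlin.mk' μ) (fun i => c i • (shiftN F)^[i] a) (Finset.range n)
  simp only [IsLinearMap.mk'_apply, hμlin.map_smul, map_shiftN_iterate hμ.2] at hsum
  simp only [Function.comp_apply, hc, hsum]

theorem isCAT_smul (c : F) : IsCAT F (fun a => c • a) :=
  ⟨continuous_pi fun k => continuous_of_discreteTopology.comp
    (g := fun x : F => c * x) (continuous_apply k), rfl⟩

theorem isCAT_add_shiftN_iterate (n : ℕ) : IsCAT F (fun a => a + (shiftN F)^[n] a) := by
  refine ⟨continuous_pi fun k => ?_, ?_⟩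
  · exact continuous_of_discreteTopology.comp (g := fun x : F × F => x.1 + x.2)
      ((continuous_apply k).prodMk ((continuous_apply k).comp (continuous_shiftN_iterate n)))
  · funext a k
    simp [shiftN_iterate_apply, shiftN, add_right_comm k n 1]

/-- If a cellular automaton transformation commutes with `1 + σ ^ n` for all `n`, then it is
additive: prepend a long initial segment of `x` to `y` and apply `1 + σ ^ n`. -/
theorem map_add_of_comm_add_shiftN_iterate {μ : (ℕ → F) → (ℕ → F)} (hμ : IsCAT F μ)
    (hcomm : ∀ n a, μ (a + (shiftN F)^[n] a) = μ a + (shiftN F)^[n] (μ a)) (x y : ℕ → F) :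
    μ (x + y) = μ x + μ y := by
  have hzero : ∀ x y : ℕ → F, μ (x + y) 0 = μ x 0 + μ y 0 := by
    intro x y
    have hcont : Continuous fun a => μ a 0 := (continuous_apply 0).comp hμ.1
    obtain ⟨n₁, h₁⟩ := exists_forall_eq_of_forall_lt hcont x
    obtain ⟨n₂, h₂⟩ := exists_forall_eq_of_forall_lt hcont (x + y)
    set n := max n₁ n₂
    set a : ℕ → F := fun i => if i < n then x i else y (i - n)
    have ha : (shiftN F)^[n] a = y := by
      funext k
      simp [shiftN_iterate_apply, a]
    have hax : ∀ i < n, a i = x i := fun i hi => if_pos hi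
    have h := congrFun (hcomm n a) 0
    rw [← map_shiftN_iterate hμ.2, ha, Pi.add_apply, h₁ n (le_max_left _ _) a hax] at h
    rw [← h]
    exact (h₂ n (le_max_right _ _) (a + y) fun i hi => by simp [hax i hi]).symm
  have hshift : ∀ k, (shiftN F)^[k] (x + y) = (shiftN F)^[k] x + (shiftN F)^[k] y := by
    intro k
    funext i
    simp [shiftN_iterate_apply]
  funext k
  rw [Pi.add_apply, apply_eq_apply_shiftN_iterate_zero hμ.2, hshift, hzero,
    ← apply_eq_apply_shiftN_iterate_zero hμ.2, ← apply_eq_apply_shiftN_iterate_zero hμ.2]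

end Linear

/-- For any finite field `F` (with the discrete topology), the semigroup
`LCAT(F^ℕ)` of all `F`-linear cellular automaton transformations is maximal commutative
in `CAT(F^ℕ)`. -/
theorem LCAT_finite_field_MC (F : Type) [Field F] [Fintype F]
    [TopologicalSpace F] [DiscreteTopology F] :
    IsMC (CATset F) {τ : (ℕ → F) → (ℕ → F) | IsCAT F τ ∧ IsLinearMap F τ} := by
  refine ⟨fun τ hτ => hτ.1, fun τ hτ μ hμ => linear_comp_comm hτ.1 hτ.2 hμ.1 hμ.2,
    fun μ hμ hcomm => ⟨hμ, ?_, ?_⟩⟩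
  · exact map_add_of_comm_add_shiftN_iterate hμ fun n =>
      congrFun (hcomm _ ⟨isCAT_add_shiftN_iterate n, isLinearMap_add_shiftN_iterate n⟩)
  · exact fun c =>
      congrFun (hcomm _ ⟨isCAT_smul c, IsLinearMap.isLinearMap_smul c⟩)
end

section
/- Let a ∈ Λ_s^ℕ be b,c-eventually periodic. Then there exists k ∈ ℕ such that the words a_{[i,i+k)} for i = 0, 1, …, b+c−2 are pairwise distinct, i.e. a_{[i,i+k)} ≠ a_{[j,j+k)} for all i ≠ j < b+c−1. -/
/-- The word `a_{[i,i+k)} = a_i a_{i+1} … a_{i+k-1}` of length `k` starting at `i`. -/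
def word {A : Type} (a : ℕ → A) (i k : ℕ) : Fin k → A := fun t => a (i + t.1)

/-- `a` is a periodic sequence (some positive period). -/
def IsPeriodicSeq {A : Type} (a : ℕ → A) : Prop := ∃ c, 0 < c ∧ ∀ n, a (n + c) = a n

/-- `a` is `c`-periodic: `c` is the minimal positive integer with `a_n = a_{n+c}` for all `n`. -/
def IsPeriodicC {A : Type} (a : ℕ → A) (c : ℕ) : Prop :=
  (0 < c ∧ ∀ n, a (n + c) = a n) ∧ ∀ c', 0 < c' → (∀ n, a (n + c') = a n) → c ≤ c'

/-- `a` is `b,c`-eventually periodic: `σ^b(a)` is `c`-periodic but `σ^{b-1}(a)` is not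
periodic. -/
def IsEvPeriodicBC {A : Type} (a : ℕ → A) (b c : ℕ) : Prop :=
  IsPeriodicC ((shiftN A)^[b] a) c ∧ (0 < b → ¬ IsPeriodicSeq ((shiftN A)^[b - 1] a))

theorem iterate_shiftN_apply {A : Type} (a : ℕ → A) (b n : ℕ) :
    (shiftN A)^[b] a n = a (n + b) := by
  induction b generalizing n with
  | zero => rfl
  | succ b ih =>
    rw [Function.iterate_succ_apply']
    exact (ih (n + 1)).trans (congrArg a (by omega))

/-- The shifts `σ^i(a)` and `σ^j(a)`, `i < j < b + c`, of a `b,c`-eventually periodic sequence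
differ. -/
theorem IsEvPeriodicBC.exists_ne {A : Type} {a : ℕ → A} {b c : ℕ} (h : IsEvPeriodicBC a b c)
    {i j : ℕ} (hij : i < j) (hj : j < b + c) : ∃ t, a (i + t) ≠ a (j + t) := by
  obtain ⟨⟨⟨hc, hper⟩, hmin⟩, hnot⟩ := h
  simp only [IsPeriodicSeq, iterate_shiftN_apply] at hper hmin hnot
  by_contra! heq
  have hshift : ∀ n, i ≤ n → a (n + (j - i)) = a n := fun n hn => by
    have := heq (n - i)
    rw [show i + (n - i) = n by omega, show j + (n - i) = n + (j - i) by omega] at this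
    exact this.symm
  rcases lt_or_ge i b with hib | hib
  · refine hnot (by omega) ⟨j - i, by omega, fun n => ?_⟩
    rw [← hshift (n + (b - 1)) (by omega)]
    exact congrArg a (by omega)
  · have hmul : ∀ m n, a (n + m * c + b) = a (n + b) := fun m n => by
      induction m with
      | zero => simp
      | succ m ih => rw [← ih, ← hper (n + m * c)]; exact congrArg a (by ring)
    have hle : i ≤ i * c := Nat.le_mul_of_pos_right i hc
    have := hmin (j - i) (by omega) fun n => by
      rw [← hmul i n, ← hmul i (n + (j - i)), ← hshift (n + i * c + b) (by omega)]
      exact congrArg a (by omega)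
    omega

/-- If `a ∈ Λ_s^ℕ` is `b,c`-eventually periodic, then there exists `k`
such that the words `a_{[i,i+k)}`, `i = 0, …, b+c−2`, are pairwise distinct. -/
theorem evPeriodic_words_distinct (s : ℕ) (hs : 2 ≤ s) (a : ℕ → Fin s) (b c : ℕ)
    (h : IsEvPeriodicBC a b c) :
    ∃ k, ∀ i j, i < b + c - 1 → j < b + c - 1 → i ≠ j → word a i k ≠ word a j k := by
  have hex : ∀ i j, ∃ t, i < j → j < b + c → a (i + t) ≠ a (j + t) := fun i j => by
    by_cases hij : i < j ∧ j < b + c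
    · obtain ⟨t, ht⟩ := h.exists_ne hij.1 hij.2
      exact ⟨t, fun _ _ => ht⟩
    · exact ⟨0, fun h₁ h₂ => (hij ⟨h₁, h₂⟩).elim⟩
  choose t ht using hex
  let S := Finset.range (b + c) ×ˢ Finset.range (b + c)
  have key : ∀ i j, i < j → j < b + c →
      word a i (S.sup (fun p => t p.1 p.2) + 1) ≠ word a j (S.sup (fun p => t p.1 p.2) + 1) := by
    intro i j hij hj heq
    have hle : t i j ≤ S.sup (fun p => t p.1 p.2) :=
      Finset.le_sup (f := fun p : ℕ × ℕ => t p.1 p.2) (b := (i, j))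
        (Finset.mk_mem_product (Finset.mem_range.2 (hij.trans hj)) (Finset.mem_range.2 hj))
    exact ht i j hij hj (congrFun heq ⟨t i j, Nat.lt_succ_of_le hle⟩)
  refine ⟨S.sup (fun p => t p.1 p.2) + 1, fun i j hi hj hne => ?_⟩
  rcases hne.lt_or_gt with hlt | hlt
  · exact key i j hlt (by omega)
  · exact (key j i hlt (by omega)).symm
end

section
/- For every s ≥ 2, the semigroup CAT(Λ_s^ℕ) of all cellular automaton transformations has the ID property: every closed CAT(Λ_s^ℕ)-invariant proper subset of Λ_s^ℕ is finite. -/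
/-- Sequences with preperiod `i` and period `j - i` are determined by their first `j` letters,
so there are only finitely many of them. -/
theorem finite_setOf_eventually_periodic {A : Type} [Finite A] {i j : ℕ} (hij : i < j) :
    {x : ℕ → A | ∀ k, x (k + i) = x (k + j)}.Finite := by
  refine Set.Finite.of_finite_image (f := fun x (k : Fin j) => x k) (Set.toFinite _) ?_
  intro x hx y hy hxy
  funext m
  induction m using Nat.strong_induction_on with
  | _ m ih =>
    by_cases hm : m < j
    · exact congrFun hxy ⟨m, hm⟩
    · have h : m - j + j = m := by omega
      have hxm := hx (m - j)
      have hym := hy (m - j)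
      rw [h] at hxm hym
      rw [← hxm, ← hym]
      exact ih _ (by omega)

/-- An infinite set of sequences contains, for every `N`, a sequence whose first `N` shifts are
pairwise distinct. -/
theorem exists_mem_injective_shifts {A : Type} [Finite A] {S : Set (ℕ → A)} (hS : S.Infinite)
    (N : ℕ) : ∃ x ∈ S, Function.Injective fun (i : Fin N) (k : ℕ) => x (k + i) := by
  by_contra! h
  refine hS (Set.Finite.subset (Set.finite_iUnion fun p : {p : Fin N × Fin N // p.1 < p.2} =>
    finite_setOf_eventually_periodic (A := A) (Fin.lt_def.mp p.2)) ?_)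
  intro x hx
  obtain ⟨i, j, hij, hne⟩ := Function.not_injective_iff.mp (h x hx)
  rcases lt_or_gt_of_ne hne with hlt | hlt
  · exact Set.mem_iUnion.mpr ⟨⟨(i, j), hlt⟩, fun k => congrFun hij k⟩
  · exact Set.mem_iUnion.mpr ⟨⟨(j, i), hlt⟩, fun k => (congrFun hij k).symm⟩

/-- Finitely many distinct sequences are already distinguished by a window of finite length. -/
theorem exists_injective_window {A ι : Type} [Finite ι] {f : ι → ℕ → A}
    (hf : Function.Injective f) :
    ∃ n : ℕ, Function.Injective fun (i : ι) (k : Fin n) => f i k := by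
  have h : ∀ p : ι × ι, ∃ k, f p.1 k = f p.2 k → p.1 = p.2 := by
    intro p
    by_contra! hp
    exact (hp 0).2 (hf (funext fun k => (hp k).1))
  choose k hk using h
  obtain ⟨n, hn⟩ := (Set.finite_range k).bddAbove
  refine ⟨n + 1, fun i j hij => hk (i, j) ?_⟩
  exact congrFun hij ⟨k (i, j), Nat.lt_succ_of_le (hn ⟨(i, j), rfl⟩)⟩

/-- A block map `G` with window length `n` induces a cellular automaton transformation. -/
theorem isCAT_of_blockMap {A : Type} [TopologicalSpace A] [DiscreteTopology A] {n : ℕ}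
    (G : (Fin n → A) → A) : IsCAT A fun y m => G fun l => y (l + m) := by
  refine ⟨continuous_pi fun m => (continuous_of_discreteTopology (f := G)).comp
    (continuous_pi fun l => continuous_apply _), ?_⟩
  funext y m
  simp only [Function.comp_apply, shiftN, add_assoc]

/-- If the first `N` shifts of `x` are distinct, then some cellular automaton transformation maps
`x` to a sequence whose first `N` letters are prescribed. -/
theorem exists_isCAT_apply_eq {A : Type} [TopologicalSpace A] [DiscreteTopology A] {N : ℕ}
    {x : ℕ → A} (hx : Function.Injective fun (i : Fin N) (k : ℕ) => x (k + i)) (y : ℕ → A) :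
    ∃ τ, IsCAT A τ ∧ ∀ m < N, τ x m = y m := by
  obtain ⟨n, hn⟩ := exists_injective_window hx
  exact ⟨_, isCAT_of_blockMap (Function.extend _ (fun i : Fin N => y i) fun _ => y 0),
    fun m hm => hn.extend_apply _ _ ⟨m, hm⟩⟩

/-- For every `s ≥ 2`, the semigroup `CAT(Λ_s^ℕ)` of all cellular
automaton transformations has the ID property. -/
theorem CAT_is_ID (s : ℕ) (hs : 2 ≤ s) : HasID (CATset (Fin s)) := by
  intro S hclosed hinv hne
  by_contra hS
  refine hne (Set.eq_univ_of_forall fun y => ?_)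
  have h : ∀ N : ℕ, ∃ z ∈ S, ∀ m < N, z m = y m := by
    intro N
    obtain ⟨x, hxS, hx⟩ := exists_mem_injective_shifts hS N
    obtain ⟨τ, hτ, hτx⟩ := exists_isCAT_apply_eq hx y
    exact ⟨τ x, hinv τ hτ x hxS, hτx⟩
  choose z hzS hz using h
  have hlim : Filter.Tendsto z Filter.atTop (nhds y) := by
    refine tendsto_pi_nhds.mpr fun m => tendsto_const_nhds.congr' ?_
    filter_upwards [Filter.eventually_gt_atTop m] with N hN
    exact (hz N m hN).symm
  exact hclosed.mem_of_tendsto hlim (Filter.Eventually.of_forall hzS)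
end

section
/- Let 𝔽_{p^m} be a finite field and let a ∈ 𝔽_{p^m}^ℕ be a rich sequence. Then for every n ∈ ℕ there exists k = k(n) such that the set of vectors {a_{[i,i+k)}}_{i=0}^{n−1} ⊂ 𝔽_{p^m}^k is linearly independent. -/
/-- `a` is a rich sequence: there exist `n_m → ∞` such that for each `m` there exists
`k(m)` with `a_{[i,i+k(m))} ≠ a_{[j,j+k(m))}` for all `i ≠ j < n_m`. -/
def IsRich {A : Type} (a : ℕ → A) : Prop :=
  ∃ n : ℕ → ℕ, Filter.Tendsto n Filter.atTop Filter.atTop ∧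
    ∀ m, ∃ k, ∀ i j, i < n m → j < n m → i ≠ j → word a i k ≠ word a j k

/-- Any two distinct shifts of a rich sequence differ somewhere. -/
theorem IsRich.exists_shift_ne {A : Type} {a : ℕ → A} (ha : IsRich a) {i j : ℕ} (hij : i ≠ j) :
    ∃ t, a (i + t) ≠ a (j + t) := by
  obtain ⟨n, hn, h⟩ := ha
  obtain ⟨m, hm⟩ := (hn.eventually_gt_atTop (max i j)).exists
  obtain ⟨k, hk⟩ := h m
  by_contra! hc
  exact hk i j (by omega) (by omega) hij (funext fun t => hc t)

/-- A sequence satisfying a linear recurrence whose first `n` terms vanish is zero. -/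
theorem eq_zero_of_linear_recurrence {F : Type} [Field F] {n : ℕ} {c : Fin n → F} (hc : c ≠ 0)
    {b : ℕ → F} (hrec : ∀ t, ∑ i, c i * b (i + t) = 0) (hinit : ∀ u < n, b u = 0) (u : ℕ) :
    b u = 0 := by
  classical
  obtain ⟨i₀, hi₀⟩ := Function.ne_iff.mp hc
  obtain ⟨d, hd, hmax⟩ := (Finset.univ.filter fun i => c i ≠ 0).exists_max_image id
    ⟨i₀, by simpa using hi₀⟩
  simp only [Finset.mem_filter, Finset.mem_univ, true_and, id] at hd hmax
  induction u using Nat.strong_induction_on with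
  | _ u ih =>
    by_cases hu : u < n
    · exact hinit u hu
    have hdu : d.1 + (u - d.1) = u := by omega
    have h := hrec (u - d.1)
    rw [Finset.sum_eq_single d, hdu] at h
    · exact (mul_eq_zero.mp h).resolve_left hd
    · intro i _ hid
      by_cases hci : c i = 0
      · rw [hci, zero_mul]
      · have hlt : i.1 < d.1 := lt_of_le_of_ne (hmax i hci) (Fin.val_ne_of_ne hid)
        rw [ih _ (by omega), mul_zero]
    · simp

/-- A rich sequence over a finite field satisfies no nontrivial linear recurrence. -/
theorem IsRich.eq_zero_of_linear_recurrence {F : Type} [Field F] [Finite F] {a : ℕ → F}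
    (ha : IsRich a) {n : ℕ} {c : Fin n → F} (hrec : ∀ t, ∑ i, c i * a (i + t) = 0) : c = 0 := by
  by_contra hc
  obtain ⟨s, t, hst, hw⟩ := Finite.exists_ne_map_eq_of_infinite fun s => word a s n
  obtain ⟨u, hu⟩ := ha.exists_shift_ne hst
  refine hu (sub_eq_zero.mp (_root_.eq_zero_of_linear_recurrence hc
    (b := fun u => a (s + u) - a (t + u)) (fun v => ?_) (fun v hv => ?_) u))
  · simp only [mul_sub, Finset.sum_sub_distrib, add_left_comm s, add_left_comm t, hrec, sub_zero]
  · exact sub_eq_zero.mpr (congrFun hw ⟨v, hv⟩)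

/-- If `a` is a rich sequence over a finite field `F`, then for every
`n` there exists `k = k(n)` such that the vectors `a_{[i,i+k)}`, `i = 0, …, n−1`, are
linearly independent in `F^k`. -/
theorem rich_words_linearIndependent (F : Type) [Field F] [Fintype F]
    (a : ℕ → F) (ha : IsRich a) (n : ℕ) :
    ∃ k, LinearIndependent F (fun i : Fin n => word a i.1 k) := by
  by_contra! h
  simp only [Fintype.linearIndependent_iff, not_forall] at h
  choose c hc i hi using h
  obtain ⟨c₀, hc₀⟩ := Finite.exists_infinite_fiber c
  have hinf : (c ⁻¹' {c₀}).Infinite := Set.infinite_coe_iff.mp hc₀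
  have hzero : c₀ = 0 := ha.eq_zero_of_linear_recurrence fun t => by
    obtain ⟨k, rfl, hk⟩ := hinf.exists_gt t
    simpa [word] using congrFun (hc k) ⟨t, hk⟩
  obtain ⟨k, hk⟩ := hinf.nonempty
  have hk' : c k = c₀ := hk
  exact hi k (by rw [hk', hzero, Pi.zero_apply])
end
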